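/- Let D be a convex drawing of K_n in the plane with star vertex v_⋆, with m ≥ 2 bad edges and a labeling satisfying sidedness and nestedness, bad edges b_i = {v_i, v_i+1} with v_1 < … < v_m, smallest and largest witnesses w_i^L and w_i^R of b_i, and for 1 ≤ i ≤ m−1 let L_i = {x : w_{i+1}^R < x < w_i^L} and R_i = {x : v_i + 1 ≤ x ≤ v_{i+1}}. Then for every i with 1 ≤ i ≤ m−1, no edge {u,v} with u ∈ L_i and v ∈ R_i crosses a star edge {z, v_⋆} with z ∈ R_i. -/

import Mathlib

open Set

/-- Cyclic successor on `Fin m` (indices modulo `m`). -/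
def finCycSucc {m : ℕ} (i : Fin m) : Fin m := ⟨((i : ℕ) + 1) % m, Nat.mod_lt _ i.pos⟩

/-- `p` is a proper (transversal) crossing point of the arcs `α` and `β` : `p` lies on both arcs
and, locally around `p`, the arc `β` has points in two different sides of `α`
(it passes from one side of `α` to the other). -/
def ProperCrossingAt (α β : Set (ℝ × ℝ)) (p : ℝ × ℝ) : Prop :=
  p ∈ α ∩ β ∧
    ∀ U ∈ nhds p, ∃ V ∈ nhds p, V ⊆ U ∧
      ∃ q₁ ∈ β ∩ V, ∃ q₂ ∈ β ∩ V, q₁ ∉ α ∧ q₂ ∉ α ∧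
        connectedComponentIn (V \ α) q₁ ≠ connectedComponentIn (V \ α) q₂

/-- A simple drawing of the complete graph `K n` in the plane: `n` distinct vertex points,
a simple arc joining each pair of distinct vertices, no edge passing through another vertex,
and any two (distinct) edges meeting in at most one point, which is either a common endpoint
or a proper crossing. -/
structure SimpleDrawing (n : ℕ) where
  vert : Fin n → ℝ × ℝ
  vert_inj : Function.Injective vert
  arc : Fin n → Fin n → Set (ℝ × ℝ)
  arc_symm : ∀ i j, arc i j = arc j i
  arc_simple : ∀ i j, i ≠ j → ∃ f : ℝ → ℝ × ℝ,
    ContinuousOn f (Icc (0:ℝ) 1) ∧ InjOn f (Icc (0:ℝ) 1) ∧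
    f '' Icc (0:ℝ) 1 = arc i j ∧ f 0 = vert i ∧ f 1 = vert j
  no_through_vertex : ∀ i j k, i ≠ j → vert k ∈ arc i j → k = i ∨ k = j
  inter_subsingleton : ∀ i j k l, i ≠ j → k ≠ l → s(i, j) ≠ s(k, l) →
    (arc i j ∩ arc k l).Subsingleton
  inter_proper : ∀ i j k l, i ≠ j → k ≠ l → s(i, j) ≠ s(k, l) →
    ∀ p ∈ arc i j ∩ arc k l,
      (∃ a, (a = i ∨ a = j) ∧ (a = k ∨ a = l) ∧ p = vert a) ∨
      ProperCrossingAt (arc i j) (arc k l) p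

namespace SimpleDrawing

variable {n : ℕ} (D : SimpleDrawing n)

/-- The arc realizing an (unordered) edge. -/
def earc : Sym2 (Fin n) → Set (ℝ × ℝ) := Sym2.lift ⟨D.arc, D.arc_symm⟩

/-- Two (distinct) edges cross: they share a point that is not a common endpoint. -/
def Crosses (e e' : Sym2 (Fin n)) : Prop :=
  e ≠ e' ∧ ∃ p ∈ D.earc e ∩ D.earc e', ¬∃ a, a ∈ e ∧ a ∈ e' ∧ p = D.vert a

/-- A set of edges is plane if no two of its edges cross. -/
def IsPlane (E : Set (Sym2 (Fin n))) : Prop :=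
  ∀ e ∈ E, ∀ e' ∈ E, ¬D.Crosses e e'

/-- A plane subdrawing: a plane set of (genuine, non-loop) edges of the drawing. -/
def IsPlaneSub (E : Set (Sym2 (Fin n))) : Prop :=
  (∀ e ∈ E, ¬e.IsDiag) ∧ D.IsPlane E

/-- A maximal plane subdrawing: no further edge can be added while keeping the set plane. -/
def IsMaximalPlaneSub (E : Set (Sym2 (Fin n))) : Prop :=
  D.IsPlaneSub E ∧ ∀ e, ¬e.IsDiag → e ∉ E → ¬D.IsPlaneSub (insert e E)

/-- The triangle of the drawing spanned by three vertices: the union of the three arcs. -/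
def triangle (a b c : Fin n) : Set (ℝ × ℝ) := D.arc a b ∪ D.arc b c ∪ D.arc a c

/-- `S` is a side of the triangle on `a b c`: the closure of a connected component of the
complement of the triangle. -/
def IsSideOf (S : Set (ℝ × ℝ)) (a b c : Fin n) : Prop :=
  ∃ p, p ∉ D.triangle a b c ∧ S = closure (connectedComponentIn (D.triangle a b c)ᶜ p)

/-- `S` is a convex side of the triangle on `a b c`: every edge of the drawing with both
endpoints in `S` is contained in `S`. -/
def IsConvexSideOf (S : Set (ℝ × ℝ)) (a b c : Fin n) : Prop :=
  D.IsSideOf S a b c ∧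
    ∀ i j : Fin n, i ≠ j → D.vert i ∈ S → D.vert j ∈ S → D.arc i j ⊆ S

/-- A convex drawing: every triangle has a convex side. -/
def Convex : Prop :=
  ∀ a b c : Fin n, a ≠ b → b ≠ c → a ≠ c → ∃ S, D.IsConvexSideOf S a b c

/-- A plane Hamiltonian cycle: a plane set of `n` edges forming a cycle through all vertices. -/
def IsPlaneHamCycle (E : Set (Sym2 (Fin n))) : Prop :=
  D.IsPlane E ∧ ∃ c : ZMod n → Fin n, Function.Bijective c ∧
    E = {e | ∃ k : ZMod n, e = s(c k, c (k + 1))}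

/-- A plane Hamiltonian path from `s` to `t`: a plane set of `n-1` edges forming a path
through all `n` vertices with endpoints `s` and `t`. -/
def IsPlaneHamPath (E : Set (Sym2 (Fin n))) (s t : Fin n) : Prop :=
  D.IsPlane E ∧ ∃ p : Fin n → Fin n, Function.Bijective p ∧
    (∀ i : Fin n, (i : ℕ) = 0 → p i = s) ∧
    (∀ i : Fin n, (i : ℕ) = n - 1 → p i = t) ∧
    E = {e | ∃ i j : Fin n, (j : ℕ) = (i : ℕ) + 1 ∧ e = s(p i, p j)}

/-- The edge from `a` towards `b` emanates (at `a`) into the set `C`. -/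
def EmanatesInto (a b : Fin n) (C : Set (ℝ × ℝ)) : Prop :=
  ∃ U ∈ nhds (D.vert a), (D.arc a b ∩ U) \ {D.vert a} ⊆ C

/-- At the vertex `vs`, the edges towards `b` and towards `d` emanate into different
connected components of the complement of the triangle on `vs`, `a`, `c`;
i.e. the pair `{a, c}` locally separates `b` from `d` in the rotation at `vs`. -/
def SeparatesAt (vs a c b d : Fin n) : Prop :=
  ∃ p q : ℝ × ℝ, p ∉ D.triangle vs a c ∧ q ∉ D.triangle vs a c ∧
    connectedComponentIn (D.triangle vs a c)ᶜ p ≠ connectedComponentIn (D.triangle vs a c)ᶜ q ∧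
    D.EmanatesInto vs b (connectedComponentIn (D.triangle vs a c)ᶜ p) ∧
    D.EmanatesInto vs d (connectedComponentIn (D.triangle vs a c)ᶜ q)

/-- `lab` labels the `n-1` non-star vertices according to the cyclic order (the rotation)
in which the star edges emanate from the star vertex `vs`: it is a bijection onto the
non-star vertices such that, for any indices `i < j < k < l`, the edges towards `lab i` and
`lab k` locally separate the edges towards `lab j` and `lab l` at `vs`. -/
def IsRotationLabeling (vs : Fin n) (lab : Fin (n - 1) → Fin n) : Prop :=
  Function.Injective lab ∧ range lab = {x | x ≠ vs} ∧
    ∀ i j k l : Fin (n - 1), i < j → j < k → k < l →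
      D.SeparatesAt vs (lab i) (lab k) (lab j) (lab l)

/-- The edge `{lab x, lab (x+1)}` (indices mod `n-1`) is a bad edge with witness `w`:
it crosses the star edge `{lab w, vs}`. -/
def BadWitness (vs : Fin n) (lab : Fin (n - 1) → Fin n) (x w : Fin (n - 1)) : Prop :=
  D.Crosses s(lab x, lab (finCycSucc x)) s(lab w, vs)

/-- The non-star edge `{lab x, lab y}` is star-crossing: it crosses some star edge. -/
def StarCrossing (vs : Fin n) (lab : Fin (n - 1) → Fin n) (x y : Fin (n - 1)) : Prop :=
  ∃ w : Fin (n - 1), D.Crosses s(lab x, lab y) s(lab w, vs)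

end SimpleDrawing

/-- Four indices appear in this cyclic order. -/
def CyclicOrdered {m : ℕ} (a b c d : Fin m) : Prop :=
  (a < b ∧ b < c ∧ c < d) ∨ (b < c ∧ c < d ∧ d < a) ∨
  (c < d ∧ d < a ∧ a < b) ∨ (d < a ∧ a < b ∧ b < c)

/-! ### Continuous logarithms -/

/-- The difference `x - z` of two points of the plane, as a complex number. -/
def cdiff (x z : ℝ × ℝ) : ℂ := ⟨x.1 - z.1, x.2 - z.2⟩

lemma cdiff_eq_zero {x z : ℝ × ℝ} : cdiff x z = 0 ↔ x = z := by
  simp [cdiff, Complex.ext_iff, sub_eq_zero, Prod.ext_iff]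

lemma cdiff_ne_zero {x z : ℝ × ℝ} : cdiff x z ≠ 0 ↔ x ≠ z := not_congr cdiff_eq_zero

lemma cdiff_swap (x z : ℝ × ℝ) : cdiff x z = -cdiff z x := by
  simp [cdiff, Complex.ext_iff]

lemma continuous_cdiff : Continuous fun x : (ℝ × ℝ) × (ℝ × ℝ) => cdiff x.1 x.2 := by
  have : (fun x : (ℝ × ℝ) × (ℝ × ℝ) => cdiff x.1 x.2) =
      fun x => ((x.1.1 - x.2.1 : ℝ) : ℂ) + ((x.1.2 - x.2.2 : ℝ) : ℂ) * Complex.I := by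
    ext x
    apply Complex.ext <;> simp [cdiff]
  rw [this]
  fun_prop

@[fun_prop]
lemma Continuous.cdiff {X : Type*} [TopologicalSpace X] {f g : X → ℝ × ℝ}
    (hf : Continuous f) (hg : Continuous g) : Continuous fun x => cdiff (f x) (g x) :=
  continuous_cdiff.comp (hf.prodMk hg)

/-- `h` has a continuous logarithm on `K`. -/
def HasLogOn {X : Type*} [TopologicalSpace X] (h : X → ℂ) (K : Set X) : Prop :=
  ∃ φ : X → ℂ, ContinuousOn φ K ∧ ∀ x ∈ K, Complex.exp (φ x) = h x

/-- Every continuous nonvanishing function on `K` has a continuous logarithm. -/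
def LogTrivial {X : Type*} [TopologicalSpace X] (K : Set X) : Prop :=
  ∀ h : X → ℂ, ContinuousOn h K → (∀ x ∈ K, h x ≠ 0) → HasLogOn h K

section
variable {X : Type*} [TopologicalSpace X]

lemma logTrivial_univ [SimplyConnectedSpace X] [LocallyPathConnectedSpace X] :
    LogTrivial (univ : Set X) := by
  intro h hc h0
  obtain ⟨x₀⟩ : Nonempty X := inferInstance
  rcases Complex.isCoveringMapOn_exp.existsUnique_continuousMap_lifts
    ⟨h, continuousOn_univ.1 hc⟩ (a₀ := x₀) (Complex.exp_log (h0 x₀ (mem_univ _)))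
    (fun x => h0 x (mem_univ _)) with ⟨f, ⟨-, hf⟩, -⟩
  exact ⟨f, f.continuous.continuousOn, fun x _ => congrFun hf x⟩

lemma exp_eq_one_const {K : Set X} (hK : IsPreconnected K) {g : X → ℂ} (hg : ContinuousOn g K)
    (h1 : ∀ x ∈ K, Complex.exp (g x) = 1) {p q : X} (hp : p ∈ K) (hq : q ∈ K) : g p = g q := by
  have hint : ∀ x ∈ K, ∃ k : ℤ, g x = k * (2 * Real.pi * Complex.I) := fun x hx =>
    Complex.exp_eq_one_iff.1 (h1 x hx)
  have hpi : (0:ℝ) < 2 * Real.pi := by positivity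
  have him : ContinuousOn (fun x => (g x).im / (2 * Real.pi)) K := by fun_prop
  have hval : ∀ x ∈ K, ∀ k : ℤ, g x = k * (2 * Real.pi * Complex.I) →
      (g x).im / (2 * Real.pi) = k := by
    intro x _ k hk
    rw [hk]
    simp
  have hoc := (hK.image _ him).ordConnected
  obtain ⟨k, hk⟩ := hint p hp
  obtain ⟨l, hl⟩ := hint q hq
  have hkl : ∀ {p q : X} {k l : ℤ}, p ∈ K → q ∈ K → g p = k * (2 * Real.pi * Complex.I) →
      g q = l * (2 * Real.pi * Complex.I) → ¬ k < l := by
    intro p q k l hp hq hk hl hlt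
    have hmem : (k:ℝ) + 1/2 ∈ (fun x => (g x).im / (2 * Real.pi)) '' K := by
      refine hoc.out (mem_image_of_mem _ hp) (mem_image_of_mem _ hq) ⟨?_, ?_⟩
      · simp only [hval p hp k hk]; linarith
      · simp only [hval q hq l hl]
        have : ((k:ℝ) + 1 ≤ l) := by exact_mod_cast hlt
        linarith
    obtain ⟨x, hx, hxe⟩ := hmem
    obtain ⟨j, hj⟩ := hint x hx
    simp only [hval x hx j hj] at hxe
    have h2 : (2 * j : ℝ) = 2 * k + 1 := by linarith
    have h3 : 2 * j = 2 * k + 1 := by exact_mod_cast h2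
    omega
  have : k = l := le_antisymm (not_lt.1 (hkl hq hp hl hk)) (not_lt.1 (hkl hp hq hk hl))
  rw [hk, hl, this]

lemma log_increment_unique {K : Set X} (hK : IsPreconnected K) {φ ψ : X → ℂ}
    (hφ : ContinuousOn φ K) (hψ : ContinuousOn ψ K)
    (h : ∀ x ∈ K, Complex.exp (φ x) = Complex.exp (ψ x)) {p q : X} (hp : p ∈ K) (hq : q ∈ K) :
    φ q - φ p = ψ q - ψ p := by
  have := exp_eq_one_const hK (hφ.sub hψ) (fun x hx => by
    simp [Complex.exp_sub, h x hx, Complex.exp_ne_zero]) hp hq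
  simp only [Pi.sub_apply] at this
  linear_combination -this

open Classical in
lemma HasLogOn.glue {h : X → ℂ} {A B : Set X} (hA : IsClosed A) (hB : IsClosed B)
    {φ ψ : X → ℂ} (hφ : ContinuousOn φ A) (hφe : ∀ x ∈ A, Complex.exp (φ x) = h x)
    (hψ : ContinuousOn ψ B) (hψe : ∀ x ∈ B, Complex.exp (ψ x) = h x)
    (hAB : ∀ x ∈ A ∩ B, φ x = ψ x) : HasLogOn h (A ∪ B) := by
  refine ⟨A.piecewise φ ψ, ?_, ?_⟩
  · refine ContinuousOn.union_of_isClosed ?_ ?_ hA hB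
    · exact hφ.congr (fun x hx => piecewise_eq_of_mem _ _ _ hx)
    · refine hψ.congr (fun x hx => ?_)
      by_cases hxA : x ∈ A
      · rw [piecewise_eq_of_mem _ _ _ hxA, hAB x ⟨hxA, hx⟩]
      · rw [piecewise_eq_of_notMem _ _ _ hxA]
  · rintro x hx
    by_cases hxA : x ∈ A
    · rw [piecewise_eq_of_mem _ _ _ hxA, hφe x hxA]
    · rw [piecewise_eq_of_notMem _ _ _ hxA, hψe x (hx.resolve_left hxA)]

lemma LogTrivial.union {A B : Set X} (tA : LogTrivial A) (tB : LogTrivial B) (hA : IsClosed A)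
    (hB : IsClosed B) {c : X} (hAB : A ∩ B ⊆ {c}) : LogTrivial (A ∪ B) := by
  intro h hc h0
  obtain ⟨φ, hφ, hφe⟩ := tA h (hc.mono subset_union_left) (fun x hx => h0 x (Or.inl hx))
  obtain ⟨ψ, hψ, hψe⟩ := tB h (hc.mono subset_union_right) (fun x hx => h0 x (Or.inr hx))
  by_cases hne : (A ∩ B).Nonempty
  · obtain ⟨x, hx⟩ := hne
    refine HasLogOn.glue hA hB hφ hφe (ψ := fun y => ψ y + (φ x - ψ x))
      (by fun_prop) (fun y hy => ?_) (fun y hy => ?_)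
    · rw [Complex.exp_add, Complex.exp_sub, hψe y hy, hφe x hx.1, hψe x hx.2,
        div_self (h0 x (Or.inl hx.1)), mul_one]
    · have h1 := hAB hy
      have h2 := hAB hx
      simp only [mem_singleton_iff] at h1 h2
      rw [h1, h2]; ring
  · exact HasLogOn.glue hA hB hφ hφe hψ hψe (fun y hy => (hne ⟨y, hy⟩).elim)

end

/-! ### Increments of the argument along sets -/

open Classical in
/-- The increment from `p` to `q` of a continuous logarithm on `K` of `x ↦ x - z`. -/
noncomputable def logInc (K : Set (ℝ × ℝ)) (z p q : ℝ × ℝ) : ℂ :=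
  if h : HasLogOn (fun x => cdiff x z) K then h.choose q - h.choose p else 0

lemma logInc_eq {K : Set (ℝ × ℝ)} (hK : IsPreconnected K) {z : ℝ × ℝ} {φ : ℝ × ℝ → ℂ}
    (hφ : ContinuousOn φ K) (he : ∀ x ∈ K, Complex.exp (φ x) = cdiff x z) {p q : ℝ × ℝ}
    (hp : p ∈ K) (hq : q ∈ K) : logInc K z p q = φ q - φ p := by
  have h : HasLogOn (fun x => cdiff x z) K := ⟨φ, hφ, he⟩
  rw [logInc, dif_pos h]
  exact log_increment_unique hK h.choose_spec.1 hφ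
    (fun x hx => by rw [h.choose_spec.2 x hx, he x hx]) hp hq

lemma LogTrivial.hasLogOn_cdiff {K : Set (ℝ × ℝ)} (hK : LogTrivial K) {z : ℝ × ℝ} (hz : z ∉ K) :
    HasLogOn (fun x => cdiff x z) K :=
  hK _ (by fun_prop) (fun x hx => cdiff_ne_zero.2 (by rintro rfl; exact hz hx))

lemma exp_logInc {K : Set (ℝ × ℝ)} (hK : IsPreconnected K) (tK : LogTrivial K) {z p q : ℝ × ℝ}
    (hz : z ∉ K) (hp : p ∈ K) (hq : q ∈ K) :
    Complex.exp (logInc K z p q) = cdiff q z / cdiff p z := by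
  obtain ⟨φ, hφ, he⟩ := tK.hasLogOn_cdiff hz
  rw [logInc_eq hK hφ he hp hq, Complex.exp_sub, he _ hp, he _ hq]

lemma logInc_mono {K K' : Set (ℝ × ℝ)} (hK : IsPreconnected K) (tK : LogTrivial K)
    (hK' : IsPreconnected K') (hs : K' ⊆ K) {z p q : ℝ × ℝ}
    (hz : z ∉ K) (hp : p ∈ K') (hq : q ∈ K') : logInc K' z p q = logInc K z p q := by
  obtain ⟨φ, hφ, he⟩ := tK.hasLogOn_cdiff hz
  rw [logInc_eq hK hφ he (hs hp) (hs hq),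
    logInc_eq hK' (hφ.mono hs) (fun x hx => he x (hs hx)) hp hq]

lemma logInc_swap (K : Set (ℝ × ℝ)) (z p q : ℝ × ℝ) : logInc K z q p = -logInc K z p q := by
  unfold logInc
  split <;> ring

lemma logInc_add (K : Set (ℝ × ℝ)) (z p q r : ℝ × ℝ) :
    logInc K z p q + logInc K z q r = logInc K z p r := by
  unfold logInc
  split <;> ring

lemma continuousOn_logInc {K : Set (ℝ × ℝ)} (hK : IsPreconnected K) (tK : LogTrivial K)
    (cK : IsCompact K) {p q : ℝ × ℝ} (hp : p ∈ K) (hq : q ∈ K) :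
    ContinuousOn (fun z => logInc K z p q) Kᶜ := by
  intro z₀ hz₀
  refine ContinuousAt.continuousWithinAt ?_
  obtain ⟨φ, hφ, he⟩ := tK.hasLogOn_cdiff hz₀
  have hne : ∀ x ∈ K, cdiff x z₀ ≠ 0 := fun x hx => cdiff_ne_zero.2 (by rintro rfl; exact hz₀ hx)
  obtain ⟨x₁, hx₁, hmin⟩ := cK.exists_isMinOn ⟨p, hp⟩
    (f := fun x => ‖cdiff x z₀‖) (by fun_prop)
  have hnear : ∀ᶠ z in nhds z₀, ‖cdiff z z₀‖ < ‖cdiff x₁ z₀‖ := by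
    have hc : Continuous fun z => ‖cdiff z z₀‖ := by fun_prop
    refine hc.continuousAt.eventually_lt continuousAt_const ?_
    simpa [cdiff_eq_zero.2 rfl] using hne x₁ hx₁
  have key : ∀ᶠ z in nhds z₀, ∀ x ∈ K, cdiff x z / cdiff x z₀ ∈ Complex.slitPlane := by
    filter_upwards [hnear] with z hz x hx
    have h1 : cdiff x z / cdiff x z₀ = 1 - cdiff z z₀ / cdiff x z₀ := by
      rw [eq_sub_iff_add_eq, ← add_div, div_eq_one_iff_eq (hne x hx)]
      simp [cdiff, Complex.ext_iff]
    have h2 : ‖cdiff z z₀ / cdiff x z₀‖ < 1 := by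
      rw [norm_div, div_lt_one (norm_pos_iff.2 (hne x hx))]
      exact hz.trans_le (hmin hx)
    rw [h1, Complex.mem_slitPlane_iff]
    left
    have := (Complex.abs_re_le_norm (cdiff z z₀ / cdiff x z₀)).trans_lt h2
    have := (abs_lt.1 this).2
    simp only [Complex.sub_re, Complex.one_re]
    linarith
  have hev : (fun z => logInc K z p q) =ᶠ[nhds z₀] fun z => (φ q - φ p) +
      (Complex.log (cdiff q z / cdiff q z₀) - Complex.log (cdiff p z / cdiff p z₀)) := by
    filter_upwards [key] with z hz
    rw [logInc_eq hK (φ := fun x => φ x + Complex.log (cdiff x z / cdiff x z₀)) _ _ hp hq]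
    · ring
    · refine hφ.add (ContinuousOn.clog ?_ hz)
      exact ContinuousOn.div (by fun_prop) (by fun_prop) hne
    · intro x hx
      rw [Complex.exp_add, he x hx, Complex.exp_log (Complex.slitPlane_ne_zero (hz x hx)),
        mul_div_cancel₀ _ (hne x hx)]
  refine ContinuousAt.congr ?_ hev.symm
  have hs : ∀ x ∈ K, cdiff x z₀ / cdiff x z₀ ∈ Complex.slitPlane := fun x hx => by
    rw [div_self (hne x hx)]; exact Complex.one_mem_slitPlane
  refine continuousAt_const.add (ContinuousAt.sub ?_ ?_)
  · exact ContinuousAt.clog (by fun_prop) (hs q hq)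
  · exact ContinuousAt.clog (by fun_prop) (hs p hp)

lemma no_log_on_circle {φ ψ : ℝ → ℂ} (hφ : Continuous φ) (hψ : Continuous ψ)
    (hφ2 : φ (2 * Real.pi) = φ 0) (hψ2 : ψ (2 * Real.pi) = ψ 0) {m : ℤ} {c : ℂ} (hc : c ≠ 0)
    (h : ∀ θ : ℝ, Complex.exp (φ θ) =
      c * Complex.exp (ψ θ) * Complex.exp (m * (θ * Complex.I))) : m = 0 := by
  have := exp_eq_one_const (X := ℝ) isPreconnected_univ
    (g := fun θ : ℝ => φ θ - (Complex.log c + ψ θ + m * (θ * Complex.I)))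
    (by fun_prop) (fun θ _ => by
      rw [Complex.exp_sub, h θ, Complex.exp_add, Complex.exp_add, Complex.exp_log hc,
        div_self (by simp [hc, Complex.exp_ne_zero])]) (mem_univ 0) (mem_univ (2 * Real.pi))
  simp only [hφ2, hψ2] at this
  have h2 : (m : ℂ) * (2 * Real.pi * Complex.I) = 0 := by
    push_cast at this
    linear_combination this
  simpa [Real.pi_ne_zero] using h2

lemma cdiff_circle (a : ℝ × ℝ) (R θ : ℝ) :
    cdiff (a.1 + R * Real.cos θ, a.2 + R * Real.sin θ) a = R * Complex.exp (θ * Complex.I) := by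
  rw [Complex.exp_mul_I]
  apply Complex.ext <;> simp [cdiff, Complex.cos_ofReal_re, Complex.sin_ofReal_re]

/-! ### Arcs -/

/-- `K` is a simple arc from `p` to `q`. -/
def IsArc (K : Set (ℝ × ℝ)) (p q : ℝ × ℝ) : Prop :=
  ∃ f : ℝ → ℝ × ℝ, ContinuousOn f (Icc (0:ℝ) 1) ∧ InjOn f (Icc (0:ℝ) 1) ∧
    f '' Icc (0:ℝ) 1 = K ∧ f 0 = p ∧ f 1 = q

lemma isArc_image_Icc {f : ℝ → ℝ × ℝ} {s t : ℝ} (hst : s < t) (hf : ContinuousOn f (Icc s t))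
    (hi : InjOn f (Icc s t)) : IsArc (f '' Icc s t) (f s) (f t) := by
  have him : (fun u : ℝ => (t - s) * u + s) '' Icc (0:ℝ) 1 = Icc s t := by
    rw [image_affine_Icc' (by linarith)]
    congr 1 <;> ring
  refine ⟨f ∘ fun u => (t - s) * u + s, ?_, ?_, ?_, by simp, by simp⟩
  · exact hf.comp (by fun_prop) (fun u hu => him ▸ mem_image_of_mem _ hu)
  · refine hi.comp ?_ (fun u hu => him ▸ mem_image_of_mem _ hu)
    intro u _ v _ huv
    have : (t - s) ≠ 0 := by linarith
    simpa [this] using huv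
  · rw [image_comp, him]

namespace IsArc

variable {K K₁ K₂ : Set (ℝ × ℝ)} {p q r x : ℝ × ℝ}

lemma symm (h : IsArc K p q) : IsArc K q p := by
  obtain ⟨f, hf, hi, rfl, rfl, rfl⟩ := h
  have him : (fun u : ℝ => 1 - u) '' Icc (0:ℝ) 1 = Icc 0 1 := by
    rw [image_const_sub_Icc]; simp
  refine ⟨f ∘ fun u => 1 - u, ?_, ?_, ?_, by simp, by simp⟩
  · exact hf.comp (by fun_prop) (fun u hu => him ▸ mem_image_of_mem _ hu)
  · refine hi.comp ?_ (fun u hu => him ▸ mem_image_of_mem _ hu)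
    intro u _ v _ huv
    simpa using huv
  · rw [image_comp, him]

lemma left_mem (h : IsArc K p q) : p ∈ K := by
  obtain ⟨f, hf, hi, rfl, rfl, rfl⟩ := h
  exact mem_image_of_mem _ (by simp)

lemma right_mem (h : IsArc K p q) : q ∈ K := h.symm.left_mem

lemma ne (h : IsArc K p q) : p ≠ q := by
  obtain ⟨f, hf, hi, rfl, rfl, rfl⟩ := h
  intro h01
  exact zero_ne_one (hi (by simp) (by simp) h01)

lemma isCompact (h : IsArc K p q) : IsCompact K := by
  obtain ⟨f, hf, hi, rfl, rfl, rfl⟩ := h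
  exact isCompact_Icc.image_of_continuousOn hf

lemma isClosed (h : IsArc K p q) : IsClosed K := h.isCompact.isClosed

lemma isPreconnected (h : IsArc K p q) : IsPreconnected K := by
  obtain ⟨f, hf, hi, rfl, rfl, rfl⟩ := h
  exact isPreconnected_Icc.image f hf

/-- A globally continuous parametrization together with its inverse. -/
lemma exists_param (h : IsArc K p q) : ∃ (f : ℝ → ℝ × ℝ) (g : ℝ × ℝ → ℝ), Continuous f ∧
    (∀ t, f t ∈ K) ∧ ContinuousOn g K ∧ (∀ y ∈ K, g y ∈ Icc (0:ℝ) 1) ∧ (∀ y ∈ K, f (g y) = y) ∧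
    (∀ t ∈ Icc (0:ℝ) 1, g (f t) = t) ∧ f 0 = p ∧ f 1 = q := by
  classical
  obtain ⟨f, hf, hi, rfl, rfl, rfl⟩ := h
  set F : ℝ → ℝ × ℝ := fun t => f (projIcc (0:ℝ) 1 zero_le_one t) with hF
  have hFf : ∀ t ∈ Icc (0:ℝ) 1, F t = f t := fun t ht => by
    simp [hF, projIcc_of_mem zero_le_one ht]
  have hcF : Continuous F :=
    (continuousOn_iff_continuous_domRestrict.1 hf).comp continuous_projIcc
  set g := Function.invFunOn f (Icc (0:ℝ) 1)
  have hg1 : ∀ y ∈ f '' Icc (0:ℝ) 1, g y ∈ Icc (0:ℝ) 1 := fun y hy => Function.invFunOn_mem hy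
  have hg2 : ∀ y ∈ f '' Icc (0:ℝ) 1, f (g y) = y := fun y hy => Function.invFunOn_eq hy
  have hg3 : ∀ t ∈ Icc (0:ℝ) 1, g (f t) = t := fun t ht =>
    hi (hg1 _ (mem_image_of_mem _ ht)) ht (hg2 _ (mem_image_of_mem _ ht))
  refine ⟨F, g, hcF, fun t => mem_image_of_mem _ (projIcc (0:ℝ) 1 zero_le_one t).2, ?_, hg1,
    fun y hy => by rw [hFf _ (hg1 y hy), hg2 y hy], fun t ht => by rw [hFf t ht, hg3 t ht],
    hFf 0 (by simp), hFf 1 (by simp)⟩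
  rw [continuousOn_iff_isClosed]
  intro C hC
  refine ⟨f '' (C ∩ Icc 0 1), ?_, ?_⟩
  · exact ((isCompact_Icc.inter_left hC).image_of_continuousOn
      (hf.mono inter_subset_right)).isClosed
  · ext y
    constructor
    · rintro ⟨hy, hyK⟩
      exact ⟨⟨g y, ⟨hy, hg1 y hyK⟩, hg2 y hyK⟩, hyK⟩
    · rintro ⟨⟨t, ⟨htC, ht⟩, rfl⟩, hyK⟩
      refine ⟨?_, hyK⟩
      simpa [hg3 t ht] using htC

lemma logTrivial (h : IsArc K p q) : LogTrivial K := by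
  obtain ⟨f, g, hf, hfK, hg, -, hfg, -⟩ := h.exists_param
  intro u hu h0
  obtain ⟨φ, hφ, he⟩ := (logTrivial_univ (X := ℝ)) (u ∘ f)
    (hu.comp hf.continuousOn (fun t _ => hfK t)) (fun t _ => h0 _ (hfK t))
  refine ⟨φ ∘ g, (continuousOn_univ.1 hφ).comp_continuousOn hg, fun x hx => ?_⟩
  simp only [Function.comp_apply]
  rw [he _ (mem_univ _), Function.comp_apply, hfg x hx]

/-- Symmetry of double increments along disjoint arcs. -/
lemma logInc_double {p₁ q₁ p₂ q₂ : ℝ × ℝ} (h₁ : IsArc K₁ p₁ q₁) (h₂ : IsArc K₂ p₂ q₂)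
    (hd : Disjoint K₁ K₂) :
    logInc K₁ q₂ p₁ q₁ - logInc K₁ p₂ p₁ q₁ = logInc K₂ q₁ p₂ q₂ - logInc K₂ p₁ p₂ q₂ := by
  obtain ⟨f₁, g₁, hf₁, hfK₁, hg₁, -, hfg₁, -⟩ := h₁.exists_param
  obtain ⟨f₂, g₂, hf₂, hfK₂, hg₂, -, hfg₂, -⟩ := h₂.exists_param
  have hne : ∀ x ∈ K₁, ∀ y ∈ K₂, x ≠ y := fun x hx y hy hxy =>
    hd.ne_of_mem hx hy hxy
  obtain ⟨φ, hφ, he⟩ := (logTrivial_univ (X := ℝ × ℝ))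
    (fun s => cdiff (f₁ s.1) (f₂ s.2)) (by fun_prop)
    (fun s _ => cdiff_ne_zero.2 (hne _ (hfK₁ _) _ (hfK₂ _)))
  have hφ := continuousOn_univ.1 hφ
  have A1 : ∀ y ∈ K₂, logInc K₁ y p₁ q₁ = φ (g₁ q₁, g₂ y) - φ (g₁ p₁, g₂ y) := by
    intro y hy
    refine logInc_eq h₁.isPreconnected (φ := fun x => φ (g₁ x, g₂ y)) ?_ (fun x hx => ?_)
      h₁.left_mem h₁.right_mem
    · exact hφ.comp_continuousOn (by fun_prop)
    · simp only [he _ (mem_univ _), hfg₁ x hx, hfg₂ y hy]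
  have A2 : ∀ x ∈ K₁, logInc K₂ x p₂ q₂ = φ (g₁ x, g₂ q₂) - φ (g₁ x, g₂ p₂) := by
    intro x hx
    rw [logInc_eq h₂.isPreconnected (φ := fun y => φ (g₁ x, g₂ y) + Real.pi * Complex.I) ?_
      (fun y hy => ?_) h₂.left_mem h₂.right_mem]
    · ring
    · exact (hφ.comp_continuousOn (by fun_prop)).add continuousOn_const
    · simp only [Complex.exp_add, he _ (mem_univ _), hfg₁ x hx, hfg₂ y hy,
        Complex.exp_pi_mul_I, cdiff_swap y x]
      ring
  rw [A1 _ h₂.left_mem, A1 _ h₂.right_mem, A2 _ h₁.left_mem, A2 _ h₁.right_mem]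
  ring

lemma exists_split (h : IsArc K p q) (hx : x ∈ K) (hxp : x ≠ p) (hxq : x ≠ q) :
    ∃ A B, IsArc A p x ∧ IsArc B x q ∧ K = A ∪ B ∧ A ∩ B = {x} := by
  obtain ⟨f, hf, hi, rfl, rfl, rfl⟩ := h
  obtain ⟨t, ht, rfl⟩ := hx
  have h0 : 0 < t := lt_of_le_of_ne ht.1 (by rintro rfl; exact hxp rfl)
  have h1 : t < 1 := lt_of_le_of_ne ht.2 (by rintro rfl; exact hxq rfl)
  have s0 : Icc 0 t ⊆ Icc (0:ℝ) 1 := Icc_subset_Icc_right h1.le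
  have s1 : Icc t 1 ⊆ Icc (0:ℝ) 1 := Icc_subset_Icc_left h0.le
  refine ⟨f '' Icc 0 t, f '' Icc t 1, isArc_image_Icc h0 (hf.mono s0) (hi.mono s0),
    isArc_image_Icc h1 (hf.mono s1) (hi.mono s1), ?_, ?_⟩
  · rw [← image_union, Icc_union_Icc_eq_Icc h0.le h1.le]
  · rw [← hi.image_inter s0 s1, Icc_inter_Icc_eq_singleton h0.le h1.le, image_singleton]

lemma trans (h₁ : IsArc K₁ p q) (h₂ : IsArc K₂ q r) (hi : K₁ ∩ K₂ ⊆ {q}) :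
    IsArc (K₁ ∪ K₂) p r := by
  classical
  obtain ⟨f₁, g₁, hf₁, hfK₁, hg₁, hgI₁, hfg₁, hgf₁, rfl, rfl⟩ := h₁.exists_param
  obtain ⟨f₂, g₂, hf₂, hfK₂, hg₂, hgI₂, hfg₂, hgf₂, h20, rfl⟩ := h₂.exists_param
  set F : ℝ → ℝ × ℝ := fun t => if t ≤ 1 then f₁ t else f₂ (t - 1) with hF
  have hcF : Continuous F := by
    refine Continuous.if_le hf₁ (by fun_prop) continuous_id continuous_const ?_
    rintro t rfl
    simp [h20]
  have hF1 : ∀ t ≤ 1, F t = f₁ t := fun t ht => by simp [hF, ht]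
  have hF2 : ∀ t, 1 < t → F t = f₂ (t - 1) := fun t ht => by simp [hF, not_le.2 ht]
  have hF2' : ∀ t, 1 ≤ t → F t = f₂ (t - 1) := fun t ht => by
    rcases ht.eq_or_lt with rfl | ht
    · rw [hF1 _ le_rfl]; simp [h20]
    · exact hF2 t ht
  have hinj : InjOn F (Icc (0:ℝ) 2) := by
    have key : ∀ s ∈ Icc (0:ℝ) 2, ∀ t ∈ Icc (0:ℝ) 2, s ≤ 1 → 1 < t → F s ≠ F t := by
      intro s hs t ht hs1 ht1 hst
      rw [hF1 s hs1, hF2 t ht1] at hst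
      have hmem : f₂ (t - 1) ∈ K₁ ∩ K₂ := ⟨hst ▸ hfK₁ s, hfK₂ _⟩
      have h3 := hi hmem
      rw [mem_singleton_iff, ← h20] at h3
      have := hgf₂ (t - 1) ⟨by linarith, by linarith [ht.2]⟩
      rw [h3, hgf₂ 0 (by simp)] at this
      linarith
    intro s hs t ht hst
    rcases le_or_gt s 1 with hs1 | hs1 <;> rcases le_or_gt t 1 with ht1 | ht1
    · rw [hF1 s hs1, hF1 t ht1] at hst
      rw [← hgf₁ s ⟨hs.1, hs1⟩, hst, hgf₁ t ⟨ht.1, ht1⟩]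
    · exact (key s hs t ht hs1 ht1 hst).elim
    · exact (key t ht s hs ht1 hs1 hst.symm).elim
    · rw [hF2 s hs1, hF2 t ht1] at hst
      have := hgf₂ (s - 1) ⟨by linarith, by linarith [hs.2]⟩
      rw [hst, hgf₂ (t - 1) ⟨by linarith, by linarith [ht.2]⟩] at this
      linarith
  have him : F '' Icc (0:ℝ) 2 = K₁ ∪ K₂ := by
    ext y
    constructor
    · rintro ⟨t, ht, rfl⟩
      rcases le_or_gt t 1 with h | h
      · exact Or.inl (hF1 t h ▸ hfK₁ t)
      · exact Or.inr (hF2 t h ▸ hfK₂ _)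
    · rintro (hy | hy)
      · have := hgI₁ y hy
        exact ⟨g₁ y, ⟨this.1, by linarith [this.2]⟩, by rw [hF1 _ this.2, hfg₁ y hy]⟩
      · have := hgI₂ y hy
        refine ⟨g₂ y + 1, ⟨by linarith [this.1], by linarith [this.2]⟩, ?_⟩
        rw [hF2' _ (by linarith [this.1]), add_sub_cancel_right, hfg₂ y hy]
  have := isArc_image_Icc (by norm_num : (0:ℝ) < 2) hcF.continuousOn hinj
  rw [him, hF1 0 zero_le_one, hF2 2 one_lt_two] at this
  convert this using 2
  norm_num

lemma isPreconnected_diff_left (h : IsArc K p q) : IsPreconnected (K \ {p}) := by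
  obtain ⟨f, hf, hi, rfl, rfl, rfl⟩ := h
  have : f '' Icc (0:ℝ) 1 \ {f 0} = f '' Ioc 0 1 := by
    rw [← image_singleton, ← hi.image_sdiff_subset (by simp), Icc_sdiff_left]
  rw [this]
  exact isPreconnected_Ioc.image f (hf.mono Ioc_subset_Icc_self)

lemma isPreconnected_diff_right (h : IsArc K p q) : IsPreconnected (K \ {q}) :=
  h.symm.isPreconnected_diff_left

lemma isPreconnected_diff (h : IsArc K p q) : IsPreconnected (K \ {p, q}) := by
  obtain ⟨f, hf, hi, rfl, rfl, rfl⟩ := h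
  have : f '' Icc (0:ℝ) 1 \ {f 0, f 1} = f '' Ioo 0 1 := by
    rw [← image_pair, ← hi.image_sdiff_subset (by simp [insert_subset_iff]), Icc_sdiff_both]
  rw [this]
  exact isPreconnected_Ioo.image f (hf.mono Ioo_subset_Icc_self)

lemma subset_closure_diff (h : IsArc K p q) : K ⊆ closure (K \ {p, q}) := by
  obtain ⟨f, hf, hi, rfl, rfl, rfl⟩ := h
  have : f '' Icc (0:ℝ) 1 \ {f 0, f 1} = f '' Ioo 0 1 := by
    rw [← image_pair, ← hi.image_sdiff_subset (by simp [insert_subset_iff]), Icc_sdiff_both]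
  rw [this]
  have h2 : Icc (0:ℝ) 1 = closure (Ioo 0 1) := (closure_Ioo zero_ne_one).symm
  conv_lhs => rw [h2]
  exact ContinuousOn.image_closure (by rw [← h2]; exact hf)

/-- An initial piece of an arc avoids a given closed set missing the initial point. -/
lemma exists_initial (h : IsArc K p q) {F : Set (ℝ × ℝ)} (hF : IsClosed F) (hp : p ∉ F) :
    ∃ x A B, IsArc A p x ∧ IsArc B x q ∧ K = A ∪ B ∧ A ∩ B = {x} ∧ Disjoint A F := by
  obtain ⟨f, g, hf, hfK, hg, hgI, hfg, hgf, rfl, rfl⟩ := h.exists_param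
  have hn : f ⁻¹' Fᶜ ∈ nhds (0:ℝ) := (hF.isOpen_compl.preimage hf).mem_nhds hp
  obtain ⟨ε, hε, hball⟩ := Metric.mem_nhds_iff.1 hn
  set t := min (ε / 2) (1 / 2) with ht
  have ht0 : 0 < t := by positivity
  have ht1 : t ≤ 1 / 2 := min_le_right _ _
  have htε : t ≤ ε / 2 := min_le_left _ _
  have hinj : InjOn f (Icc 0 1) := fun s hs u hu hsu => by rw [← hgf s hs, hsu, hgf u hu]
  have s0 : Icc 0 t ⊆ Icc (0:ℝ) 1 := Icc_subset_Icc_right (by linarith)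
  have s1 : Icc t 1 ⊆ Icc (0:ℝ) 1 := Icc_subset_Icc_left ht0.le
  refine ⟨f t, f '' Icc 0 t, f '' Icc t 1, isArc_image_Icc ht0 hf.continuousOn (hinj.mono s0),
    isArc_image_Icc (by linarith) hf.continuousOn (hinj.mono s1), ?_, ?_, ?_⟩
  · rw [← image_union, Icc_union_Icc_eq_Icc ht0.le (by linarith)]
    ext y
    exact ⟨fun hy => ⟨g y, hgI y hy, hfg y hy⟩, by rintro ⟨s, -, rfl⟩; exact hfK s⟩
  · rw [← hinj.image_inter s0 s1, Icc_inter_Icc_eq_singleton ht0.le (by linarith), image_singleton]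
  · rw [disjoint_left]
    rintro _ ⟨s, hs, rfl⟩
    refine hball ?_
    rw [Metric.mem_ball, Real.dist_eq, sub_zero, abs_of_nonneg hs.1]
    linarith [hs.2]

/-- Deleting a small open piece around an inner point of an arc leaves two disjoint arcs. -/
lemma exists_gap (h : IsArc K p q) {N : Set (ℝ × ℝ)} (hN : IsOpen N) (hx : x ∈ K)
    (hxN : x ∈ N) (hxp : x ≠ p) (hxq : x ≠ q) : ∃ y z A B, IsArc A p y ∧ IsArc B z q ∧
      A ∪ B ⊆ K ∧ Disjoint A B ∧ K \ N ⊆ A ∪ B := by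
  obtain ⟨A, B, hA, hB, hK, hAB⟩ := h.exists_split hx hxp hxq
  obtain ⟨a, A₁, A₂, hA₁, hA₂, hAu, hAi, hAd⟩ :=
    hA.symm.exists_initial hN.isClosed_compl (by simpa using hxN)
  obtain ⟨b, B₁, B₂, hB₁, hB₂, hBu, hBi, hBd⟩ :=
    hB.exists_initial hN.isClosed_compl (by simpa using hxN)
  rw [disjoint_compl_right_iff_subset] at hAd hBd
  refine ⟨a, b, A₂, B₂, hA₂.symm, hB₂, ?_, ?_, ?_⟩
  · rw [hK, hAu, hBu]
    exact union_subset_union subset_union_right subset_union_right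
  · rw [disjoint_left]
    intro y hy1 hy2
    have h1 : y ∈ A ∩ B := ⟨hAu ▸ Or.inr hy1, hBu ▸ Or.inr hy2⟩
    rw [hAB, mem_singleton_iff] at h1
    subst h1
    have : y ∈ A₁ ∩ A₂ := ⟨hA₁.left_mem, hy1⟩
    rw [hAi, mem_singleton_iff] at this
    exact hA₁.ne this
  · rintro y ⟨hy, hyN⟩
    rw [hK, hAu, hBu] at hy
    rcases hy with (hy | hy) | (hy | hy)
    · exact (hyN (hAd hy)).elim
    · exact Or.inl hy
    · exact (hyN (hBd hy)).elim
    · exact Or.inr hy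

end IsArc

/-! ### Components of the complement of a compact set -/

lemma isPreconnected_norm_gt (R : ℝ) : IsPreconnected {x : ℝ × ℝ | R < ‖x‖} := by
  rcases lt_or_ge R 0 with hR | hR
  · have : {x : ℝ × ℝ | R < ‖x‖} = univ := by
      ext x; simpa using hR.trans_le (norm_nonneg x)
    rw [this]; exact isPreconnected_univ
  have hrank : 1 < Module.rank ℝ (ℝ × ℝ) := by
    rw [rank_prod', Module.rank_self, one_add_one_eq_two]; exact Cardinal.one_lt_two
  have him : {x : ℝ × ℝ | R < ‖x‖} =
      (fun s : ℝ × (ℝ × ℝ) => s.1 • s.2) '' (Ioi R ×ˢ Metric.sphere (0 : ℝ × ℝ) 1) := by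
    ext x
    constructor
    · intro hx
      have hx : R < ‖x‖ := hx
      have h0 : ‖x‖ ≠ 0 := (hR.trans_lt hx).ne'
      exact ⟨(‖x‖, ‖x‖⁻¹ • x), ⟨hx, by simp [norm_smul, h0]⟩, by simp [smul_smul, h0]⟩
    · rintro ⟨⟨r, s⟩, ⟨hr, hs⟩, rfl⟩
      have hr : R < r := hr
      have hs : ‖s‖ = 1 := by simpa using hs
      change R < ‖r • s‖
      rw [norm_smul, hs, mul_one, Real.norm_of_nonneg (hR.trans hr.le)]
      exact hr
  rw [him]
  exact (isPreconnected_Ioi.prod (isPreconnected_sphere hrank 0 1)).image _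
    (by fun_prop)

lemma isOpen_component {K : Set (ℝ × ℝ)} (cK : IsCompact K) (a : ℝ × ℝ) :
    IsOpen (connectedComponentIn Kᶜ a) := cK.isClosed.isOpen_compl.connectedComponentIn

lemma closure_component_subset {K : Set (ℝ × ℝ)} (cK : IsCompact K) (a : ℝ × ℝ) :
    closure (connectedComponentIn Kᶜ a) ⊆ connectedComponentIn Kᶜ a ∪ K := by
  intro x hx
  by_cases hxK : x ∈ K
  · exact Or.inr hxK
  left
  obtain ⟨y, hy1, hy2⟩ := mem_closure_iff.1 hx _ (isOpen_component cK x)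
    (mem_connectedComponentIn hxK)
  rw [connectedComponentIn_eq hy2, ← connectedComponentIn_eq hy1]
  exact mem_connectedComponentIn hxK

lemma frontier_component_subset {K : Set (ℝ × ℝ)} (cK : IsCompact K) (a : ℝ × ℝ) :
    frontier (connectedComponentIn Kᶜ a) ⊆ K := by
  intro x hx
  rw [(isOpen_component cK a).frontier_eq] at hx
  exact (closure_component_subset cK a hx.1).resolve_left hx.2

lemma component_bounded_or {K : Set (ℝ × ℝ)} (cK : IsCompact K) {a b : ℝ × ℝ}
    (hab : connectedComponentIn Kᶜ a ≠ connectedComponentIn Kᶜ b) :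
    Bornology.IsBounded (connectedComponentIn Kᶜ a) ∨
      Bornology.IsBounded (connectedComponentIn Kᶜ b) := by
  by_contra! hcon
  obtain ⟨R, hR⟩ := cK.isBounded.exists_norm_le
  have hout : {x : ℝ × ℝ | R < ‖x‖} ⊆ Kᶜ := fun x hx hxK => (hR x hxK).not_gt hx
  have meet : ∀ c, ¬ Bornology.IsBounded (connectedComponentIn Kᶜ c) →
      ∃ x ∈ connectedComponentIn Kᶜ c, R < ‖x‖ := by
    intro c hc
    by_contra! h
    exact hc (isBounded_iff_forall_norm_le.2 ⟨R, h⟩)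
  obtain ⟨x, hx, hxR⟩ := meet a hcon.1
  obtain ⟨y, hy, hyR⟩ := meet b hcon.2
  have h1 : y ∈ connectedComponentIn Kᶜ x :=
    (isPreconnected_norm_gt R).subset_connectedComponentIn hxR hout hyR
  rw [← connectedComponentIn_eq hx] at h1
  rw [connectedComponentIn_eq h1, ← connectedComponentIn_eq hy] at hab
  exact hab rfl

open Classical in
lemma zpow_eq_zero_of_hasLogOn {K U : Set (ℝ × ℝ)} (cK : IsCompact K) (hU : IsOpen U)
    (bU : Bornology.IsBounded U) (fU : frontier U ⊆ K) {a : ℝ × ℝ} (ha : a ∈ U)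
    {r : ℝ × ℝ → ℂ} (hr : ContinuousOn r (closure U)) (hr0 : ∀ z ∈ closure U, r z ≠ 0) {m : ℤ}
    (h : HasLogOn (fun z => cdiff z a ^ m * r z) K) : m = 0 := by
  obtain ⟨φ, hφ, he⟩ := h
  obtain ⟨Ψ, hΨ⟩ := ContinuousMap.exists_restrict_eq cK.isClosed
    ⟨K.domRestrict φ, continuousOn_iff_continuous_domRestrict.1 hφ⟩
  have hΨφ : ∀ z ∈ K, Ψ z = φ z := fun z hz => congrArg (fun f => f ⟨z, hz⟩) hΨ
  set H : ℝ × ℝ → ℂ := fun z =>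
    if z ∈ closure U then Complex.exp (Ψ z) / r z else cdiff z a ^ m with hH
  have hcH : Continuous H := by
    refine continuous_if ?_ ?_ ?_
    · intro z hz
      have hz' : z ∈ K := fU (frontier_closure_subset hz)
      have hzc : z ∈ closure U := by
        have := frontier_subset_closure hz
        simpa using this
      rw [hΨφ z hz', he z hz', mul_div_assoc, div_self (hr0 z hzc), mul_one]
    · have : closure {z | z ∈ closure U} = closure U := by simp
      rw [this]
      exact ContinuousOn.div (by fun_prop) hr hr0
    · have hsub : closure {z | z ∉ closure U} ⊆ Uᶜ := by
        refine closure_minimal (fun z hz hzU => hz (subset_closure hzU)) hU.isClosed_compl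
      intro z hz
      refine ContinuousAt.continuousWithinAt (ContinuousAt.zpow₀ (by fun_prop) m (Or.inl ?_))
      rw [cdiff_ne_zero]
      rintro rfl
      exact hsub hz ha
  have hH0 : ∀ z, H z ≠ 0 := by
    intro z
    by_cases hz : z ∈ closure U
    · simp only [hH, if_pos hz]
      exact div_ne_zero (Complex.exp_ne_zero _) (hr0 z hz)
    · simp only [hH, if_neg hz]
      refine zpow_ne_zero _ (cdiff_ne_zero.2 ?_)
      rintro rfl
      exact hz (subset_closure ha)
  obtain ⟨l, hl, hle⟩ := (logTrivial_univ (X := ℝ × ℝ)) H hcH.continuousOn (fun z _ => hH0 z)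
  have hl := continuousOn_univ.1 hl
  have cU : IsCompact (closure U) := Metric.isCompact_of_isClosed_isBounded isClosed_closure
    bU.closure
  obtain ⟨M, hM⟩ := cU.exists_bound_of_continuousOn (f := fun z => cdiff z a) (by fun_prop)
  have hM0 : 0 ≤ M := (norm_nonneg _).trans (hM a (subset_closure ha))
  refine no_log_on_circle (φ := fun θ => l (a.1 + (M + 1) * Real.cos θ, a.2 + (M + 1) * Real.sin θ))
    (ψ := fun _ => 0) (c := (((M + 1 : ℝ)) : ℂ) ^ m) (by fun_prop) continuous_const (by simp) rfl
    (zpow_ne_zero _ (by exact_mod_cast (by linarith : M + 1 ≠ 0))) (fun θ => ?_)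
  have hc := cdiff_circle a (M + 1) θ
  have hnot : ((a.1 + (M + 1) * Real.cos θ, a.2 + (M + 1) * Real.sin θ) : ℝ × ℝ) ∉ closure U := by
    intro hmem
    have := hM _ hmem
    simp only [hc, norm_mul, Complex.norm_exp_ofReal_mul_I, Complex.norm_real, mul_one,
      Real.norm_of_nonneg (by linarith : 0 ≤ M + 1)] at this
    linarith
  rw [hle _ (mem_univ _)]
  simp only [hH, if_neg hnot, hc, mul_zpow, Complex.exp_zero, mul_one, ← Complex.exp_int_mul]

/-- Eilenberg's criterion. -/
lemma component_eq_of_hasLogOn {K : Set (ℝ × ℝ)} (cK : IsCompact K) {a b : ℝ × ℝ}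
    (ha : a ∉ K) (hb : b ∉ K) (h : HasLogOn (fun z => cdiff z a / cdiff z b) K) :
    connectedComponentIn Kᶜ a = connectedComponentIn Kᶜ b := by
  have key : ∀ {a b : ℝ × ℝ}, a ∉ K → b ∉ K → HasLogOn (fun z => cdiff z a / cdiff z b) K →
      connectedComponentIn Kᶜ a ≠ connectedComponentIn Kᶜ b →
      ¬ Bornology.IsBounded (connectedComponentIn Kᶜ a) := by
    intro a b ha hb h hne hbd
    have hcl : ∀ z ∈ closure (connectedComponentIn Kᶜ a), cdiff z b ≠ 0 := by
      intro z hz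
      rw [cdiff_ne_zero]
      rintro rfl
      exact hne (connectedComponentIn_eq ((closure_component_subset cK a hz).resolve_right hb))
    have := zpow_eq_zero_of_hasLogOn cK (isOpen_component cK a) hbd
      (frontier_component_subset cK a) (mem_connectedComponentIn ha)
      (r := fun z => (cdiff z b)⁻¹) (m := 1) (ContinuousOn.inv₀ (by fun_prop) hcl)
      (fun z hz => inv_ne_zero (hcl z hz)) (by simpa [div_eq_mul_inv] using h)
    exact one_ne_zero this
  by_contra hne
  rcases component_bounded_or cK hne with h1 | h1
  · exact key ha hb h hne h1
  · refine key hb ha ?_ (Ne.symm hne) h1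
    obtain ⟨φ, hφ, he⟩ := h
    exact ⟨fun z => -φ z, hφ.neg, fun z hz => by rw [Complex.exp_neg, he z hz, inv_div]⟩

lemma LogTrivial.isPreconnected_compl {K : Set (ℝ × ℝ)} (tK : LogTrivial K) (cK : IsCompact K) :
    IsPreconnected Kᶜ := by
  rcases Kᶜ.eq_empty_or_nonempty with h | ⟨a, ha⟩
  · rw [h]; exact isPreconnected_empty
  · have : Kᶜ = connectedComponentIn Kᶜ a := by
      refine Subset.antisymm (fun b hb => ?_) (connectedComponentIn_subset _ _)
      rw [component_eq_of_hasLogOn cK ha hb]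
      · exact mem_connectedComponentIn hb
      · have hne : ∀ c ∈ Kᶜ, ∀ x ∈ K, cdiff x c ≠ 0 := fun c hc x hx =>
          cdiff_ne_zero.2 (by rintro rfl; exact hc hx)
        exact tK _ (ContinuousOn.div (by fun_prop) (by fun_prop) (hne b hb))
          (fun x hx => div_ne_zero (hne a ha x hx) (hne b hb x hx))
    rw [this]
    exact isPreconnected_connectedComponentIn

/-! ### The Jordan curve theorem -/

/-- `U` and `V` are the two sides of the closed curve `C`. -/
structure Sides (C U V : Set (ℝ × ℝ)) : Prop where
  open_left : IsOpen U
  open_right : IsOpen V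
  conn_left : IsPreconnected U
  conn_right : IsPreconnected V
  nonempty_left : U.Nonempty
  nonempty_right : V.Nonempty
  disj : Disjoint U V
  union_eq : U ∪ V = Cᶜ
  subset_left : C ⊆ closure U
  subset_right : C ⊆ closure V

/-- `K₁` and `K₂` are arcs from `p` to `q` whose union is a simple closed curve. -/
structure IsJordanPair (K₁ K₂ : Set (ℝ × ℝ)) (p q : ℝ × ℝ) : Prop where
  left : IsArc K₁ p q
  right : IsArc K₂ p q
  inter : K₁ ∩ K₂ ⊆ {p, q}

/-- The winding function (times `2πi`) of a closed curve composed of two arcs. -/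
noncomputable def wnum (K₁ K₂ : Set (ℝ × ℝ)) (p q z : ℝ × ℝ) : ℂ :=
  logInc K₁ z p q - logInc K₂ z p q

namespace IsJordanPair

variable {K₁ K₂ : Set (ℝ × ℝ)} {p q : ℝ × ℝ}

lemma symm (J : IsJordanPair K₁ K₂ p q) : IsJordanPair K₂ K₁ p q :=
  ⟨J.right, J.left, by rw [inter_comm]; exact J.inter⟩

lemma isCompact (J : IsJordanPair K₁ K₂ p q) : IsCompact (K₁ ∪ K₂) :=
  J.left.isCompact.union J.right.isCompact

lemma exp_wnum (J : IsJordanPair K₁ K₂ p q) {z : ℝ × ℝ} (hz : z ∉ K₁ ∪ K₂) :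
    Complex.exp (wnum K₁ K₂ p q z) = 1 := by
  have h1 : z ∉ K₁ := fun h => hz (Or.inl h)
  have h2 : z ∉ K₂ := fun h => hz (Or.inr h)
  rw [wnum, Complex.exp_sub,
    exp_logInc J.left.isPreconnected J.left.logTrivial h1 J.left.left_mem J.left.right_mem,
    exp_logInc J.right.isPreconnected J.right.logTrivial h2 J.right.left_mem J.right.right_mem]
  refine div_self (div_ne_zero ?_ ?_) <;> rw [cdiff_ne_zero] <;> rintro rfl
  · exact h1 J.left.right_mem
  · exact h1 J.left.left_mem

lemma continuousOn_wnum (J : IsJordanPair K₁ K₂ p q) :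
    ContinuousOn (wnum K₁ K₂ p q) (K₁ ∪ K₂)ᶜ := by
  rw [compl_union]
  exact ((continuousOn_logInc J.left.isPreconnected J.left.logTrivial J.left.isCompact
    J.left.left_mem J.left.right_mem).mono inter_subset_left).sub
    ((continuousOn_logInc J.right.isPreconnected J.right.logTrivial J.right.isCompact
    J.right.left_mem J.right.right_mem).mono inter_subset_right)

lemma wnum_eq_of_preconnected (J : IsJordanPair K₁ K₂ p q) {S : Set (ℝ × ℝ)} (hS : IsPreconnected S)
    (hd : S ⊆ (K₁ ∪ K₂)ᶜ) {a b : ℝ × ℝ} (ha : a ∈ S) (hb : b ∈ S) :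
    wnum K₁ K₂ p q a = wnum K₁ K₂ p q b :=
  exp_eq_one_const hS (J.continuousOn_wnum.mono hd) (fun _ hx => J.exp_wnum (hd hx)) ha hb

/-- A product of powers of linear factors whose winding numbers cancel has a logarithm. -/
lemma hasLogOn_prod (J : IsJordanPair K₁ K₂ p q) {a b c : ℝ × ℝ} (ha : a ∉ K₁ ∪ K₂)
    (hb : b ∉ K₁ ∪ K₂) (hc : c ∉ K₁ ∪ K₂) {k l m : ℤ}
    (h : k * wnum K₁ K₂ p q a + l * wnum K₁ K₂ p q b + m * wnum K₁ K₂ p q c = 0) :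
    HasLogOn (fun z => cdiff z a ^ k * (cdiff z b ^ l * cdiff z c ^ m)) (K₁ ∪ K₂) := by
  have main : ∀ K, IsArc K p q → K ⊆ K₁ ∪ K₂ → ∃ φ : ℝ × ℝ → ℂ, ContinuousOn φ K ∧
      (∀ z ∈ K, Complex.exp (φ z) = cdiff z a ^ k * (cdiff z b ^ l * cdiff z c ^ m)) ∧
      φ q - φ p = k * logInc K a p q + l * logInc K b p q + m * logInc K c p q := by
    intro K hK hs
    obtain ⟨α, hα, hαe⟩ := hK.logTrivial.hasLogOn_cdiff (fun h => ha (hs h))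
    obtain ⟨β, hβ, hβe⟩ := hK.logTrivial.hasLogOn_cdiff (fun h => hb (hs h))
    obtain ⟨γ, hγ, hγe⟩ := hK.logTrivial.hasLogOn_cdiff (fun h => hc (hs h))
    refine ⟨fun z => k * α z + (l * β z + m * γ z), by fun_prop, fun z hz => ?_, ?_⟩
    · rw [Complex.exp_add, Complex.exp_add, Complex.exp_int_mul, Complex.exp_int_mul,
        Complex.exp_int_mul, hαe z hz, hβe z hz, hγe z hz]
    · rw [logInc_eq hK.isPreconnected hα hαe hK.left_mem hK.right_mem,
        logInc_eq hK.isPreconnected hβ hβe hK.left_mem hK.right_mem,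
        logInc_eq hK.isPreconnected hγ hγe hK.left_mem hK.right_mem]
      ring
  obtain ⟨φ, hφ, hφe, hφi⟩ := main K₁ J.left subset_union_left
  obtain ⟨ψ, hψ, hψe, hψi⟩ := main K₂ J.right subset_union_right
  have hpe : Complex.exp (φ p - ψ p) = 1 := by
    rw [Complex.exp_sub, hφe p J.left.left_mem, ← hψe p J.right.left_mem,
      div_self (Complex.exp_ne_zero _)]
  refine HasLogOn.glue J.left.isClosed J.right.isClosed hφ hφe
    (ψ := fun z => ψ z + (φ p - ψ p)) (by fun_prop) (fun z hz => ?_) (fun z hz => ?_)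
  · rw [Complex.exp_add, hpe, mul_one, hψe z hz]
  · rcases J.inter hz with rfl | rfl
    · ring
    · simp only [wnum] at h
      linear_combination hφi - hψi + h

lemma component_eq_of_wnum_eq (J : IsJordanPair K₁ K₂ p q) {a b : ℝ × ℝ} (ha : a ∉ K₁ ∪ K₂)
    (hb : b ∉ K₁ ∪ K₂) (h : wnum K₁ K₂ p q a = wnum K₁ K₂ p q b) :
    connectedComponentIn (K₁ ∪ K₂)ᶜ a = connectedComponentIn (K₁ ∪ K₂)ᶜ b := by
  refine component_eq_of_hasLogOn J.isCompact ha hb ?_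
  have := J.hasLogOn_prod ha hb hb (k := 1) (l := -1) (m := 0) (by simp [h])
  simpa [div_eq_mul_inv] using this

lemma wnum_eq_or (J : IsJordanPair K₁ K₂ p q) {a b c : ℝ × ℝ} (ha : a ∉ K₁ ∪ K₂)
    (hb : b ∉ K₁ ∪ K₂) (hc : c ∉ K₁ ∪ K₂) (hab : wnum K₁ K₂ p q a ≠ wnum K₁ K₂ p q b) :
    wnum K₁ K₂ p q c = wnum K₁ K₂ p q a ∨ wnum K₁ K₂ p q c = wnum K₁ K₂ p q b := by
  by_contra! hcon
  have two_pi : ((2 * Real.pi * Complex.I : ℂ)) ≠ 0 := Complex.two_pi_I_ne_zero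
  have key : ∀ {a b c : ℝ × ℝ}, a ∉ K₁ ∪ K₂ → b ∉ K₁ ∪ K₂ → c ∉ K₁ ∪ K₂ →
      wnum K₁ K₂ p q a ≠ wnum K₁ K₂ p q b → wnum K₁ K₂ p q a ≠ wnum K₁ K₂ p q c →
      wnum K₁ K₂ p q b ≠ wnum K₁ K₂ p q c →
      ¬ Bornology.IsBounded (connectedComponentIn (K₁ ∪ K₂)ᶜ a) := by
    intro a b c ha hb hc hab hac hbc hbd
    obtain ⟨k, hk⟩ := Complex.exp_eq_one_iff.1 (J.exp_wnum ha)
    obtain ⟨l, hl⟩ := Complex.exp_eq_one_iff.1 (J.exp_wnum hb)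
    obtain ⟨m, hm⟩ := Complex.exp_eq_one_iff.1 (J.exp_wnum hc)
    have hlog := J.hasLogOn_prod ha hb hc (k := l - m) (l := m - k) (m := k - l) (by
      rw [hk, hl, hm]; push_cast; ring)
    have hcl : ∀ d, d ∉ K₁ ∪ K₂ → wnum K₁ K₂ p q a ≠ wnum K₁ K₂ p q d →
        ∀ z ∈ closure (connectedComponentIn (K₁ ∪ K₂)ᶜ a), cdiff z d ≠ 0 := by
      intro d hd hne z hz
      rw [cdiff_ne_zero]
      rintro rfl
      exact hne (J.wnum_eq_of_preconnected isPreconnected_connectedComponentIn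
        (connectedComponentIn_subset _ _) (mem_connectedComponentIn ha)
        ((closure_component_subset J.isCompact a hz).resolve_right hd))
    have h0 := zpow_eq_zero_of_hasLogOn J.isCompact (isOpen_component J.isCompact a) hbd
      (frontier_component_subset J.isCompact a) (mem_connectedComponentIn ha)
      (ContinuousOn.mul
        (ContinuousOn.zpow₀ (by fun_prop) _ (fun z hz => Or.inl (hcl b hb hab z hz)))
        (ContinuousOn.zpow₀ (by fun_prop) _ (fun z hz => Or.inl (hcl c hc hac z hz))))
      (fun z hz => mul_ne_zero (zpow_ne_zero _ (hcl b hb hab z hz))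
        (zpow_ne_zero _ (hcl c hc hac z hz))) hlog
    rw [sub_eq_zero] at h0
    rw [hl, hm, h0] at hbc
    exact hbc rfl
  have hne : connectedComponentIn (K₁ ∪ K₂)ᶜ a ≠ connectedComponentIn (K₁ ∪ K₂)ᶜ b := by
    intro h
    refine hab (J.wnum_eq_of_preconnected isPreconnected_connectedComponentIn
        (connectedComponentIn_subset _ a) (mem_connectedComponentIn ha) ?_)
    rw [h]
    exact mem_connectedComponentIn hb
  rcases component_bounded_or J.isCompact hne with h | h
  · exact key ha hb hc hab hcon.1.symm hcon.2.symm h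
  · exact key hb ha hc hab.symm hcon.2.symm hcon.1.symm h

end IsJordanPair

namespace IsJordanPair

variable {K₁ K₂ U V : Set (ℝ × ℝ)} {p q : ℝ × ℝ}

open Classical in
lemma exists_wnum_ne (J : IsJordanPair K₁ K₂ p q) : ∃ a b, a ∉ K₁ ∪ K₂ ∧ b ∉ K₁ ∪ K₂ ∧
    wnum K₁ K₂ p q a ≠ wnum K₁ K₂ p q b := by
  by_contra! hcon
  obtain ⟨c, hc⟩ : ∃ c, ∀ z, z ∉ K₁ ∪ K₂ → wnum K₁ K₂ p q z = c := by
    by_cases h : ∃ a, a ∉ K₁ ∪ K₂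
    · obtain ⟨a, ha⟩ := h
      exact ⟨_, fun z hz => hcon z a hz ha⟩
    · exact ⟨0, fun z hz => (h ⟨z, hz⟩).elim⟩
  have hA := continuousOn_logInc J.left.isPreconnected J.left.logTrivial J.left.isCompact
    J.left.left_mem J.left.right_mem
  have hB := continuousOn_logInc J.right.isPreconnected J.right.logTrivial J.right.isCompact
    J.right.left_mem J.right.right_mem
  set l : ℝ × ℝ → ℂ := fun z => if z ∈ K₁ then logInc K₂ z p q + c else logInc K₁ z p q with hl
  have hl2 : ∀ z, z ∉ K₂ → l z = logInc K₂ z p q + c := by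
    intro z hz
    by_cases h : z ∈ K₁
    · simp [hl, h]
    · have := hc z (by simp [h, hz])
      simp only [hl, if_neg h]
      rw [← this, wnum]; ring
  have hl1 : ∀ z, z ∉ K₁ → l z = logInc K₁ z p q := fun z hz => by simp [hl, hz]
  have hcont : ∀ z, z ≠ p → z ≠ q → ContinuousAt l z := by
    intro z hzp hzq
    by_cases h : z ∈ K₁
    · have h2 : z ∉ K₂ := fun h2 => by
        rcases J.inter ⟨h, h2⟩ with rfl | rfl
        · exact hzp rfl
        · exact hzq rfl
      have hn := J.right.isClosed.isOpen_compl.mem_nhds h2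
      exact ((hB.continuousAt hn).add continuousAt_const).congr
        (Filter.mem_of_superset hn fun y hy => (hl2 y hy).symm)
    · have hn := J.left.isClosed.isOpen_compl.mem_nhds h
      exact (hA.continuousAt hn).congr (Filter.mem_of_superset hn fun y hy => (hl1 y hy).symm)
  have hexpc : Complex.exp c = 1 ∨ ∀ z, z ∈ K₁ ∪ K₂ := by
    by_cases h : ∀ z, z ∈ K₁ ∪ K₂
    · exact Or.inr h
    · push Not at h
      obtain ⟨z, hz⟩ := h
      left; rw [← hc z hz, J.exp_wnum hz]
  have hexpc : Complex.exp c = 1 := by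
    rcases hexpc with h | h
    · exact h
    · exfalso
      have hu : K₁ ∪ K₂ = univ := eq_univ_of_forall h
      exact noncompact_univ (ℝ × ℝ) (hu ▸ J.isCompact)
  have hexp : ∀ z, z ≠ p → z ≠ q → Complex.exp (l z) = cdiff q z / cdiff p z := by
    intro z hzp hzq
    by_cases h : z ∈ K₁
    · have h2 : z ∉ K₂ := fun h2 => by
        rcases J.inter ⟨h, h2⟩ with rfl | rfl
        · exact hzp rfl
        · exact hzq rfl
      rw [hl2 z h2, Complex.exp_add, hexpc, mul_one, exp_logInc J.right.isPreconnected
        J.right.logTrivial h2 J.right.left_mem J.right.right_mem]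
    · rw [hl1 z h, exp_logInc J.left.isPreconnected J.left.logTrivial h J.left.left_mem
        J.left.right_mem]
  have hpq : cdiff q p ≠ 0 := cdiff_ne_zero.2 J.left.ne.symm
  set R : ℝ := ‖cdiff q p‖ / 2 with hR
  have hR0 : 0 < R := by positivity
  have hRC : (R : ℂ) ≠ 0 := by exact_mod_cast hR0.ne'
  set γ : ℝ → ℝ × ℝ := fun θ => (p.1 + R * Real.cos θ, p.2 + R * Real.sin θ) with hγ
  have hcγ : Continuous γ := by fun_prop
  have hγd : ∀ θ, cdiff (γ θ) p = R * Complex.exp (θ * Complex.I) := fun θ => cdiff_circle p R θ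
  have hγn : ∀ θ, ‖cdiff (γ θ) p‖ = R := fun θ => by
    rw [hγd, norm_mul, Complex.norm_exp_ofReal_mul_I, mul_one, Complex.norm_real,
      Real.norm_of_nonneg hR0.le]
  have hγp : ∀ θ, γ θ ≠ p := fun θ h => by
    have := hγn θ
    rw [h, cdiff_eq_zero.2 rfl, norm_zero] at this
    exact hR0.ne this
  have hγq : ∀ θ, γ θ ≠ q := fun θ h => by
    have := hγn θ
    rw [h] at this
    rw [hR] at this
    linarith [norm_pos_iff.2 hpq]
  have hslit : ∀ θ, cdiff q (γ θ) / cdiff q p ∈ Complex.slitPlane := by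
    intro θ
    have h1 : cdiff q (γ θ) / cdiff q p = 1 - cdiff (γ θ) p / cdiff q p := by
      rw [eq_sub_iff_add_eq, ← add_div, div_eq_one_iff_eq hpq]
      simp [cdiff, Complex.ext_iff]
    have h2 : ‖cdiff (γ θ) p / cdiff q p‖ < 1 := by
      rw [norm_div, hγn, div_lt_one (norm_pos_iff.2 hpq), hR]
      linarith [norm_pos_iff.2 hpq]
    rw [h1, Complex.mem_slitPlane_iff]
    left
    have := (Complex.abs_re_le_norm _).trans_lt h2
    have := (abs_lt.1 this).2
    simp only [Complex.sub_re, Complex.one_re]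
    linarith
  have := no_log_on_circle (φ := fun θ => l (γ θ))
    (ψ := fun θ => Complex.log (cdiff q (γ θ) / cdiff q p)) (m := -1)
    (c := -(cdiff q p) / R)
    (continuous_iff_continuousAt.2 fun θ =>
      ContinuousAt.comp (g := l) (hcont _ (hγp θ) (hγq θ)) hcγ.continuousAt)
    (by
      refine Continuous.clog ?_ hslit
      exact (continuous_const.cdiff hcγ).div_const _)
    (by simp [hγ]) (by simp [hγ]) (div_ne_zero (neg_ne_zero.2 hpq) hRC) (fun θ => by
      rw [hexp _ (hγp θ) (hγq θ), Complex.exp_log (Complex.slitPlane_ne_zero (hslit θ)),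
        cdiff_swap p, hγd, Complex.exp_int_mul, zpow_neg, zpow_one]
      have := Complex.exp_ne_zero (θ * Complex.I)
      field_simp)
  norm_num at this

lemma closure_of_partition (J : IsJordanPair K₁ K₂ p q) (oU : IsOpen U) (oV : IsOpen V)
    (nU : U.Nonempty) (nV : V.Nonempty) (hd : Disjoint U V) (hu : U ∪ V = (K₁ ∪ K₂)ᶜ) :
    K₁ ∪ K₂ ⊆ closure U := by
  have main : ∀ {K₁ K₂ : Set (ℝ × ℝ)}, IsJordanPair K₁ K₂ p q → U ∪ V = (K₁ ∪ K₂)ᶜ →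
      K₁ ⊆ closure U := by
    intro K₁ K₂ J hu
    by_contra hcon
    have hN : IsOpen (closure U)ᶜ := isClosed_closure.isOpen_compl
    obtain ⟨y, hy, hyU⟩ := not_subset.1 hcon
    obtain ⟨x, hxN, hx, hxpq⟩ := mem_closure_iff.1 (J.left.subset_closure_diff hy) _ hN hyU
    simp only [mem_insert_iff, mem_singleton_iff, not_or] at hxpq
    obtain ⟨y, z, A, B, hA, hB, hAB, hdAB, hKN⟩ :=
      J.left.exists_gap hN hx hxN hxpq.1 hxpq.2
    have hqA : q ∉ A := fun h => disjoint_left.1 hdAB h hB.right_mem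
    have hpB : p ∉ B := fun h => disjoint_left.1 hdAB hA.left_mem h
    have t1 : LogTrivial (A ∪ K₂) := by
      refine hA.logTrivial.union J.right.logTrivial hA.isClosed J.right.isClosed (c := p) ?_
      rintro x ⟨hx1, hx2⟩
      rcases J.inter ⟨hAB (Or.inl hx1), hx2⟩ with rfl | rfl
      · rfl
      · exact (hqA hx1).elim
    have t2 : LogTrivial ((A ∪ K₂) ∪ B) := by
      refine t1.union hB.logTrivial (hA.isClosed.union J.right.isClosed) hB.isClosed (c := q) ?_
      rintro x ⟨hx1, hx2⟩
      rcases hx1 with hx1 | hx1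
      · exact (disjoint_left.1 hdAB hx1 hx2).elim
      · rcases J.inter ⟨hAB (Or.inr hx2), hx1⟩ with rfl | rfl
        · exact (hpB hx2).elim
        · rfl
    have hconn := t2.isPreconnected_compl
      ((hA.isCompact.union J.right.isCompact).union hB.isCompact)
    have hsub : (K₁ ∪ K₂)ᶜ ⊆ ((A ∪ K₂) ∪ B)ᶜ := by
      refine compl_subset_compl.2 ?_
      rintro x ((hx | hx) | hx)
      · exact Or.inl (hAB (Or.inl hx))
      · exact Or.inr hx
      · exact Or.inl (hAB (Or.inr hx))
    have hVcl : Disjoint (closure U) V := hd.closure_left oV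
    have hcov : ((A ∪ K₂) ∪ B)ᶜ ⊆ U ∪ (closure U)ᶜ := by
      intro x hx
      by_cases hxU : x ∈ U
      · exact Or.inl hxU
      right
      intro hxc
      have hxV : x ∉ V := disjoint_left.1 hVcl hxc
      have hxC : x ∈ K₁ ∪ K₂ := by
        by_contra h
        have : x ∈ U ∪ V := by rw [hu]; exact h
        exact this.elim hxU hxV
      rcases hxC with h | h
      · rcases hKN ⟨h, fun hn => hn hxc⟩ with h | h
        · exact hx (Or.inl (Or.inl h))
        · exact hx (Or.inr h)
      · exact hx (Or.inl (Or.inr h))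
    obtain ⟨u, hu'⟩ := nU
    obtain ⟨v, hv⟩ := nV
    have hle := hconn.subset_left_of_subset_union oU hN
      (disjoint_compl_right_iff_subset.2 subset_closure) hcov
      ⟨u, hsub (hu ▸ Or.inl hu'), hu'⟩
    exact disjoint_left.1 hd (hle (hsub (hu ▸ Or.inr hv))) hv
  exact union_subset (main J hu) (main J.symm (by rw [hu, union_comm]))

/-- The Jordan curve theorem. -/
theorem exists_sides (J : IsJordanPair K₁ K₂ p q) : ∃ U V, Sides (K₁ ∪ K₂) U V := by
  obtain ⟨a, b, ha, hb, hab⟩ := J.exists_wnum_ne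
  have hne : connectedComponentIn (K₁ ∪ K₂)ᶜ a ≠ connectedComponentIn (K₁ ∪ K₂)ᶜ b := by
    intro h
    refine hab (J.wnum_eq_of_preconnected isPreconnected_connectedComponentIn
        (connectedComponentIn_subset _ a) (mem_connectedComponentIn ha) ?_)
    rw [h]
    exact mem_connectedComponentIn hb
  have hd : Disjoint (connectedComponentIn (K₁ ∪ K₂)ᶜ a) (connectedComponentIn (K₁ ∪ K₂)ᶜ b) := by
    rw [disjoint_left]
    intro x h1 h2
    exact hne ((connectedComponentIn_eq h1).trans (connectedComponentIn_eq h2).symm)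
  have hu : connectedComponentIn (K₁ ∪ K₂)ᶜ a ∪ connectedComponentIn (K₁ ∪ K₂)ᶜ b =
      (K₁ ∪ K₂)ᶜ := by
    refine Subset.antisymm (union_subset (connectedComponentIn_subset _ _)
      (connectedComponentIn_subset _ _)) (fun c hc => ?_)
    rcases J.wnum_eq_or ha hb hc hab with h | h
    · left; rw [← J.component_eq_of_wnum_eq hc ha h]; exact mem_connectedComponentIn hc
    · right; rw [← J.component_eq_of_wnum_eq hc hb h]; exact mem_connectedComponentIn hc
  have na : (connectedComponentIn (K₁ ∪ K₂)ᶜ a).Nonempty := ⟨a, mem_connectedComponentIn ha⟩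
  have nb : (connectedComponentIn (K₁ ∪ K₂)ᶜ b).Nonempty := ⟨b, mem_connectedComponentIn hb⟩
  have oa := isOpen_component J.isCompact a
  have ob := isOpen_component J.isCompact b
  exact ⟨_, _, oa, ob, isPreconnected_connectedComponentIn, isPreconnected_connectedComponentIn,
    na, nb, hd, hu, J.closure_of_partition oa ob na nb hd hu,
    J.closure_of_partition ob oa nb na hd.symm (by rw [union_comm, hu])⟩

end IsJordanPair

/-! ### Sides of closed curves -/

namespace Sides

variable {C C₁ C₂ U V U₁ V₁ U₂ V₂ S : Set (ℝ × ℝ)} {a b : ℝ × ℝ}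

lemma symm (h : Sides C U V) : Sides C V U :=
  ⟨h.open_right, h.open_left, h.conn_right, h.conn_left, h.nonempty_right, h.nonempty_left,
    h.disj.symm, by rw [union_comm, h.union_eq], h.subset_right, h.subset_left⟩

lemma disj_left (h : Sides C U V) : Disjoint C U := by
  rw [← subset_compl_iff_disjoint_left, ← h.union_eq]; exact subset_union_left

lemma disj_right (h : Sides C U V) : Disjoint C V := h.symm.disj_left

lemma mem_cases (h : Sides C U V) (x : ℝ × ℝ) : x ∈ U ∨ x ∈ V ∨ x ∈ C := by
  by_cases hx : x ∈ C
  · exact Or.inr (Or.inr hx)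
  · have : x ∈ U ∪ V := by rw [h.union_eq]; exact hx
    exact this.imp_right Or.inl

lemma closure_disj (h : Sides C U V) : Disjoint (closure U) V := h.disj.closure_left h.open_right

lemma closure_eq (h : Sides C U V) : closure U = U ∪ C := by
  refine Subset.antisymm (fun x hx => ?_) (union_subset subset_closure h.subset_left)
  rcases h.mem_cases x with h1 | h1 | h1
  · exact Or.inl h1
  · exact (disjoint_left.1 h.closure_disj hx h1).elim
  · exact Or.inr h1

lemma mem_closure_iff_notMem (h : Sides C U V) {x : ℝ × ℝ} : x ∈ closure U ↔ x ∉ V := by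
  constructor
  · exact fun hx => disjoint_left.1 h.closure_disj hx
  · intro hx
    rw [h.closure_eq]
    rcases h.mem_cases x with h1 | h1 | h1
    · exact Or.inl h1
    · exact (hx h1).elim
    · exact Or.inr h1

lemma subset_closure_iff (h : Sides C U V) {T : Set (ℝ × ℝ)} : T ⊆ closure U ↔ Disjoint T V := by
  rw [disjoint_left]
  exact forall₂_congr fun x _ => h.mem_closure_iff_notMem

lemma right_eq (h : Sides C U V) : V = (closure U)ᶜ := by
  ext x
  rw [mem_compl_iff, h.mem_closure_iff_notMem, not_not]

/-- A connected set avoiding the curve lies on one side. -/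
lemma subset_or (h : Sides C U V) (hS : IsPreconnected S) (hd : Disjoint S C) :
    S ⊆ U ∨ S ⊆ V :=
  hS.subset_or_subset h.open_left h.open_right h.disj
    (by rw [h.union_eq]; exact hd.subset_compl_right)

lemma subset_left_of_mem (h : Sides C U V) (hS : IsPreconnected S) (hd : Disjoint S C)
    {x : ℝ × ℝ} (hx : x ∈ S) (hxU : x ∈ U) : S ⊆ U :=
  (h.subset_or hS hd).resolve_right fun hV => disjoint_left.1 h.disj hxU (hV hx)

lemma unique (h₁ : Sides C U₁ V₁) (h₂ : Sides C U₂ V₂) :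
    (U₁ = U₂ ∧ V₁ = V₂) ∨ (U₁ = V₂ ∧ V₁ = U₂) := by
  have key : ∀ {U₁ V₁ U₂ V₂ : Set (ℝ × ℝ)}, Sides C U₁ V₁ → Sides C U₂ V₂ → U₁ ⊆ U₂ →
      U₁ = U₂ ∧ V₁ = V₂ := by
    intro U₁ V₁ U₂ V₂ h₁ h₂ hs
    obtain ⟨x, hx⟩ := h₁.nonempty_left
    have hs' : U₂ ⊆ U₁ := h₁.subset_left_of_mem h₂.conn_left h₂.disj_left.symm (hs hx) hx
    have hU : U₁ = U₂ := hs.antisymm hs'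
    exact ⟨hU, by rw [h₁.right_eq, h₂.right_eq, hU]⟩
  rcases h₂.subset_or h₁.conn_left h₁.disj_left.symm with h | h
  · exact Or.inl (key h₁ h₂ h)
  · exact Or.inr (key h₁ h₂.symm h)

/-- If `C₂` meets both sides of `C₁`, then `C₁` meets each side of `C₂`. -/
lemma exists_mem_of_meets (h₁ : Sides C₁ U₁ V₁) (h₂ : Sides C₂ U₂ V₂) (hU : a ∈ C₂) (hU' : a ∈ U₁)
    (hV : b ∈ C₂) (hV' : b ∈ V₁) : ∃ x ∈ C₁, x ∈ U₂ := by
  by_contra! hcon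
  have hd : Disjoint U₂ C₁ := disjoint_right.2 hcon
  rcases h₁.subset_or h₂.conn_left hd with h | h
  · exact disjoint_left.1 h₁.closure_disj (closure_mono h (h₂.subset_left hV)) hV'
  · exact disjoint_left.1 h₁.symm.closure_disj (closure_mono h (h₂.subset_left hU)) hU'

/-- A connected open set disjoint from the curve: its closure lies in one closed side. -/
lemma closure_subset_or (h : Sides C U V) (hS : IsPreconnected S) (hd : Disjoint S C) :
    closure S ⊆ closure U ∨ closure S ⊆ closure V :=
  (h.subset_or hS hd).imp (fun h => closure_mono h) (fun h => closure_mono h)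

end Sides

lemma IsJordanPair.wnum_ne {K₁ K₂ U V : Set (ℝ × ℝ)} {p q a b : ℝ × ℝ}
    (J : IsJordanPair K₁ K₂ p q) (h : Sides (K₁ ∪ K₂) U V) (ha : a ∈ U) (hb : b ∈ V) :
    wnum K₁ K₂ p q a ≠ wnum K₁ K₂ p q b := by
  intro heq
  have ha' : a ∉ K₁ ∪ K₂ := fun h' => disjoint_left.1 h.disj_left h' ha
  have hb' : b ∉ K₁ ∪ K₂ := fun h' => disjoint_left.1 h.disj_right h' hb
  have hc := J.component_eq_of_wnum_eq ha' hb' heq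
  have := h.subset_left_of_mem (S := connectedComponentIn (K₁ ∪ K₂)ᶜ a)
    isPreconnected_connectedComponentIn
    (disjoint_compl_left.mono_left (connectedComponentIn_subset _ _))
    (mem_connectedComponentIn ha') ha
  rw [hc] at this
  exact disjoint_left.1 h.disj (this (mem_connectedComponentIn hb')) hb

lemma IsJordanPair.wnum_eq {K₁ K₂ U V : Set (ℝ × ℝ)} {p q a b : ℝ × ℝ}
    (J : IsJordanPair K₁ K₂ p q) (h : Sides (K₁ ∪ K₂) U V) (ha : a ∈ U) (hb : b ∈ U) :
    wnum K₁ K₂ p q a = wnum K₁ K₂ p q b :=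
  J.wnum_eq_of_preconnected h.conn_left h.disj_left.symm.subset_compl_right ha hb

/-! ### The theta curve -/

/-- The curve `K₁ ∪ K₂` with sides `E`, `O` and a chord `K₃` through `E`; the chord cuts `E` into
`E₁` (bounded by `K₁ ∪ K₃`) and `E₂` (bounded by `K₂ ∪ K₃`). -/
structure IsTheta (K₁ K₂ K₃ E O E₁ O₁ E₂ O₂ : Set (ℝ × ℝ)) (p q : ℝ × ℝ) : Prop where
  sides_left : Sides (K₁ ∪ K₃) E₁ O₁
  sides_right : Sides (K₂ ∪ K₃) E₂ O₂
  subset_left : E₁ ⊆ E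
  subset_right : E₂ ⊆ E
  outer_left : O ⊆ O₁
  outer_right : O ⊆ O₂
  disj : Disjoint E₁ E₂
  cover : E ⊆ E₁ ∪ E₂ ∪ K₃
  inter_left : closure E₁ ∩ K₂ ⊆ {p, q}
  inter_right : closure E₂ ∩ K₁ ⊆ {p, q}

lemma exists_theta {K₁ K₂ K₃ E O : Set (ℝ × ℝ)} {p q : ℝ × ℝ} (J : IsJordanPair K₁ K₂ p q)
    (J₁ : IsJordanPair K₁ K₃ p q) (J₂ : IsJordanPair K₂ K₃ p q) (h : Sides (K₁ ∪ K₂) E O)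
    (hK : K₃ \ {p, q} ⊆ E) : ∃ E₁ O₁ E₂ O₂, IsTheta K₁ K₂ K₃ E O E₁ O₁ E₂ O₂ p q := by
  have hK₃O : Disjoint K₃ O := by
    rw [disjoint_left]
    intro x hx hxO
    by_cases hpq : x ∈ ({p, q} : Set (ℝ × ℝ))
    · refine disjoint_left.1 h.disj_right ?_ hxO
      rcases hpq with rfl | rfl
      · exact Or.inl J.left.left_mem
      · exact Or.inl J.left.right_mem
    · exact disjoint_left.1 h.disj (hK ⟨hx, hpq⟩) hxO
  have main : ∀ {K L}, IsJordanPair K K₃ p q → K ∪ L = K₁ ∪ K₂ →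
      ∃ E₁ O₁, Sides (K ∪ K₃) E₁ O₁ ∧ O ⊆ O₁ ∧ E₁ ⊆ E ∧ Disjoint E₁ L := by
    intro K L JK hKL
    have hdO : Disjoint O (K ∪ K₃) := by
      rw [disjoint_union_right]
      refine ⟨(h.disj_right.mono_left ?_).symm, hK₃O.symm⟩
      rw [← hKL]; exact subset_union_left
    obtain ⟨E₁, O₁, hs, hO⟩ : ∃ E₁ O₁, Sides (K ∪ K₃) E₁ O₁ ∧ O ⊆ O₁ := by
      obtain ⟨U, V, hUV⟩ := JK.exists_sides
      rcases hUV.subset_or h.conn_right hdO with h' | h'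
      · exact ⟨V, U, hUV.symm, h'⟩
      · exact ⟨U, V, hUV, h'⟩
    have hEd : Disjoint (closure O) E₁ := (hs.disj.symm.mono_left hO).closure_left hs.open_left
    refine ⟨E₁, O₁, hs, hO, fun x hx => ?_, ?_⟩
    · by_contra hxE
      exact disjoint_right.1 hEd hx (h.symm.mem_closure_iff_notMem.2 hxE)
    · refine (hEd.mono_left ?_).symm
      refine Subset.trans ?_ h.subset_right
      rw [← hKL]; exact subset_union_right
  obtain ⟨E₁, O₁, hs₁, hO₁, hE₁, hd₁⟩ := main J₁ rfl
  obtain ⟨E₂, O₂, hs₂, hO₂, hE₂, hd₂⟩ := main J₂ (union_comm K₂ K₁)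
  have i1 : closure E₁ ∩ K₂ ⊆ {p, q} := by
    rintro x ⟨hx, hx2⟩
    rw [hs₁.closure_eq] at hx
    rcases hx with hx | hx | hx
    · exact (disjoint_left.1 hd₁ hx hx2).elim
    · exact J.inter ⟨hx, hx2⟩
    · exact J₂.inter ⟨hx2, hx⟩
  have i2 : closure E₂ ∩ K₁ ⊆ {p, q} := by
    rintro x ⟨hx, hx2⟩
    rw [hs₂.closure_eq] at hx
    rcases hx with hx | hx | hx
    · exact (disjoint_left.1 hd₂ hx hx2).elim
    · exact J.inter ⟨hx2, hx⟩
    · exact J₁.inter ⟨hx2, hx⟩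
  have hd : Disjoint E₁ E₂ := by
    rw [disjoint_left]
    intro z hz1 hz2
    have d1 : Disjoint E₁ (K₂ ∪ K₃) := by
      rw [disjoint_union_right]
      exact ⟨hd₁, hs₁.disj_left.symm.mono_right subset_union_right⟩
    have : E₁ ⊆ E₂ := hs₂.subset_left_of_mem hs₁.conn_left d1 hz1 hz2
    have hcl : K₁ ⊆ closure E₂ :=
      (subset_union_left.trans hs₁.subset_left).trans (closure_mono this)
    obtain ⟨x, hx⟩ : (K₁ \ {p, q}).Nonempty := by
      rw [← closure_nonempty_iff]
      exact ⟨p, J.left.subset_closure_diff J.left.left_mem⟩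
    exact hx.2 (i2 ⟨hcl hx.1, hx.1⟩)
  refine ⟨E₁, O₁, E₂, O₂, hs₁, hs₂, hE₁, hE₂, hO₁, hO₂, hd, fun z hz => ?_, i1, i2⟩
  by_contra hcon
  simp only [mem_union, not_or] at hcon
  obtain ⟨o, ho⟩ := h.nonempty_right
  have hzC : z ∉ K₁ ∪ K₂ := disjoint_right.1 h.disj_left hz
  have hz1 : z ∈ O₁ := by
    rcases hs₁.mem_cases z with h' | h' | h' | h'
    exacts [(hcon.1.1 h').elim, h', (hzC (Or.inl h')).elim, (hcon.2 h').elim]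
  have hz2 : z ∈ O₂ := by
    rcases hs₂.mem_cases z with h' | h' | h' | h'
    exacts [(hcon.1.2 h').elim, h', (hzC (Or.inr h')).elim, (hcon.2 h').elim]
  refine J.wnum_ne h hz ho ?_
  have e1 := J₁.wnum_eq hs₁.symm hz1 (hO₁ ho)
  have e2 := J₂.wnum_eq hs₂.symm hz2 (hO₂ ho)
  simp only [wnum] at *
  linear_combination e1 - e2

/-! ### Germs of arcs and local separation -/

/-- The arc `K` issuing from `o` starts inside `U`. -/
def GermIn (o : ℝ × ℝ) (K U : Set (ℝ × ℝ)) : Prop := ∃ N ∈ nhds o, (K ∩ N) \ {o} ⊆ U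

lemma GermIn.mono {o : ℝ × ℝ} {K U V : Set (ℝ × ℝ)} (h : GermIn o K U) (hUV : U ⊆ V) :
    GermIn o K V := by
  obtain ⟨N, hN, hs⟩ := h
  exact ⟨N, hN, hs.trans hUV⟩

lemma GermIn.of_subset {o : ℝ × ℝ} {K U : Set (ℝ × ℝ)} (h : K \ {o} ⊆ U) : GermIn o K U :=
  ⟨univ, Filter.univ_mem, by simpa using h⟩

lemma GermIn.restrict {o : ℝ × ℝ} {K K' U : Set (ℝ × ℝ)} (h : GermIn o K U) (hs : K' ⊆ K) :
    GermIn o K' U := by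
  obtain ⟨N, hN, hs'⟩ := h
  exact ⟨N, hN, fun x hx => hs' ⟨⟨hs hx.1.1, hx.1.2⟩, hx.2⟩⟩

lemma GermIn.extend {o : ℝ × ℝ} {K L U : Set (ℝ × ℝ)} (h : GermIn o K U) (hL : IsClosed L)
    (ho : o ∉ L) : GermIn o (K ∪ L) U := by
  obtain ⟨N, hN, hs⟩ := h
  refine ⟨N ∩ Lᶜ, Filter.inter_mem hN (hL.isOpen_compl.mem_nhds ho), ?_⟩
  rintro x ⟨⟨hx | hx, hxN, hxL⟩, hxo⟩
  · exact hs ⟨⟨hx, hxN⟩, hxo⟩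
  · exact (hxL hx).elim

/-- A germ contains points of the arc arbitrarily close to the origin. -/
lemma GermIn.exists_mem {o a : ℝ × ℝ} {K U N : Set (ℝ × ℝ)} (h : GermIn o K U) (hK : IsArc K o a)
    (hN : N ∈ nhds o) : ∃ x ∈ K, x ∈ U ∧ x ∈ N ∧ x ≠ o := by
  obtain ⟨M, hM, hs⟩ := h
  obtain ⟨W, hW, oW, hoW⟩ := mem_nhds_iff.1 (Filter.inter_mem hM hN)
  obtain ⟨x, A, B, hA, -, hAB, -, hd⟩ := hK.exists_initial oW.isClosed_compl (by simpa using hoW)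
  rw [disjoint_compl_right_iff_subset] at hd
  have hxA := hA.right_mem
  have hxK : x ∈ K := hAB ▸ Or.inl hxA
  exact ⟨x, hxK, hs ⟨⟨hxK, (hW (hd hxA)).1⟩, hA.ne.symm⟩, (hW (hd hxA)).2, hA.ne.symm⟩

lemma GermIn.not_disjoint {o a : ℝ × ℝ} {K U V : Set (ℝ × ℝ)} (h : GermIn o K U)
    (h' : GermIn o K V) (hK : IsArc K o a) : ¬ Disjoint U V := by
  obtain ⟨N, hN, hs⟩ := h'
  obtain ⟨x, hx, hxU, hxN, hxo⟩ := h.exists_mem hK hN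
  exact not_disjoint_iff.2 ⟨x, hxU, hs ⟨⟨hx, hxN⟩, hxo⟩⟩

/-- If `K` meets the curve near `o` only in `o`, then it starts inside one of the sides. -/
lemma Sides.germIn_or {o a : ℝ × ℝ} {C U V K F : Set (ℝ × ℝ)} (h : Sides C U V)
    (hK : IsArc K o a) (hF : IsClosed F) (ho : o ∉ F) (hKC : K ∩ C ⊆ insert o F) :
    GermIn o K U ∨ GermIn o K V := by
  obtain ⟨x, A, B, hA, hB, rfl, hi, hd⟩ := hK.exists_initial hF ho
  have hoB : o ∉ B := fun hoB => hA.ne (by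
    have : o ∈ A ∩ B := ⟨hA.left_mem, hoB⟩
    rw [hi] at this
    exact this)
  have hAC : Disjoint (A \ {o}) C := by
    rw [disjoint_left]
    rintro y ⟨hyA, hyo⟩ hyC
    rcases hKC ⟨Or.inl hyA, hyC⟩ with h' | h'
    · exact hyo h'
    · exact disjoint_left.1 hd hyA h'
  exact (h.subset_or hA.isPreconnected_diff_left hAC).imp
    (fun h => (GermIn.of_subset h).extend hB.isClosed hoB)
    (fun h => (GermIn.of_subset h).extend hB.isClosed hoB)

/-- If `K` meets the curve only in its starting point, it stays in the side it starts in. -/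
lemma Sides.subset_of_germIn {o a : ℝ × ℝ} {C U V K : Set (ℝ × ℝ)} (h : Sides C U V)
    (hK : IsArc K o a) (hKC : K ∩ C ⊆ {o}) (hg : GermIn o K U) : K \ {o} ⊆ U := by
  have hd : Disjoint (K \ {o}) C := disjoint_left.2 fun x hx hxC => hx.2 (hKC ⟨hx.1, hxC⟩)
  refine (h.subset_or hK.isPreconnected_diff_left hd).resolve_right fun h' => ?_
  exact hg.not_disjoint (GermIn.of_subset h') hK h.disj

/-- A simple closed curve composed of three arcs, with a distinguished point `o`. -/
structure IsTri (A ρ B : Set (ℝ × ℝ)) (o a b : ℝ × ℝ) : Prop where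
  left : IsArc A o a
  mid : IsArc ρ a b
  right : IsArc B o b
  left_mid : A ∩ ρ ⊆ {a}
  right_mid : B ∩ ρ ⊆ {b}
  left_right : A ∩ B ⊆ {o}

namespace IsTri

variable {A ρ ρ' B U V U' V' K L A₁ A₂ : Set (ℝ × ℝ)} {o a b a' k l : ℝ × ℝ}

lemma symm (h : IsTri A ρ B o a b) : IsTri B ρ A o b a :=
  ⟨h.right, h.mid.symm, h.left, h.right_mid, h.left_mid, by rw [inter_comm]; exact h.left_right⟩

lemma notMem_mid (h : IsTri A ρ B o a b) : o ∉ ρ := fun ho =>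
  h.left.ne (h.left_mid ⟨h.left.left_mem, ho⟩)

lemma jordan (h : IsTri A ρ B o a b) : IsJordanPair (A ∪ ρ) B o b := by
  refine ⟨h.left.trans h.mid h.left_mid, h.right, ?_⟩
  rintro x ⟨hx | hx, hxB⟩
  · exact Or.inl (h.left_right ⟨hx, hxB⟩)
  · exact Or.inr (h.right_mid ⟨hxB, hx⟩)

lemma exists_sides (h : IsTri A ρ B o a b) : ∃ U V, Sides (A ∪ ρ ∪ B) U V := h.jordan.exists_sides

lemma wnum_eq (h : IsTri A ρ B o a b) {z : ℝ × ℝ} (hz : z ∉ A ∪ ρ ∪ B) :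
    wnum (A ∪ ρ) B o b z = logInc A z o a + logInc ρ z a b - logInc B z o b := by
  have hz' : z ∉ A ∪ ρ := fun h => hz (Or.inl h)
  have hJ := h.jordan.left
  rw [wnum, logInc_mono hJ.isPreconnected hJ.logTrivial h.left.isPreconnected subset_union_left hz'
    h.left.left_mem h.left.right_mem, logInc_mono hJ.isPreconnected hJ.logTrivial
    h.mid.isPreconnected subset_union_right hz' h.mid.left_mem h.mid.right_mem, logInc_add]

/-- Shorten the first arc. -/
lemma shorten (h : IsTri A ρ B o a b) (h₁ : IsArc A₁ o a') (h₂ : IsArc A₂ a' a)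
    (hu : A = A₁ ∪ A₂) (hi : A₁ ∩ A₂ = {a'}) : IsTri A₁ (A₂ ∪ ρ) B o a' b := by
  have haA₁ : a ∉ A₁ := fun ha => h₂.ne (by
    have : a ∈ A₁ ∩ A₂ := ⟨ha, h₂.right_mem⟩
    rw [hi] at this; exact this.symm)
  have hoA₂ : o ∉ A₂ := fun ha => h₁.ne (by
    have : o ∈ A₁ ∩ A₂ := ⟨h₁.left_mem, ha⟩
    rw [hi] at this; exact this)
  have s1 : A₁ ⊆ A := hu ▸ subset_union_left
  have s2 : A₂ ⊆ A := hu ▸ subset_union_right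
  refine ⟨h₁, h₂.trans h.mid fun x hx => h.left_mid ⟨s2 hx.1, hx.2⟩, h.right, ?_, ?_,
    fun x hx => h.left_right ⟨s1 hx.1, hx.2⟩⟩
  · rintro x ⟨hx, hx' | hx'⟩
    · rw [← hi]; exact ⟨hx, hx'⟩
    · have := h.left_mid ⟨s1 hx, hx'⟩
      rw [mem_singleton_iff] at this
      exact (haA₁ (this ▸ hx)).elim
  · rintro x ⟨hx, hx' | hx'⟩
    · have := h.left_right ⟨s2 hx', hx⟩
      rw [mem_singleton_iff] at this
      exact (hoA₂ (this ▸ hx')).elim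
    · exact h.right_mid ⟨hx, hx'⟩

/-- Local separation at `o` only depends on the germs of the curve at `o`. -/
lemma germ_locality (h : IsTri A ρ B o a b) (h' : IsTri A ρ' B o a b)
    (hs : Sides (A ∪ ρ ∪ B) U V) (hs' : Sides (A ∪ ρ' ∪ B) U' V') (hK : IsArc K o k)
    (hL : IsArc L o l) (hKU : GermIn o K U) (hLV : GermIn o L V) (hKU' : GermIn o K U') :
    ¬ GermIn o L U' := by
  intro hLU'
  have hF : IsClosed (ρ ∪ ρ') := h.mid.isClosed.union h'.mid.isClosed
  have ho : o ∈ (ρ ∪ ρ')ᶜ := fun hh => hh.elim h.notMem_mid h'.notMem_mid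
  obtain ⟨ε, hε, hball⟩ := Metric.mem_nhds_iff.1 (hF.isOpen_compl.mem_nhds ho)
  obtain ⟨N, hN, hNs⟩ := hKU'
  obtain ⟨M, hM, hMs⟩ := hLU'
  have hb := Metric.ball_mem_nhds o hε
  obtain ⟨x, hx, hxU, hxN, hxo⟩ := hKU.exists_mem hK (Filter.inter_mem hN hb)
  obtain ⟨y, hy, hyV, hyM, hyo⟩ := hLV.exists_mem hL (Filter.inter_mem hM hb)
  have hxU' : x ∈ U' := hNs ⟨⟨hx, hxN.1⟩, hxo⟩
  have hyU' : y ∈ U' := hMs ⟨⟨hy, hyM.1⟩, hyo⟩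
  have hex : ∀ z ∈ (ρ ∪ ρ')ᶜ, Complex.exp (logInc ρ z a b - logInc ρ' z a b) = 1 := by
    intro z hz
    have h1 : z ∉ ρ := fun hh => hz (Or.inl hh)
    have h2 : z ∉ ρ' := fun hh => hz (Or.inr hh)
    rw [Complex.exp_sub, exp_logInc h.mid.isPreconnected h.mid.logTrivial h1 h.mid.left_mem
      h.mid.right_mem, exp_logInc h'.mid.isPreconnected h'.mid.logTrivial h2 h'.mid.left_mem
      h'.mid.right_mem]
    refine div_self (div_ne_zero ?_ ?_) <;> rw [cdiff_ne_zero] <;> rintro rfl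
    · exact h1 h.mid.right_mem
    · exact h1 h.mid.left_mem
  have hcon : ContinuousOn (fun z => logInc ρ z a b - logInc ρ' z a b) (ρ ∪ ρ')ᶜ := by
    rw [compl_union]
    exact ((continuousOn_logInc h.mid.isPreconnected h.mid.logTrivial h.mid.isCompact
      h.mid.left_mem h.mid.right_mem).mono inter_subset_left).sub
      ((continuousOn_logInc h'.mid.isPreconnected h'.mid.logTrivial h'.mid.isCompact
      h'.mid.left_mem h'.mid.right_mem).mono inter_subset_right)
  have hg := exp_eq_one_const (convex_ball o ε).isPreconnected (hcon.mono hball)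
    (fun z hz => hex z (hball hz)) hxN.2 hyM.2
  have e1 := h'.jordan.wnum_eq hs' hxU' hyU'
  refine h.jordan.wnum_ne hs hxU hyV ?_
  rw [h.wnum_eq (disjoint_right.1 hs.disj_left hxU), h.wnum_eq (disjoint_right.1 hs.disj_right hyV)]
  rw [h'.wnum_eq (disjoint_right.1 hs'.disj_left hxU'),
    h'.wnum_eq (disjoint_right.1 hs'.disj_left hyU')] at e1
  linear_combination hg + e1

lemma separation_symm_aux {A ρ C B δ D : Set (ℝ × ℝ)} {o a c b d : ℝ × ℝ}
    (h : IsTri A ρ C o a c) (h' : IsTri B δ D o b d)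
    (iAB : A ∩ B ⊆ {o}) (iAD : A ∩ D ⊆ {o}) (iCB : C ∩ B ⊆ {o}) (iCD : C ∩ D ⊆ {o})
    (dρB : Disjoint ρ B) (dρD : Disjoint ρ D) (dδA : Disjoint δ A) (dδC : Disjoint δ C)
    (hs : Sides (A ∪ ρ ∪ C) U V) (hs' : Sides (B ∪ δ ∪ D) U' V') (hB : GermIn o B U)
    (hD : GermIn o D V) (hA : GermIn o A U') : ¬ GermIn o C U' := by
  intro hC
  have nb : b ≠ o := h'.left.ne.symm
  have nd : d ≠ o := h'.right.ne.symm
  have na : a ≠ o := h.left.ne.symm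
  have nc : c ≠ o := h.right.ne.symm
  have hb : b ∈ U := by
    refine hs.subset_of_germIn h'.left ?_ hB ⟨h'.left.right_mem, nb⟩
    rintro x ⟨hx, (hx' | hx') | hx'⟩
    exacts [iAB ⟨hx', hx⟩, (disjoint_left.1 dρB hx' hx).elim, iCB ⟨hx', hx⟩]
  have hd : d ∈ V := by
    refine hs.symm.subset_of_germIn h'.right ?_ hD ⟨h'.right.right_mem, nd⟩
    rintro x ⟨hx, (hx' | hx') | hx'⟩
    exacts [iAD ⟨hx', hx⟩, (disjoint_left.1 dρD hx' hx).elim, iCD ⟨hx', hx⟩]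
  have ha : a ∈ U' := by
    refine hs'.subset_of_germIn h.left ?_ hA ⟨h.left.right_mem, na⟩
    rintro x ⟨hx, (hx' | hx') | hx'⟩
    exacts [iAB ⟨hx, hx'⟩, (disjoint_left.1 dδA hx' hx).elim, iAD ⟨hx, hx'⟩]
  have hc : c ∈ U' := by
    refine hs'.subset_of_germIn h.right ?_ hC ⟨h.right.right_mem, nc⟩
    rintro x ⟨hx, (hx' | hx') | hx'⟩
    exacts [iCB ⟨hx, hx'⟩, (disjoint_left.1 dδC hx' hx).elim, iCD ⟨hx, hx'⟩]
  have e0 := h'.jordan.wnum_eq hs' ha hc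
  refine h.jordan.wnum_ne hs hb hd ?_
  rw [h.wnum_eq (disjoint_right.1 hs.disj_left hb), h.wnum_eq (disjoint_right.1 hs.disj_right hd)]
  rw [h'.wnum_eq (disjoint_right.1 hs'.disj_left ha),
    h'.wnum_eq (disjoint_right.1 hs'.disj_left hc)] at e0
  have pair : ∀ {A B : Set (ℝ × ℝ)} {a b z : ℝ × ℝ}, IsArc A o a → IsArc B o b → A ∩ B ⊆ {o} →
      z ∉ A → z ∉ B → IsArc (B ∪ A) b a ∧
        logInc (B ∪ A) z b a = logInc A z o a - logInc B z o b := by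
    intro A B a b z hA hB hi hzA hzB
    have hAB : IsArc (B ∪ A) b a := hB.symm.trans hA (by rw [inter_comm]; exact hi)
    have hz : z ∉ B ∪ A := fun hh => hh.elim hzB hzA
    refine ⟨hAB, ?_⟩
    rw [logInc_mono hAB.isPreconnected hAB.logTrivial hA.isPreconnected subset_union_right hz
      hA.left_mem hA.right_mem, logInc_mono hAB.isPreconnected hAB.logTrivial hB.isPreconnected
      subset_union_left hz hB.left_mem hB.right_mem, ← logInc_add _ z b o a,
      logInc_swap _ z o b]
    ring
  have caB : a ∉ B := fun hh => na (iAB ⟨h.left.right_mem, hh⟩)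
  have caD : a ∉ D := fun hh => na (iAD ⟨h.left.right_mem, hh⟩)
  have ccB : c ∉ B := fun hh => nc (iCB ⟨h.right.right_mem, hh⟩)
  have ccD : c ∉ D := fun hh => nc (iCD ⟨h.right.right_mem, hh⟩)
  have cbA : b ∉ A := fun hh => nb (iAB ⟨hh, h'.left.right_mem⟩)
  have cbC : b ∉ C := fun hh => nb (iCB ⟨hh, h'.left.right_mem⟩)
  have cdA : d ∉ A := fun hh => nd (iAD ⟨hh, h'.right.right_mem⟩)
  have cdC : d ∉ C := fun hh => nd (iCD ⟨hh, h'.right.right_mem⟩)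
  obtain ⟨hβ, βa⟩ := pair h'.left h'.right h'.left_right caB caD
  obtain ⟨-, βc⟩ := pair h'.left h'.right h'.left_right ccB ccD
  obtain ⟨hα, αb⟩ := pair h.left h.right h.left_right cbA cbC
  obtain ⟨-, αd⟩ := pair h.left h.right h.left_right cdA cdC
  have r1 := h.mid.logInc_double hβ (disjoint_union_right.2 ⟨dρD, dρB⟩)
  have r2 := h'.mid.logInc_double hα (disjoint_union_right.2 ⟨dδC, dδA⟩)
  rw [βa, βc] at r1
  rw [αb, αd] at r2
  linear_combination r1 + r2 - e0

/-- Local separation of germs at `o` is symmetric. -/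
lemma separation_symm {A ρ C B δ D : Set (ℝ × ℝ)} {o a c b d : ℝ × ℝ}
    (h : IsTri A ρ C o a c) (h' : IsTri B δ D o b d)
    (iAB : A ∩ B ⊆ {o}) (iAD : A ∩ D ⊆ {o}) (iCB : C ∩ B ⊆ {o}) (iCD : C ∩ D ⊆ {o})
    (hs : Sides (A ∪ ρ ∪ C) U V) (hs' : Sides (B ∪ δ ∪ D) U' V') (hB : GermIn o B U)
    (hD : GermIn o D V) (hA : GermIn o A U') : ¬ GermIn o C U' := by
  intro hC
  obtain ⟨a', A₁, A₂, hA₁, hA₂, uA, jA, dA⟩ := h.left.exists_initial h'.mid.isClosed h'.notMem_mid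
  obtain ⟨c', C₁, C₂, hC₁, hC₂, uC, jC, dC⟩ := h.right.exists_initial h'.mid.isClosed h'.notMem_mid
  obtain ⟨b', B₁, B₂, hB₁, hB₂, uB, jB, dB⟩ := h'.left.exists_initial h.mid.isClosed h.notMem_mid
  obtain ⟨d', D₁, D₂, hD₁, hD₂, uD, jD, dD⟩ := h'.right.exists_initial h.mid.isClosed h.notMem_mid
  have t := ((h.shorten hA₁ hA₂ uA jA).symm.shorten hC₁ hC₂ uC jC).symm
  have t' := ((h'.shorten hB₁ hB₂ uB jB).symm.shorten hD₁ hD₂ uD jD).symm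
  have rest : ∀ {X X₁ X₂ Y Y₁ : Set (ℝ × ℝ)} {x x' : ℝ × ℝ}, IsArc X₁ o x → IsArc X₂ x x' →
      X = X₁ ∪ X₂ → X₁ ∩ X₂ = {x} → X ∩ Y ⊆ {o} → Y₁ ⊆ Y → Disjoint X₂ Y₁ := by
    intro X X₁ X₂ Y Y₁ x x' h₁ h₂ hu hi hXY hY
    rw [disjoint_left]
    intro y hy1 hy2
    have := hXY ⟨hu ▸ Or.inr hy1, hY hy2⟩
    rw [mem_singleton_iff] at this
    subst this
    have : y ∈ X₁ ∩ X₂ := ⟨h₁.left_mem, hy1⟩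
    rw [hi] at this
    exact h₁.ne this
  have sA : A₁ ⊆ A := uA ▸ subset_union_left
  have sC : C₁ ⊆ C := uC ▸ subset_union_left
  have sB : B₁ ⊆ B := uB ▸ subset_union_left
  have sD : D₁ ⊆ D := uD ▸ subset_union_left
  have iBA : B ∩ A ⊆ {o} := by rw [inter_comm]; exact iAB
  have iDA : D ∩ A ⊆ {o} := by rw [inter_comm]; exact iAD
  have iBC : B ∩ C ⊆ {o} := by rw [inter_comm]; exact iCB
  have iDC : D ∩ C ⊆ {o} := by rw [inter_comm]; exact iCD
  have e1 : A₁ ∪ (C₂ ∪ (A₂ ∪ ρ)) ∪ C₁ = A ∪ ρ ∪ C := by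
    rw [uA, uC]; ext; simp only [mem_union]; tauto
  have e2 : B₁ ∪ (D₂ ∪ (B₂ ∪ δ)) ∪ D₁ = B ∪ δ ∪ D := by
    rw [uB, uD]; ext; simp only [mem_union]; tauto
  refine separation_symm_aux t t' (fun x hx => iAB ⟨sA hx.1, sB hx.2⟩)
    (fun x hx => iAD ⟨sA hx.1, sD hx.2⟩) (fun x hx => iCB ⟨sC hx.1, sB hx.2⟩)
    (fun x hx => iCD ⟨sC hx.1, sD hx.2⟩) ?_ ?_ ?_ ?_ (e1 ▸ hs) (e2 ▸ hs') (hB.restrict sB)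
    (hD.restrict sD) (hA.restrict sA) (hC.restrict sC)
  · exact disjoint_union_left.2 ⟨rest hC₁ hC₂ uC jC iCB sB,
      disjoint_union_left.2 ⟨rest hA₁ hA₂ uA jA iAB sB, dB.symm⟩⟩
  · exact disjoint_union_left.2 ⟨rest hC₁ hC₂ uC jC iCD sD,
      disjoint_union_left.2 ⟨rest hA₁ hA₂ uA jA iAD sD, dD.symm⟩⟩
  · exact disjoint_union_left.2 ⟨rest hD₁ hD₂ uD jD iDA sA,
      disjoint_union_left.2 ⟨rest hB₁ hB₂ uB jB iBA sA, dA.symm⟩⟩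
  · exact disjoint_union_left.2 ⟨rest hD₁ hD₂ uD jD iDC sC,
      disjoint_union_left.2 ⟨rest hB₁ hB₂ uB jB iBC sC, dC.symm⟩⟩

end IsTri

lemma Sides.component_eq {C U V : Set (ℝ × ℝ)} (h : Sides C U V) {p : ℝ × ℝ} (hp : p ∈ U) :
    connectedComponentIn Cᶜ p = U := by
  refine Subset.antisymm ?_ (h.conn_left.subset_connectedComponentIn hp
    (h.union_eq ▸ subset_union_left))
  have hpC : p ∈ Cᶜ := h.union_eq ▸ Or.inl hp
  exact h.subset_left_of_mem isPreconnected_connectedComponentIn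
    (disjoint_compl_left.mono_left (connectedComponentIn_subset _ _))
    (mem_connectedComponentIn hpC) hp

lemma IsTheta.symm {K₁ K₂ K₃ E O E₁ O₁ E₂ O₂ : Set (ℝ × ℝ)} {p q : ℝ × ℝ}
    (h : IsTheta K₁ K₂ K₃ E O E₁ O₁ E₂ O₂ p q) : IsTheta K₂ K₁ K₃ E O E₂ O₂ E₁ O₁ p q :=
  ⟨h.sides_right, h.sides_left, h.subset_right, h.subset_left, h.outer_right, h.outer_left,
    h.disj.symm, union_comm E₁ E₂ ▸ h.cover, h.inter_right, h.inter_left⟩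

namespace SimpleDrawing

variable {n : ℕ} {D : SimpleDrawing n} {vs a b c d : Fin n} {U V E O : Set (ℝ × ℝ)}

lemma isArc (D : SimpleDrawing n) (h : a ≠ b) : IsArc (D.arc a b) (D.vert a) (D.vert b) :=
  D.arc_simple a b h

lemma vert_notMem (D : SimpleDrawing n) (hab : a ≠ b) (ha : c ≠ a) (hb : c ≠ b) :
    D.vert c ∉ D.arc a b := fun h => (D.no_through_vertex a b c hab h).elim ha hb

lemma arc_inter_arc (D : SimpleDrawing n) (hab : a ≠ b) (hac : a ≠ c) (hbc : b ≠ c) :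
    D.arc a b ∩ D.arc a c ⊆ {D.vert a} := fun _ hx =>
  D.inter_subsingleton a b a c hab hac (by simp [hbc, hac]) hx
    ⟨(D.isArc hab).left_mem, (D.isArc hac).left_mem⟩

lemma triangle_comm (D : SimpleDrawing n) (a b c : Fin n) :
    D.triangle a b c = D.triangle a c b := by
  unfold triangle
  rw [D.arc_symm b c, union_right_comm, union_comm (D.arc a b), union_right_comm]

lemma isTri (D : SimpleDrawing n) (ha : vs ≠ a) (hc : vs ≠ c) (hac : a ≠ c) :
    IsTri (D.arc vs a) (D.arc a c) (D.arc vs c) (D.vert vs) (D.vert a) (D.vert c) where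
  left := D.isArc ha
  mid := D.isArc hac
  right := D.isArc hc
  left_mid := by
    rw [D.arc_symm vs a]
    exact D.arc_inter_arc ha.symm hac hc
  right_mid := by
    rw [D.arc_symm vs c, D.arc_symm a c]
    exact D.arc_inter_arc hc.symm hac.symm ha
  left_right := D.arc_inter_arc ha hc hac

lemma exists_sides (D : SimpleDrawing n) (ha : vs ≠ a) (hc : vs ≠ c) (hac : a ≠ c) :
    ∃ U V, Sides (D.triangle vs a c) U V := (D.isTri ha hc hac).exists_sides

lemma vert_notMem_triangle (D : SimpleDrawing n) (ha : vs ≠ a) (hc : vs ≠ c) (hac : a ≠ c)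
    (hb : b ≠ vs) (hba : b ≠ a) (hbc : b ≠ c) : D.vert b ∉ D.triangle vs a c := by
  rintro ((h | h) | h)
  exacts [D.vert_notMem ha hb hba h, D.vert_notMem hac hba hbc h, D.vert_notMem hc hb hbc h]

lemma star_inter_triangle (D : SimpleDrawing n) (ha : vs ≠ a) (hc : vs ≠ c) (hb : vs ≠ b)
    (hba : b ≠ a) (hbc : b ≠ c) :
    D.arc vs b ∩ D.triangle vs a c ⊆ insert (D.vert vs) (D.arc a c) := by
  rintro x ⟨hx, (h | h) | h⟩
  exacts [Or.inl (D.arc_inter_arc hb ha hba ⟨hx, h⟩), Or.inr h,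
    Or.inl (D.arc_inter_arc hb hc hbc ⟨hx, h⟩)]

lemma germ_or (ha : vs ≠ a) (hc : vs ≠ c) (hac : a ≠ c) (hb : vs ≠ b)
    (hba : b ≠ a) (hbc : b ≠ c) (hs : Sides (D.triangle vs a c) U V) :
    D.EmanatesInto vs b U ∨ D.EmanatesInto vs b V :=
  hs.germIn_or (D.isArc hb) (D.isArc hac).isClosed (D.isTri ha hc hac).notMem_mid
    (D.star_inter_triangle ha hc hb hba hbc)

lemma EmanatesInto.not_disjoint (h : D.EmanatesInto vs b U) (h' : D.EmanatesInto vs b V)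
    (hb : vs ≠ b) : ¬ Disjoint U V :=
  GermIn.not_disjoint h h' (D.isArc hb)

/-- A star edge missing the edge `ac` stays on the side into which it emanates. -/
lemma star_subset_of_disjoint (ha : vs ≠ a) (hc : vs ≠ c) (hb : vs ≠ b)
    (hba : b ≠ a) (hbc : b ≠ c) (hs : Sides (D.triangle vs a c) U V)
    (hd : Disjoint (D.arc vs b) (D.arc a c)) (he : D.EmanatesInto vs b U) :
    D.arc vs b \ {D.vert vs} ⊆ U := by
  refine hs.subset_of_germIn (D.isArc hb) ?_ he
  intro x hx
  exact (D.star_inter_triangle ha hc hb hba hbc hx).resolve_right (disjoint_left.1 hd hx.1)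

lemma vert_mem_of_disjoint (ha : vs ≠ a) (hc : vs ≠ c) (hb : vs ≠ b)
    (hba : b ≠ a) (hbc : b ≠ c) (hs : Sides (D.triangle vs a c) U V)
    (hd : Disjoint (D.arc vs b) (D.arc a c)) (he : D.EmanatesInto vs b U) : D.vert b ∈ U :=
  star_subset_of_disjoint ha hc hb hba hbc hs hd he
    ⟨(D.isArc hb).right_mem, fun h => hb (D.vert_inj h).symm⟩

/-- A star edge contained in a closed side emanates into that side. -/
lemma emanates_of_subset (ha : vs ≠ a) (hc : vs ≠ c) (hac : a ≠ c) (hb : vs ≠ b)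
    (hba : b ≠ a) (hbc : b ≠ c) (hs : Sides (D.triangle vs a c) U V)
    (h : D.arc vs b ⊆ closure U) : D.EmanatesInto vs b U := by
  refine (germ_or ha hc hac hb hba hbc hs).resolve_right fun hV => ?_
  obtain ⟨x, hx, hxV, -⟩ := GermIn.exists_mem hV (D.isArc hb) Filter.univ_mem
  exact disjoint_left.1 hs.closure_disj (h hx) hxV

/-- Every edge with both ends in the closed side `U` stays there. -/
def IsConvexRegion (D : SimpleDrawing n) (U : Set (ℝ × ℝ)) : Prop :=
  ∀ i j : Fin n, i ≠ j → D.vert i ∈ closure U → D.vert j ∈ closure U → D.arc i j ⊆ closure U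

lemma Convex.isConvexRegion_or (hD : D.Convex) (ha : vs ≠ a) (hc : vs ≠ c) (hac : a ≠ c)
    (hs : Sides (D.triangle vs a c) U V) : D.IsConvexRegion U ∨ D.IsConvexRegion V := by
  obtain ⟨S, ⟨p, hp, rfl⟩, hS⟩ := hD vs a c ha hac hc
  rcases hs.mem_cases p with h | h | h
  · rw [hs.component_eq h] at hS
    exact Or.inl hS
  · rw [hs.symm.component_eq h] at hS
    exact Or.inr hS
  · exact (hp h).elim

/-- The pair `a, c` locally separates `b` from `d` at the star vertex. -/
def Sep (D : SimpleDrawing n) (vs a c b d : Fin n) : Prop :=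
  ∃ U V, Sides (D.triangle vs a c) U V ∧ D.EmanatesInto vs b U ∧ D.EmanatesInto vs d V

lemma Sep.symm (h : D.Sep vs a c b d) : D.Sep vs a c d b :=
  let ⟨U, V, hs, hb, hd⟩ := h
  ⟨V, U, hs.symm, hd, hb⟩

lemma Sep.comm (h : D.Sep vs a c b d) : D.Sep vs c a b d :=
  let ⟨U, V, hs, hb, hd⟩ := h
  ⟨U, V, D.triangle_comm vs a c ▸ hs, hb, hd⟩

lemma Sep.emanates (h : D.Sep vs a c b d) (hvb : vs ≠ b) (hs : Sides (D.triangle vs a c) U V)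
    (hb : D.EmanatesInto vs b U) : D.EmanatesInto vs d V := by
  obtain ⟨U', V', hs', hb', hd'⟩ := h
  rcases hs.unique hs' with ⟨rfl, rfl⟩ | ⟨rfl, rfl⟩
  · exact hd'
  · exact (hb.not_disjoint hb' hvb hs.disj).elim

lemma Sep.dual (h : D.Sep vs a c b d) (ha : vs ≠ a) (hc : vs ≠ c) (hac : a ≠ c) (hb : vs ≠ b)
    (hd : vs ≠ d) (hbd : b ≠ d) (hab : a ≠ b) (had : a ≠ d) (hcb : c ≠ b) (hcd : c ≠ d) :
    D.Sep vs b d a c := by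
  obtain ⟨U, V, hs, hbU, hdV⟩ := h
  obtain ⟨U', V', hs'⟩ := D.exists_sides hb hd hbd
  have key : ∀ {U' V'}, Sides (D.triangle vs b d) U' V' → D.EmanatesInto vs a U' →
      D.Sep vs b d a c := by
    intro U' V' hs' haU
    refine ⟨U', V', hs', haU, (germ_or hb hd hbd hc hcb hcd hs').resolve_left ?_⟩
    exact (D.isTri ha hc hac).separation_symm (D.isTri hb hd hbd)
      (D.arc_inter_arc ha hb hab) (D.arc_inter_arc ha hd had) (D.arc_inter_arc hc hb hcb)
      (D.arc_inter_arc hc hd hcd) hs hs' hbU hdV haU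
  rcases germ_or hb hd hbd ha hab had hs' with h | h
  exacts [key hs' h, key hs'.symm h]

lemma SeparatesAt.sep (h : D.SeparatesAt vs a c b d) (ha : vs ≠ a) (hc : vs ≠ c) (hac : a ≠ c) :
    D.Sep vs a c b d := by
  obtain ⟨p, q, hp, hq, hpq, hb, hd⟩ := h
  have key : ∀ {U V}, Sides (D.triangle vs a c) U V → p ∈ U → D.Sep vs a c b d := by
    intro U V hs hpU
    rw [hs.component_eq hpU] at hpq hb
    have hqV : q ∈ V := by
      rcases hs.mem_cases q with h | h | h
      · exact (hpq (hs.component_eq h).symm).elim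
      · exact h
      · exact (hq h).elim
    rw [hs.symm.component_eq hqV] at hd
    exact ⟨U, V, hs, hb, hd⟩
  obtain ⟨U, V, hs⟩ := D.exists_sides ha hc hac
  rcases hs.mem_cases p with h | h | h
  exacts [key hs h, key hs.symm h, (hp h).elim]

lemma IsRotationLabeling.sep {lab : Fin (n - 1) → Fin n} (h : D.IsRotationLabeling vs lab)
    {i j k l : Fin (n - 1)} (ho : CyclicOrdered i j k l ∨ CyclicOrdered l k j i) :
    D.Sep vs (lab i) (lab k) (lab j) (lab l) := by
  obtain ⟨hinj, hrange, hsep⟩ := h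
  have hvs : ∀ i, vs ≠ lab i := fun i => by
    have : lab i ∈ {x | x ≠ vs} := hrange ▸ mem_range_self i
    exact this.symm
  have base : ∀ {i j k l : Fin (n - 1)}, i < j → j < k → k < l →
      D.Sep vs (lab i) (lab k) (lab j) (lab l) ∧ D.Sep vs (lab j) (lab l) (lab i) (lab k) := by
    intro i j k l hij hjk hkl
    have h1 := (hsep i j k l hij hjk hkl).sep (hvs i) (hvs k)
      (hinj.ne (hij.trans hjk).ne)
    refine ⟨h1, h1.dual (hvs _) (hvs _) ?_ (hvs _) (hvs _) ?_ ?_ ?_ ?_ ?_⟩ <;>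
      exact hinj.ne (by omega)
  rcases ho with (⟨h1, h2, h3⟩ | ⟨h1, h2, h3⟩ | ⟨h1, h2, h3⟩ | ⟨h1, h2, h3⟩) |
    (⟨h1, h2, h3⟩ | ⟨h1, h2, h3⟩ | ⟨h1, h2, h3⟩ | ⟨h1, h2, h3⟩)
  exacts [(base h1 h2 h3).1, (base h1 h2 h3).2.comm, (base h1 h2 h3).1.symm.comm,
    (base h1 h2 h3).2.symm, (base h1 h2 h3).2.symm.comm, (base h1 h2 h3).1.comm,
    (base h1 h2 h3).2, (base h1 h2 h3).1.symm]

/-- The star edge to `b` emanates into the side `E` of the triangle on `vs, a, c` and meets `ac`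
in `p`: it splits into `σ` and `τ`, the edge `ac` into `α` and `γ`, and `E` into `Ea` and `Ec`. -/
structure Cut (D : SimpleDrawing n) (vs a c b : Fin n) (E O : Set (ℝ × ℝ)) (p : ℝ × ℝ)
    (σ τ α γ Ea Oa Ec Oc : Set (ℝ × ℝ)) : Prop where
  sides : Sides (D.triangle vs a c) E O
  emanates : D.EmanatesInto vs b E
  arc_sigma : IsArc σ (D.vert vs) p
  arc_tau : IsArc τ p (D.vert b)
  arc_alpha : IsArc α (D.vert a) p
  arc_gamma : IsArc γ (D.vert c) p
  star_eq : D.arc vs b = σ ∪ τ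
  sigma_tau : σ ∩ τ = {p}
  mid_eq : D.arc a c = α ∪ γ
  alpha_gamma : α ∩ γ = {p}
  theta : IsTheta (D.arc vs a ∪ α) (D.arc vs c ∪ γ) σ E O Ea Oa Ec Oc (D.vert vs) p

lemma star_inter_mid_subsingleton (hb : vs ≠ b) (hac : a ≠ c) (ha : vs ≠ a) (hc : vs ≠ c) :
    (D.arc vs b ∩ D.arc a c).Subsingleton :=
  D.inter_subsingleton vs b a c hb hac (by simp [ha, hc])

lemma exists_cut (ha : vs ≠ a) (hc : vs ≠ c) (hac : a ≠ c) (hb : vs ≠ b)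
    (hba : b ≠ a) (hbc : b ≠ c) (hs : Sides (D.triangle vs a c) E O)
    (he : D.EmanatesInto vs b E) {p : ℝ × ℝ} (hp : p ∈ D.arc vs b) (hp' : p ∈ D.arc a c) :
    ∃ σ τ α γ Ea Oa Ec Oc, D.Cut vs a c b E O p σ τ α γ Ea Oa Ec Oc := by
  have pv : p ≠ D.vert vs := fun h => D.vert_notMem hac ha hc (h ▸ hp')
  have pb : p ≠ D.vert b := fun h => D.vert_notMem hac hba hbc (h ▸ hp')
  have pa : p ≠ D.vert a := fun h => D.vert_notMem hb ha.symm hba.symm (h ▸ hp)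
  have pc : p ≠ D.vert c := fun h => D.vert_notMem hb hc.symm hbc.symm (h ▸ hp)
  obtain ⟨σ, τ, hσ, hτ, e1, i1⟩ := (D.isArc hb).exists_split hp pv pb
  obtain ⟨α, γ, hα, hγ, e2, i2⟩ := (D.isArc hac).exists_split hp' pa pc
  have hT := D.isTri ha hc hac
  have hσb : σ ⊆ D.arc vs b := e1 ▸ subset_union_left
  have hαm : α ⊆ D.arc a c := e2 ▸ subset_union_left
  have hγm : γ ⊆ D.arc a c := e2 ▸ subset_union_right
  have hσm : ∀ x ∈ σ, x ∈ D.arc a c → x = p := fun x h h' =>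
    star_inter_mid_subsingleton hb hac ha hc ⟨hσb h, h'⟩ ⟨hp, hp'⟩
  have hLa : IsArc (D.arc vs a ∪ α) (D.vert vs) p :=
    (D.isArc ha).trans hα ((inter_subset_inter_right _ hαm).trans hT.left_mid)
  have hLc : IsArc (D.arc vs c ∪ γ) (D.vert vs) p :=
    (D.isArc hc).trans hγ.symm ((inter_subset_inter_right _ hγm).trans hT.right_mid)
  have pσa : p ∉ D.arc vs a := fun h => pv (D.arc_inter_arc hb ha hba ⟨hp, h⟩)
  have pσc : p ∉ D.arc vs c := fun h => pv (D.arc_inter_arc hb hc hbc ⟨hp, h⟩)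
  have J : IsJordanPair (D.arc vs a ∪ α) (D.arc vs c ∪ γ) (D.vert vs) p := by
    refine ⟨hLa, hLc, ?_⟩
    rintro x ⟨h1 | h1, h2 | h2⟩
    · exact Or.inl (hT.left_right ⟨h1, h2⟩)
    · have hx : x = D.vert a := hT.left_mid ⟨h1, hγm h2⟩
      have : x ∈ α ∩ γ := ⟨hx ▸ hα.left_mem, h2⟩
      rw [i2] at this
      exact (pa (this.symm.trans hx)).elim
    · have hx : x = D.vert c := hT.right_mid ⟨h2, hαm h1⟩
      have : x ∈ α ∩ γ := ⟨h1, hx ▸ hγ.right_mem⟩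
      rw [i2] at this
      exact (pc (this.symm.trans hx)).elim
    · have : x ∈ α ∩ γ := ⟨h1, h2⟩
      rw [i2] at this
      exact Or.inr this
  have J1 : IsJordanPair (D.arc vs a ∪ α) σ (D.vert vs) p := by
    refine ⟨hLa, hσ, ?_⟩
    rintro x ⟨h1 | h1, h2⟩
    · exact Or.inl (D.arc_inter_arc hb ha hba ⟨hσb h2, h1⟩)
    · exact Or.inr (hσm x h2 (hαm h1))
  have J2 : IsJordanPair (D.arc vs c ∪ γ) σ (D.vert vs) p := by
    refine ⟨hLc, hσ, ?_⟩
    rintro x ⟨h1 | h1, h2⟩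
    · exact Or.inl (D.arc_inter_arc hb hc hbc ⟨hσb h2, h1⟩)
    · exact Or.inr (hσm x h2 (hγm h1))
  have eT : D.triangle vs a c = (D.arc vs a ∪ α) ∪ (D.arc vs c ∪ γ) := by
    unfold triangle
    rw [e2]
    ext
    simp only [mem_union]
    tauto
  have hpre : IsPreconnected (σ \ {D.vert vs, p}) := hσ.isPreconnected_diff
  have hdis : Disjoint (σ \ {D.vert vs, p}) (D.triangle vs a c) := by
    rw [disjoint_left]
    rintro x ⟨hx, hx'⟩ hxT
    rcases D.star_inter_triangle ha hc hb hba hbc ⟨hσb hx, hxT⟩ with h | h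
    exacts [hx' (Or.inl h), hx' (Or.inr (hσm x hx h))]
  have hσE : σ \ {D.vert vs, p} ⊆ E := by
    obtain ⟨x, hx, hxE, hxN, hxo⟩ := (GermIn.restrict he hσb).exists_mem hσ
      (isOpen_compl_singleton.mem_nhds (show D.vert vs ∈ ({p}ᶜ : Set (ℝ × ℝ)) from pv.symm))
    exact hs.subset_left_of_mem hpre hdis (x := x) ⟨hx, fun h => h.elim hxo hxN⟩ hxE
  obtain ⟨Ea, Oa, Ec, Oc, hθ⟩ := exists_theta J J1 J2 (eT ▸ hs) hσE
  exact ⟨σ, τ, α, γ, Ea, Oa, Ec, Oc, hs, he, hσ, hτ, hα, hγ.symm, e1, i1, e2, i2, hθ⟩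

namespace Cut

variable {p : ℝ × ℝ} {σ τ α γ Ea Oa Ec Oc : Set (ℝ × ℝ)}

lemma symm (h : D.Cut vs a c b E O p σ τ α γ Ea Oa Ec Oc) :
    D.Cut vs c a b E O p σ τ γ α Ec Oc Ea Oa where
  sides := D.triangle_comm vs a c ▸ h.sides
  emanates := h.emanates
  arc_sigma := h.arc_sigma
  arc_tau := h.arc_tau
  arc_alpha := h.arc_gamma
  arc_gamma := h.arc_alpha
  star_eq := h.star_eq
  sigma_tau := h.sigma_tau
  mid_eq := by rw [D.arc_symm, h.mid_eq, union_comm]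
  alpha_gamma := by rw [inter_comm, h.alpha_gamma]
  theta := h.theta.symm

lemma mem_star (h : D.Cut vs a c b E O p σ τ α γ Ea Oa Ec Oc) : p ∈ D.arc vs b :=
  h.star_eq ▸ Or.inl h.arc_sigma.right_mem

lemma mem_mid (h : D.Cut vs a c b E O p σ τ α γ Ea Oa Ec Oc) : p ∈ D.arc a c :=
  h.mid_eq ▸ Or.inl h.arc_alpha.right_mem

lemma sigma_subset (h : D.Cut vs a c b E O p σ τ α γ Ea Oa Ec Oc) : σ ⊆ D.arc vs b :=
  h.star_eq ▸ subset_union_left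

lemma tau_subset (h : D.Cut vs a c b E O p σ τ α γ Ea Oa Ec Oc) : τ ⊆ D.arc vs b :=
  h.star_eq ▸ subset_union_right

lemma alpha_subset (h : D.Cut vs a c b E O p σ τ α γ Ea Oa Ec Oc) : α ⊆ D.arc a c :=
  h.mid_eq ▸ subset_union_left

lemma gamma_subset (h : D.Cut vs a c b E O p σ τ α γ Ea Oa Ec Oc) : γ ⊆ D.arc a c :=
  h.mid_eq ▸ subset_union_right

lemma closure_left_inter (h : D.Cut vs a c b E O p σ τ α γ Ea Oa Ec Oc)
    (hb : vs ≠ b) (hc : vs ≠ c) (hbc : b ≠ c) :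
    closure Ea ∩ D.arc vs c ⊆ {D.vert vs} := by
  rintro x ⟨hx, hx'⟩
  rcases h.theta.inter_left ⟨hx, Or.inl hx'⟩ with h1 | h1
  · exact h1
  · rw [mem_singleton_iff] at h1
    subst h1
    exact D.arc_inter_arc hb hc hbc ⟨h.mem_star, hx'⟩

lemma closure_right_inter (h : D.Cut vs a c b E O p σ τ α γ Ea Oa Ec Oc)
    (hb : vs ≠ b) (ha : vs ≠ a) (hba : b ≠ a) :
    closure Ec ∩ D.arc vs a ⊆ {D.vert vs} := h.symm.closure_left_inter hb ha hba

lemma notMem_sigma (h : D.Cut vs a c b E O p σ τ α γ Ea Oa Ec Oc) : D.vert b ∉ σ := fun hb => by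
  have : D.vert b ∈ σ ∩ τ := ⟨hb, h.arc_tau.right_mem⟩
  rw [h.sigma_tau] at this
  exact h.arc_tau.ne this.symm

/-- The far part of the star edge avoids the triangle and the near part. -/
lemma tau_disjoint (h : D.Cut vs a c b E O p σ τ α γ Ea Oa Ec Oc) (ha : vs ≠ a) (hc : vs ≠ c)
    (hac : a ≠ c) (hb : vs ≠ b) (hba : b ≠ a) (hbc : b ≠ c) :
    Disjoint (τ \ {p}) (D.triangle vs a c ∪ σ) := by
  rw [disjoint_left]
  rintro x ⟨hx, hxp⟩ (hxT | hxσ)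
  · rcases D.star_inter_triangle ha hc hb hba hbc ⟨h.tau_subset hx, hxT⟩ with h1 | h1
    · have : x ∈ σ ∩ τ := ⟨h1 ▸ h.arc_sigma.left_mem, hx⟩
      rw [h.sigma_tau] at this
      exact hxp this
    · exact hxp (star_inter_mid_subsingleton hb hac ha hc ⟨h.tau_subset hx, h1⟩
        ⟨h.mem_star, h.mem_mid⟩)
  · have : x ∈ σ ∩ τ := ⟨hxσ, hx⟩
    rw [h.sigma_tau] at this
    exact hxp this

lemma tau_subset_outer (h : D.Cut vs a c b E O p σ τ α γ Ea Oa Ec Oc) (ha : vs ≠ a) (hc : vs ≠ c)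
    (hac : a ≠ c) (hb : vs ≠ b) (hba : b ≠ a) (hbc : b ≠ c) (hO : D.vert b ∈ O) :
    τ \ {p} ⊆ O :=
  h.sides.symm.subset_left_of_mem h.arc_tau.isPreconnected_diff_left
    ((h.tau_disjoint ha hc hac hb hba hbc).mono_right subset_union_left)
    ⟨h.arc_tau.right_mem, h.arc_tau.ne.symm⟩ hO

/-- A star edge separated from `a` by `b` and `c` emanates into the part of `E` at `c`. -/
lemma emanates_right (h : D.Cut vs a c b E O p σ τ α γ Ea Oa Ec Oc) (ha : vs ≠ a) (hc : vs ≠ c)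
    (hac : a ≠ c) (hb : vs ≠ b) (hba : b ≠ a) (hbc : b ≠ c) (hd : vs ≠ d) (hdb : d ≠ b)
    (hdc : d ≠ c) (hsep : D.Sep vs b c d a) : D.EmanatesInto vs d Ec := by
  obtain ⟨U, V, hs, hdU, haV⟩ := hsep
  have hT : IsTri σ (τ ∪ D.arc b c) (D.arc vs c) (D.vert vs) p (D.vert c) :=
    (D.isTri hb hc hbc).shorten h.arc_sigma h.arc_tau h.star_eq h.sigma_tau
  have hTs : Sides (σ ∪ (τ ∪ D.arc b c) ∪ D.arc vs c) U V := by
    have : σ ∪ (τ ∪ D.arc b c) ∪ D.arc vs c = D.triangle vs b c := by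
      simp only [triangle, h.star_eq, union_assoc]
    rwa [this]
  have hC : IsTri σ γ (D.arc vs c) (D.vert vs) p (D.vert c) := by
    refine ⟨h.arc_sigma, h.arc_gamma.symm, D.isArc hc, fun x hx => ?_,
      (inter_subset_inter_right _ h.gamma_subset).trans (D.isTri ha hc hac).right_mid,
      (inter_subset_inter_left _ h.sigma_subset).trans (D.arc_inter_arc hb hc hbc)⟩
    exact star_inter_mid_subsingleton hb hac ha hc
      ⟨h.sigma_subset hx.1, h.gamma_subset hx.2⟩ ⟨h.mem_star, h.mem_mid⟩
  have hCs : Sides (σ ∪ γ ∪ D.arc vs c) Ec Oc := by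
    have : σ ∪ γ ∪ D.arc vs c = D.arc vs c ∪ γ ∪ σ := by
      ext
      simp only [mem_union]
      tauto
    rw [this]
    exact h.theta.sides_right
  have haO : D.EmanatesInto vs a Oc := by
    refine GermIn.of_subset fun x hx => ?_
    have hx' : x ∉ closure Ec := fun hh => hx.2 (h.closure_right_inter hb ha hba ⟨hh, hx.1⟩)
    rw [hCs.mem_closure_iff_notMem, not_not] at hx'
    exact hx'
  have hdor : D.EmanatesInto vs d Ec ∨ D.EmanatesInto vs d Oc := by
    refine hCs.germIn_or (D.isArc hd) (F := D.arc a c) (D.isArc hac).isClosed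
      (D.isTri ha hc hac).notMem_mid ?_
    rintro x ⟨hx, (h1 | h1) | h1⟩
    exacts [Or.inl (D.arc_inter_arc hd hb hdb ⟨hx, h.sigma_subset h1⟩), Or.inr (h.gamma_subset h1),
      Or.inl (D.arc_inter_arc hd hc hdc ⟨hx, h1⟩)]
  refine hdor.resolve_right fun hdO => ?_
  exact hT.germ_locality hC hTs hCs.symm (D.isArc hd) (D.isArc ha) hdU haV hdO haO

end Cut
lemma Cut.edge_subset {p : ℝ × ℝ} {σ τ α γ Ea Oa Ec Oc : Set (ℝ × ℝ)}
    (h : D.Cut vs a c b E O p σ τ α γ Ea Oa Ec Oc) (ha : vs ≠ a) (hc : vs ≠ c)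
    (hac : a ≠ c) (hb : vs ≠ b) (hba : b ≠ a) (hbc : b ≠ c) (hO : D.vert b ∈ O) :
    D.arc a b ⊆ closure O := by
  rw [h.sides.symm.subset_closure_iff, disjoint_left]
  intro x hx hxE
  have hab := D.isArc hba.symm
  have e1 : ∀ y ∈ D.arc a b, y ∈ D.triangle vs a c → y = D.vert a ∨ y ∈ D.arc vs c := by
    rintro y hy ((h1 | h1) | h1)
    · rw [D.arc_symm] at h1
      exact Or.inl (D.arc_inter_arc ha.symm hba.symm hb ⟨h1, hy⟩)
    · exact Or.inl (D.arc_inter_arc hba.symm hac hbc ⟨hy, h1⟩)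
    · exact Or.inr h1
  have hvab : D.vert vs ∉ D.arc a b := D.vert_notMem hba.symm ha hb
  have hbE : D.vert b ∉ E := disjoint_right.1 h.sides.disj hO
  have xT : x ∉ D.triangle vs a c := fun hh => disjoint_left.1 h.sides.disj_left hh hxE
  have xa : x ≠ D.vert a := fun hh => xT (hh ▸ Or.inl (Or.inl (D.isArc ha).right_mem))
  by_cases hq : ∃ q, q ∈ D.arc a b ∧ q ∈ D.arc vs c
  · obtain ⟨q, hq, hqc⟩ := hq
    have huniq : ∀ y ∈ D.arc a b, y ∈ D.arc vs c → y = q := fun y hy hy' =>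
      D.inter_subsingleton a b vs c hba.symm hc (by simp [ha.symm, hac]) ⟨hy, hy'⟩ ⟨hq, hqc⟩
    have qa : q ≠ D.vert a := fun hh => D.vert_notMem hc ha.symm hac (hh ▸ hqc)
    have qb : q ≠ D.vert b := fun hh => D.vert_notMem hc hb.symm hbc (hh ▸ hqc)
    obtain ⟨P, Q, hP, hQ, e, i⟩ := hab.exists_split hq qa qb
    have hPs : P ⊆ D.arc a b := e ▸ subset_union_left
    have hQs : Q ⊆ D.arc a b := e ▸ subset_union_right
    have hQO : Q \ {q} ⊆ O := by
      refine h.sides.symm.subset_left_of_mem hQ.isPreconnected_diff_left ?_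
        ⟨hQ.right_mem, qb.symm⟩ hO
      rw [disjoint_left]
      rintro y ⟨hy, hyq⟩ hyT
      rcases e1 y (hQs hy) hyT with rfl | h1
      · have : D.vert a ∈ P ∩ Q := ⟨hP.left_mem, hy⟩
        rw [i] at this
        exact hyq this
      · exact hyq (huniq y (hQs hy) h1)
    have xq : x ≠ q := fun hh => xT (hh ▸ Or.inr hqc)
    have hxP : x ∈ P := by
      rw [e] at hx
      exact hx.resolve_right fun hh => disjoint_left.1 h.sides.disj hxE (hQO ⟨hh, xq⟩)
    have hPd : Disjoint (P \ {D.vert a, q}) (D.triangle vs a c ∪ σ) := by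
      rw [disjoint_left]
      rintro y ⟨hy, hyn⟩ (hyT | hyσ)
      · rcases e1 y (hPs hy) hyT with h1 | h1
        · exact hyn (Or.inl h1)
        · exact hyn (Or.inr (huniq y (hPs hy) h1))
      · have hyb : y = D.vert b := by
          have h2 := hPs hy
          have h3 := h.sigma_subset hyσ
          rw [D.arc_symm] at h2 h3
          exact D.arc_inter_arc hba hb.symm ha.symm ⟨h2, h3⟩
        exact h.notMem_sigma (hyb ▸ hyσ)
    have sub1 : D.arc vs a ∪ α ∪ σ ⊆ D.triangle vs a c ∪ σ :=
      union_subset_union_left _ (union_subset (fun y hy => Or.inl (Or.inl hy))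
        fun y hy => Or.inl (Or.inr (h.alpha_subset hy)))
    have sub2 : D.arc vs c ∪ γ ∪ σ ⊆ D.triangle vs a c ∪ σ :=
      union_subset_union_left _ (union_subset (fun y hy => Or.inr hy)
        fun y hy => Or.inl (Or.inr (h.gamma_subset hy)))
    have hxP' : x ∈ P \ {D.vert a, q} := ⟨hxP, fun hh => hh.elim xa xq⟩
    have hxσ : x ∉ σ := fun hh => disjoint_left.1 hPd hxP' (Or.inr hh)
    rcases h.theta.cover hxE with (h1 | h1) | h1
    · have := h.theta.sides_left.subset_left_of_mem hP.isPreconnected_diff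
        (hPd.mono_right sub1) hxP' h1
      have hqE : q ∈ closure Ea := closure_mono this (hP.subset_closure_diff hP.right_mem)
      exact hvab (h.closure_left_inter hb hc hbc ⟨hqE, hqc⟩ ▸ hq)
    · have := h.theta.sides_right.subset_left_of_mem hP.isPreconnected_diff
        (hPd.mono_right sub2) hxP' h1
      have hqE : D.vert a ∈ closure Ec := closure_mono this (hP.subset_closure_diff hP.left_mem)
      exact ha (D.vert_inj (h.closure_right_inter hb ha hba ⟨hqE, (D.isArc ha).right_mem⟩)).symm
    · exact hxσ h1
  · have := h.sides.symm.subset_left_of_mem hab.isPreconnected_diff_left (x := D.vert b) ?_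
      ⟨hab.right_mem, hab.ne.symm⟩ hO ⟨hx, xa⟩
    · exact disjoint_left.1 h.sides.disj hxE this
    · rw [disjoint_left]
      rintro y ⟨hy, hya⟩ hyT
      rcases e1 y hy hyT with h1 | h1
      exacts [hya h1, hq ⟨y, hy, h1⟩]

/-- The star edge to `b` emanates into one side of the triangle on `vs, a, c`, and `b` lies in the
other side. -/
def Pierces (D : SimpleDrawing n) (vs a c b : Fin n) : Prop :=
  ∃ E O, Sides (D.triangle vs a c) E O ∧ D.EmanatesInto vs b E ∧ D.vert b ∈ O

lemma Pierces.symm (h : D.Pierces vs a c b) : D.Pierces vs c a b :=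
  let ⟨E, O, hs, he, hO⟩ := h
  ⟨E, O, D.triangle_comm vs a c ▸ hs, he, hO⟩

lemma mem_of_not_pierces (hs : Sides (D.triangle vs a c) U V) (ha : vs ≠ a) (hc : vs ≠ c)
    (hac : a ≠ c) (hb : vs ≠ b) (hba : b ≠ a) (hbc : b ≠ c) (he : D.EmanatesInto vs b U)
    (h : ¬ D.Pierces vs a c b) : D.vert b ∈ U := by
  rcases hs.mem_cases (D.vert b) with h1 | h1 | h1
  · exact h1
  · exact (h ⟨U, V, hs, he, h1⟩).elim
  · exact (D.vert_notMem_triangle ha hc hac hb.symm hba hbc h1).elim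

lemma not_pierces_of_disjoint (ha : vs ≠ a) (hc : vs ≠ c) (hb : vs ≠ b)
    (hba : b ≠ a) (hbc : b ≠ c) (hd : Disjoint (D.arc vs b) (D.arc a c)) :
    ¬ D.Pierces vs a c b := by
  rintro ⟨E, O, hs, he, hO⟩
  exact disjoint_left.1 hs.disj (vert_mem_of_disjoint ha hc hb hba hbc hs hd he) hO

lemma Pierces.exists_cut (h : D.Pierces vs a c b) (ha : vs ≠ a) (hc : vs ≠ c) (hac : a ≠ c)
    (hb : vs ≠ b) (hba : b ≠ a) (hbc : b ≠ c) : ∃ E O p σ τ α γ Ea Oa Ec Oc,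
      D.Cut vs a c b E O p σ τ α γ Ea Oa Ec Oc ∧ D.vert b ∈ O := by
  obtain ⟨E, O, hs, he, hO⟩ := h
  have hd : ¬ Disjoint (D.arc vs b) (D.arc a c) := fun hd =>
    not_pierces_of_disjoint ha hc hb hba hbc hd ⟨E, O, hs, he, hO⟩
  rw [not_disjoint_iff] at hd
  obtain ⟨p, hp, hp'⟩ := hd
  obtain ⟨σ, τ, α, γ, Ea, Oa, Ec, Oc, hc⟩ :=
    SimpleDrawing.exists_cut ha hc hac hb hba hbc hs he hp hp'
  exact ⟨E, O, p, σ, τ, α, γ, Ea, Oa, Ec, Oc, hc, hO⟩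

/-- If the star edge to `b` pierces the triangle on `vs, a, c`, then the star edge to `c` stays in
a non-convex closed side of the triangle on `vs, a, b`. -/
lemma Pierces.exists_sides (h : D.Pierces vs a c b) (ha : vs ≠ a) (hc : vs ≠ c) (hac : a ≠ c)
    (hb : vs ≠ b) (hba : b ≠ a) (hbc : b ≠ c) : ∃ X X', Sides (D.triangle vs a b) X X' ∧
      D.EmanatesInto vs c X ∧ D.vert c ∈ X ∧ D.arc vs c ⊆ closure X ∧ ¬ D.IsConvexRegion X := by
  obtain ⟨E, O, p, σ, τ, α, γ, Ea, Oa, Ec, Oc, hcut, hO⟩ := h.exists_cut ha hc hac hb hba hbc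
  have hs := hcut.sides
  have hd : Disjoint Ec (D.triangle vs a b) := by
    rw [disjoint_left]
    intro x hxc hx
    have hxE := hcut.theta.subset_right hxc
    rcases hx with (hx | hx) | hx
    · exact disjoint_left.1 hs.disj_left (Or.inl (Or.inl hx)) hxE
    · exact disjoint_left.1 (hs.symm.subset_closure_iff.1
        (hcut.edge_subset ha hc hac hb hba hbc hO)) hx hxE
    · rw [hcut.star_eq] at hx
      have hσ : x ∉ σ := fun hh => disjoint_left.1 hcut.theta.sides_right.disj_left (Or.inr hh) hxc
      have hxτ := hx.resolve_left hσ
      refine disjoint_left.1 hs.disj hxE (hcut.tau_subset_outer ha hc hac hb hba hbc hO ⟨hxτ, ?_⟩)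
      rintro rfl
      exact hσ hcut.arc_sigma.right_mem
  have key : ∀ {X X'}, Sides (D.triangle vs a b) X X' → Ec ⊆ X →
      D.EmanatesInto vs c X ∧ D.vert c ∈ X ∧ D.arc vs c ⊆ closure X ∧ ¬ D.IsConvexRegion X := by
    intro X X' hX hsub
    have h1 : D.arc vs c ⊆ closure X := fun y hy =>
      closure_mono hsub (hcut.theta.sides_right.subset_left (Or.inl (Or.inl hy)))
    have h2 := h1 (D.isArc hc).right_mem
    refine ⟨emanates_of_subset ha hb hba.symm hc hac.symm hbc.symm hX h1, ?_, h1, ?_⟩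
    · rw [hX.closure_eq] at h2
      exact h2.resolve_right (D.vert_notMem_triangle ha hb hba.symm hc.symm hac.symm hbc.symm)
    · intro hconv
      have h3 : D.arc a c ⊆ closure X :=
        hconv a c hac (hX.subset_left (Or.inl (Or.inl (D.isArc ha).right_mem))) h2
      obtain ⟨y, hy, hyE, -⟩ := GermIn.exists_mem hcut.emanates (D.isArc hb) Filter.univ_mem
      obtain ⟨x, hx, hxX⟩ := hs.exists_mem_of_meets hX.symm (Or.inr hy) hyE
        (Or.inr (D.isArc hb).right_mem) hO
      refine disjoint_left.1 hX.closure_disj ?_ hxX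
      rcases hx with (hx | hx) | hx
      exacts [hX.subset_left (Or.inl (Or.inl hx)), h3 hx, h1 hx]
  obtain ⟨X, X', hX⟩ := D.exists_sides ha hb hba.symm
  rcases hX.subset_or hcut.theta.sides_right.conn_left hd with h1 | h1
  exacts [⟨X, X', hX, key hX h1⟩, ⟨X', X, hX.symm, key hX.symm h1⟩]

/-- A pierced triangle has both sides met by the piercing star edge. -/
lemma Pierces.meets (h : D.Pierces vs a c b) (hb : vs ≠ b)
    (hs : Sides (D.triangle vs a c) U V) : (∃ x ∈ D.arc vs b, x ∈ U) ∧ ∃ x ∈ D.arc vs b, x ∈ V := by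
  obtain ⟨E, O, hs', he, hO⟩ := h
  obtain ⟨y, hy, hyE, -⟩ := GermIn.exists_mem he (D.isArc hb) Filter.univ_mem
  rcases hs.unique hs' with ⟨rfl, rfl⟩ | ⟨rfl, rfl⟩
  exacts [⟨⟨y, hy, hyE⟩, _, (D.isArc hb).right_mem, hO⟩,
    ⟨⟨_, (D.isArc hb).right_mem, hO⟩, y, hy, hyE⟩]

lemma triangle_subset (ha : vs ≠ a) (hc : vs ≠ c) (hac : a ≠ c) (hU : D.IsConvexRegion U)
    (h1 : D.arc vs a ⊆ closure U) (h2 : D.arc vs c ⊆ closure U) :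
    D.triangle vs a c ⊆ closure U :=
  union_subset (union_subset h1 (hU a c hac (h1 (D.isArc ha).right_mem)
    (h2 (D.isArc hc).right_mem))) h2

lemma Pierces.not_pierces_across (hD : D.Convex) {u w s x z y : Fin n}
    (hp : D.Pierces vs s x w) (hz : D.Pierces vs u y z)
    (vu : vs ≠ u) (vw : vs ≠ w) (vs' : vs ≠ s) (vx : vs ≠ x) (vz : vs ≠ z) (vy : vs ≠ y)
    (uw : u ≠ w) (us : u ≠ s) (ux : u ≠ x) (uz : u ≠ z) (uy : u ≠ y) (ws : w ≠ s) (wx : w ≠ x)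
    (wz : w ≠ z) (wy : w ≠ y) (sx : s ≠ x) (sz : s ≠ z) (sy : s ≠ y) (xy : x ≠ y) (zy : z ≠ y)
    (du : Disjoint (D.arc vs u) (D.arc s x)) (dy : Disjoint (D.arc vs y) (D.arc s x))
    (dz : z ≠ x → Disjoint (D.arc vs z) (D.arc s x))
    (su : D.Sep vs w x u s) (sy' : D.Sep vs w x y s) (sz' : z ≠ x → D.Sep vs w x z s)
    (su' : z ≠ x → D.Sep vs z w s u) (sw : z ≠ x → D.Sep vs u z y w) : False := by
  obtain ⟨A, B, p, σ, τ, α, γ, Ea, Oa, Ec, Oc, hcut, hB⟩ :=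
    hp.exists_cut vs' vx sx vw ws wx
  obtain ⟨N, G, hNG, sN, -, starsN, nconvN⟩ :=
    hp.symm.exists_sides vx vs' sx.symm vw wx ws
  have convG : D.IsConvexRegion G :=
    (hD.isConvexRegion_or vx vw wx.symm hNG).resolve_left nconvN
  have hxw : D.arc x w ⊆ closure B := hcut.symm.edge_subset vx vs' sx.symm vw wx ws hB
  have inG : ∀ d, vs ≠ d → d ≠ w → d ≠ s → d ≠ x → Disjoint (D.arc vs d) (D.arc s x) →
      D.Sep vs w x d s → D.arc vs d ⊆ closure G := by
    intro d vd dw ds dx hd hsep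
    have h1 : D.EmanatesInto vs d A := GermIn.mono
      (hcut.emanates_right vs' vx sx vw ws wx vd dw dx hsep) hcut.theta.subset_right
    have h2 := star_subset_of_disjoint vs' vx vd ds dx hcut.sides hd h1
    have h3 : Disjoint (D.arc vs d) (D.arc x w) := by
      rw [disjoint_left]
      intro q hq hq'
      refine disjoint_left.1 hcut.sides.symm.closure_disj (hxw hq') (h2 ⟨hq, fun h => ?_⟩)
      exact D.vert_notMem wx.symm vx vw (h ▸ hq')
    have h4 := hsep.symm.comm.emanates vs' hNG sN
    intro q hq
    by_cases hqv : q = D.vert vs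
    · exact hqv ▸ hNG.subset_right (Or.inl (Or.inl (D.isArc vx).left_mem))
    · exact subset_closure (star_subset_of_disjoint vx vw vd dx dw hNG.symm h3 h4 ⟨hq, hqv⟩)
  have uG := inG u vu uw us ux du su
  have yG := inG y vy wy.symm sy.symm xy.symm dy sy'
  have TuyG := triangle_subset vu vy uy convG uG yG
  obtain ⟨P, Q, hPQ⟩ := D.exists_sides vu vy uy
  obtain ⟨⟨z₁, hz₁, hz₁P⟩, z₂, hz₂, hz₂Q⟩ := hz.meets vz hPQ
  by_cases zx : z = x
  · subst zx
    obtain ⟨q, hq, hqN⟩ := hPQ.exists_mem_of_meets hNG (Or.inl (Or.inl hz₁)) hz₁P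
      (Or.inl (Or.inl hz₂)) hz₂Q
    exact disjoint_left.1 hNG.symm.closure_disj (TuyG hq) hqN
  have zG := inG z vz wz.symm sz.symm zx (dz zx) (sz' zx)
  have wG : D.arc vs w ⊆ closure G := fun q hq => hNG.subset_right (Or.inr hq)
  have TuzG := triangle_subset vu vz uz convG uG zG
  have TzwG := triangle_subset vz vw wz.symm convG zG wG
  obtain ⟨M', M, hM, yM', -, staryM', nconvM'⟩ := hz.exists_sides vu vy uy vz uz.symm zy
  have convM : D.IsConvexRegion M :=
    (hD.isConvexRegion_or vu vz uz hM).resolve_left nconvM'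
  have wM := (sw zx).emanates vy hM yM'
  have starwM : D.arc vs w ⊆ closure M := by
    have hwN : D.arc vs w ⊆ closure N := fun q hq => hNG.subset_left (Or.inr hq)
    rcases hM.closure_subset_or hNG.conn_left (hNG.symm.subset_closure_iff.1 TuzG).symm with h | h
    · exact (wM.not_disjoint (emanates_of_subset vu vz uz vw uw.symm wz hM (hwN.trans h)) vw
        hM.symm.disj).elim
    · exact hwN.trans h
  have starzM : D.arc vs z ⊆ closure M := fun q hq => hM.subset_right (Or.inr hq)
  have TzwM := triangle_subset vz vw wz.symm convM starzM starwM
  have key : ∀ {top bot}, Sides (D.triangle vs z w) top bot → N ⊆ top → False := by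
    intro top bot hs hN
    have starsT : D.arc vs s ⊆ closure top := starsN.trans (closure_mono hN)
    have starxT : D.arc vs x ⊆ closure top := fun q hq =>
      closure_mono hN (hNG.subset_left (Or.inl (Or.inl hq)))
    have sT := emanates_of_subset vz vw wz.symm vs' sz ws.symm hs starsT
    have uB := (su' zx).emanates vs' hs sT
    have convB : D.IsConvexRegion bot := by
      refine (hD.isConvexRegion_or vz vw wz.symm hs).resolve_left fun hc => ?_
      have h1 := triangle_subset vs' vx sx hc starsT starxT
      obtain ⟨⟨w₁, hw₁, hw₁A⟩, w₂, hw₂, hw₂B⟩ := hp.meets vw hcut.sides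
      obtain ⟨q, hq, hqb⟩ := hcut.sides.exists_mem_of_meets hs.symm (Or.inr hw₁) hw₁A
        (Or.inr hw₂) hw₂B
      exact disjoint_left.1 hs.closure_disj (h1 hq) hqb
    have hM'B : closure M' ⊆ closure bot := by
      refine (hs.closure_subset_or hM.conn_left
        (hM.symm.subset_closure_iff.1 TzwM).symm).resolve_left fun h => ?_
      have h1 : D.arc vs u ⊆ closure top := fun q hq => h (hM.subset_left (Or.inl (Or.inl hq)))
      exact (emanates_of_subset vz vw wz.symm vu uz uw hs h1).not_disjoint uB vu hs.disj
    have h2 := triangle_subset vu vy uy convB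
      (fun q hq => hM'B (hM.subset_left (Or.inl (Or.inl hq)))) (staryM'.trans hM'B)
    obtain ⟨q, hq, hqt⟩ := hPQ.exists_mem_of_meets hs (Or.inl (Or.inl hz₁)) hz₁P
      (Or.inl (Or.inl hz₂)) hz₂Q
    exact disjoint_left.1 hs.symm.closure_disj (h2 hq) hqt
  obtain ⟨top, bot, hs⟩ := D.exists_sides vz vw wz.symm
  rcases hs.subset_or hNG.conn_left (hNG.symm.subset_closure_iff.1 TzwG).symm with h | h
  exacts [key hs h, key hs.symm h]

end SimpleDrawing

lemma IsArc.left_mem_closure {K S : Set (ℝ × ℝ)} {x y : ℝ × ℝ} (h : IsArc K x y)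
    (hs : K \ {x} ⊆ S) : x ∈ closure S := by
  have h1 : K \ {x, y} ⊆ S := fun z hz => hs ⟨hz.1, fun hx => hz.2 (Or.inl hx)⟩
  exact closure_mono h1 (h.subset_closure_diff h.left_mem)

namespace SimpleDrawing

variable {n : ℕ} {D : SimpleDrawing n} {vs a b c d q : Fin n} {U V E O : Set (ℝ × ℝ)}
  {p : ℝ × ℝ} {σ τ α γ Ea Oa Ec Oc : Set (ℝ × ℝ)}

namespace Cut

lemma notMem_alpha (h : D.Cut vs a c b E O p σ τ α γ Ea Oa Ec Oc) : D.vert c ∉ α := fun hc => by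
  have : D.vert c ∈ α ∩ γ := ⟨hc, h.arc_gamma.left_mem⟩
  rw [h.alpha_gamma] at this
  exact h.arc_gamma.ne this

lemma boundary_left (h : D.Cut vs a c b E O p σ τ α γ Ea Oa Ec Oc) :
    D.arc vs a ∪ α ∪ σ ⊆ D.triangle vs a c ∪ σ :=
  union_subset_union_left _ (union_subset (fun _ hy => Or.inl (Or.inl hy))
    fun _ hy => Or.inl (Or.inr (h.alpha_subset hy)))

lemma boundary_right (h : D.Cut vs a c b E O p σ τ α γ Ea Oa Ec Oc) :
    D.arc vs c ∪ γ ∪ σ ⊆ D.triangle vs a c ∪ σ :=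
  union_subset_union_left _ (union_subset (fun _ hy => Or.inr hy)
    fun _ hy => Or.inl (Or.inr (h.gamma_subset hy)))

lemma sigma_inter_edge (h : D.Cut vs a c b E O p σ τ α γ Ea Oa Ec Oc) (hb : vs ≠ b)
    (hbd : b ≠ d) (hd : vs ≠ d) : Disjoint (D.arc b d) σ := by
  rw [disjoint_left]
  intro x hx hxσ
  have h1 := h.sigma_subset hxσ
  rw [D.arc_symm] at h1
  have : x = D.vert b := D.arc_inter_arc hbd hb.symm hd.symm ⟨hx, h1⟩
  exact h.notMem_sigma (this ▸ hxσ)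

lemma not_disjoint_star (h : D.Cut vs a c b E O p σ τ α γ Ea Oa Ec Oc)
    (hc : vs ≠ c) (hac : a ≠ c) (hb : vs ≠ b) (hba : b ≠ a) (hbc : b ≠ c)
    (hbE : D.vert b ∈ Ea) : ¬ Disjoint (D.arc b c) (D.arc vs a) := by
  intro hd
  have h1 : D.arc b c ⊆ Ea := by
    refine h.theta.sides_left.subset_left_of_mem (D.isArc hbc).isPreconnected ?_
      (D.isArc hbc).left_mem hbE
    refine disjoint_union_right.2 ⟨disjoint_union_right.2 ⟨hd, ?_⟩, h.sigma_inter_edge hb hbc hc⟩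
    rw [disjoint_left]
    intro x hx hxα
    have h2 := h.alpha_subset hxα
    rw [D.arc_symm] at h2 hx
    have : x = D.vert c := D.arc_inter_arc hbc.symm hac.symm hba ⟨hx, h2⟩
    exact h.notMem_alpha (this ▸ hxα)
  exact hc (D.vert_inj (h.closure_left_inter hb hc hbc
    ⟨subset_closure (h1 (D.isArc hbc).right_mem), (D.isArc hc).right_mem⟩)).symm

lemma vert_mem_right (h : D.Cut vs a c b E O p σ τ α γ Ea Oa Ec Oc) (ha : vs ≠ a)
    (hc : vs ≠ c) (hac : a ≠ c) (hb : vs ≠ b) (hba : b ≠ a) (hbc : b ≠ c) (hq : vs ≠ q)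
    (hqa : q ≠ a) (hqc : q ≠ c) (hqb : q ≠ b) (hsep : D.Sep vs b c q a)
    (hnp : ¬ D.Pierces vs a c q) : D.vert q ∈ Ec := by
  have hg := h.emanates_right ha hc hac hb hba hbc hq hqb hqc hsep
  have hqE : D.vert q ∈ E := mem_of_not_pierces h.sides ha hc hac hq hqa hqc
    (GermIn.mono hg h.theta.subset_right) hnp
  have hQ := D.isArc hq
  have hσ : ∀ x ∈ D.arc vs q, x ∈ σ → x = D.vert vs := fun x hx hx' =>
    D.arc_inter_arc hq hb hqb ⟨hx, h.sigma_subset hx'⟩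
  have hC : ∀ x ∈ D.arc vs q, x ∈ D.arc vs c ∪ γ ∪ σ → x = D.vert vs ∨ x ∈ γ := by
    rintro x hx ((h1 | h1) | h1)
    exacts [Or.inl (D.arc_inter_arc hq hc hqc ⟨hx, h1⟩), Or.inr h1, Or.inl (hσ x hx h1)]
  by_cases hr : ∃ r, r ∈ D.arc vs q ∧ r ∈ γ
  · obtain ⟨r, hr, hrγ⟩ := hr
    have hrm := h.gamma_subset hrγ
    have rv : r ≠ D.vert vs := fun hh => D.vert_notMem hac ha hc (hh ▸ hrm)
    have rq : r ≠ D.vert q := fun hh => D.vert_notMem hac hqa hqc (hh ▸ hrm)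
    obtain ⟨P, Q, hP, hQ', e, i⟩ := hQ.exists_split hr rv rq
    have hdis : Disjoint (Q \ {r}) (D.triangle vs a c ∪ σ) := by
      rw [disjoint_left]
      rintro x ⟨hx, hxr⟩ hx'
      have hxs : x ∈ D.arc vs q := e ▸ Or.inr hx
      have hv : x ≠ D.vert vs := by
        rintro rfl
        have : D.vert vs ∈ P ∩ Q := ⟨hP.left_mem, hx⟩
        rw [i] at this
        exact hxr this
      rcases hx' with h1 | h1
      · rcases D.star_inter_triangle ha hc hq hqa hqc ⟨hxs, h1⟩ with h2 | h2
        · exact hv h2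
        · exact hxr (star_inter_mid_subsingleton hq hac ha hc ⟨hxs, h2⟩ ⟨hr, hrm⟩)
      · exact hv (hσ x hxs h1)
    have hqQ : D.vert q ∈ Q \ {r} := ⟨hQ'.right_mem, rq.symm⟩
    rcases h.theta.cover hqE with (h1 | h1) | h1
    · have h2 := h.theta.sides_left.subset_left_of_mem hQ'.isPreconnected_diff_left
        (hdis.mono_right h.boundary_left) hqQ h1
      have h3 : r ∈ closure Ea := hQ'.left_mem_closure h2
      rcases h.theta.inter_left ⟨h3, Or.inr hrγ⟩ with h4 | h4
      · exact (rv h4).elim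
      · rw [mem_singleton_iff] at h4
        exact (rv (D.arc_inter_arc hq hb hqb ⟨hr, h4 ▸ h.mem_star⟩)).elim
    · exact h1
    · exact (disjoint_left.1 hdis hqQ (Or.inr h1)).elim
  · refine h.theta.sides_right.subset_of_germIn hQ ?_ hg
      ⟨hQ.right_mem, fun hh => hq (D.vert_inj hh).symm⟩
    rintro x ⟨hx, hx'⟩
    exact (hC x hx hx').resolve_right fun hh => hr ⟨x, hx, hh⟩

lemma not_disjoint_stars (h : D.Cut vs a c b E O p σ τ α γ Ea Oa Ec Oc) (hac : a ≠ c)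
    (hb : vs ≠ b) (hba : b ≠ a) (hbc : b ≠ c) (hq : vs ≠ q)
    (hqa : q ≠ a) (hqc : q ≠ c) (hqb : q ≠ b) (hbE : D.vert b ∈ Ea) (hqE : D.vert q ∈ Ec)
    (hda : Disjoint (D.arc b q) (D.arc vs a)) : ¬ Disjoint (D.arc b q) (D.arc vs c) := by
  intro hdc
  have hσ := h.sigma_inter_edge hb hqb.symm hq
  have hB := D.isArc hqb.symm
  have hT : ∀ x ∈ D.arc b q, x ∈ D.triangle vs a c ∪ σ → x ∈ D.arc a c := by
    rintro x hx (((h1 | h1) | h1) | h1)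
    exacts [(disjoint_left.1 hda hx h1).elim, h1, (disjoint_left.1 hdc hx h1).elim,
      (disjoint_left.1 hσ hx h1).elim]
  by_cases hr : ∃ r, r ∈ D.arc b q ∧ r ∈ D.arc a c
  · obtain ⟨r, hr, hrm⟩ := hr
    have hu : ∀ x ∈ D.arc b q, x ∈ D.arc a c → x = r := fun x hx hx' =>
      D.inter_subsingleton b q a c hqb.symm hac (by simp [hba, hbc]) ⟨hx, hx'⟩ ⟨hr, hrm⟩
    have rb : r ≠ D.vert b := fun hh => D.vert_notMem hac hba hbc (hh ▸ hrm)
    have rq : r ≠ D.vert q := fun hh => D.vert_notMem hac hqa hqc (hh ▸ hrm)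
    obtain ⟨P, Q, hP, hQ, e, i⟩ := hB.exists_split hr rb rq
    have hPd : Disjoint (P \ {r}) (D.triangle vs a c ∪ σ) := by
      rw [disjoint_left]
      rintro x ⟨hx, hxr⟩ hx'
      have hxs : x ∈ D.arc b q := e ▸ Or.inl hx
      exact hxr (hu x hxs (hT x hxs hx'))
    have hQd : Disjoint (Q \ {r}) (D.triangle vs a c ∪ σ) := by
      rw [disjoint_left]
      rintro x ⟨hx, hxr⟩ hx'
      have hxs : x ∈ D.arc b q := e ▸ Or.inr hx
      exact hxr (hu x hxs (hT x hxs hx'))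
    have h1 := h.theta.sides_left.subset_left_of_mem hP.isPreconnected_diff_right
      (hPd.mono_right h.boundary_left) ⟨hP.left_mem, rb.symm⟩ hbE
    have h2 := h.theta.sides_right.subset_left_of_mem hQ.isPreconnected_diff_left
      (hQd.mono_right h.boundary_right) ⟨hQ.right_mem, rq.symm⟩ hqE
    have h3 : r ∈ closure Ea := hP.symm.left_mem_closure h1
    have h4 : r ∈ closure Ec := hQ.left_mem_closure h2
    have h5 : r = D.vert vs ∨ r = p := by
      rw [h.mid_eq] at hrm
      rcases hrm with hh | hh
      exacts [h.theta.inter_right ⟨h4, Or.inr hh⟩, h.theta.inter_left ⟨h3, Or.inr hh⟩]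
    rcases h5 with rfl | rfl
    · exact D.vert_notMem hqb.symm hb hq hr
    · exact disjoint_left.1 hσ hr h.arc_sigma.right_mem
  · have h1 := h.theta.sides_left.subset_left_of_mem hB.isPreconnected (disjoint_left.2
      fun x hx hx' => hr ⟨x, hx, hT x hx (h.boundary_left hx')⟩) hB.left_mem hbE
    exact disjoint_left.1 h.theta.disj (h1 hB.right_mem) hqE

end Cut

lemma star_subset_closure (ha : vs ≠ a) (hc : vs ≠ c) (hac : a ≠ c) (hb : vs ≠ b)
    (hba : b ≠ a) (hbc : b ≠ c) (hs : Sides (D.triangle vs a c) U V)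
    (he : D.EmanatesInto vs b U) (hbU : D.vert b ∈ U) : D.arc vs b ⊆ closure U := by
  by_cases hd : Disjoint (D.arc vs b) (D.arc a c)
  · intro x hx
    by_cases hxv : x = D.vert vs
    · exact hxv ▸ hs.subset_left (Or.inr (D.isArc hc).left_mem)
    · exact subset_closure (star_subset_of_disjoint ha hc hb hba hbc hs hd he ⟨hx, hxv⟩)
  · rw [not_disjoint_iff] at hd
    obtain ⟨p, hp, hp'⟩ := hd
    obtain ⟨σ, τ, α, γ, Ea, Oa, Ec, Oc, h⟩ := exists_cut ha hc hac hb hba hbc hs he hp hp'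
    have hτ := hs.subset_left_of_mem h.arc_tau.isPreconnected_diff_left
      ((h.tau_disjoint ha hc hac hb hba hbc).mono_right subset_union_left)
      ⟨h.arc_tau.right_mem, h.arc_tau.ne.symm⟩ hbU
    rw [h.star_eq]
    refine union_subset (fun x hx => closure_mono h.theta.subset_left
      (h.theta.sides_left.subset_left (Or.inr hx))) fun x hx => ?_
    by_cases hxp : x = p
    · exact hxp ▸ hs.subset_left (Or.inl (Or.inr hp'))
    · exact subset_closure (hτ ⟨hx, hxp⟩)

lemma Cut.pierces_of_mem_right (h : D.Cut vs a c b E O p σ τ α γ Ea Oa Ec Oc) (ha : vs ≠ a)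
    (hc : vs ≠ c) (hac : a ≠ c) (hb : vs ≠ b) (hba : b ≠ a) (hbc : b ≠ c)
    (hbE : D.vert b ∈ Ec) : D.Pierces vs a b c := by
  by_contra hnp
  have key : ∀ {X X'}, Sides (D.triangle vs a b) X X' → D.EmanatesInto vs c X → False := by
    intro X X' hX he
    have hcX := mem_of_not_pierces hX ha hb hba.symm hc hac.symm hbc.symm he hnp
    have h1 := star_subset_closure ha hb hba.symm hc hac.symm hbc.symm hX he hcX
    have h2 : γ \ {p} ⊆ X := by
      refine hX.subset_left_of_mem h.arc_gamma.isPreconnected_diff_right ?_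
        ⟨h.arc_gamma.left_mem, h.arc_gamma.ne⟩ hcX
      rw [disjoint_left]
      rintro x ⟨hx, hxp⟩ hxT
      have hxm := h.gamma_subset hx
      have hxa : x ≠ D.vert a := fun hh => h.symm.notMem_alpha (hh ▸ hx)
      rcases hxT with (h3 | h3) | h3
      · rw [D.arc_symm] at h3
        exact hxa (D.arc_inter_arc hac ha.symm hc.symm ⟨hxm, h3⟩)
      · exact hxa (D.arc_inter_arc hac hba.symm hbc.symm ⟨hxm, h3⟩)
      · exact hxp (star_inter_mid_subsingleton hb hac ha hc ⟨h3, hxm⟩ ⟨h.mem_star, h.mem_mid⟩)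
    have hstar : D.arc vs b ⊆ closure X := fun x hx => hX.subset_left (Or.inr hx)
    have h3 : D.arc vs c ∪ γ ∪ σ ⊆ closure X := by
      refine union_subset (union_subset h1 fun x hx => ?_) (h.sigma_subset.trans hstar)
      by_cases hxp : x = p
      · exact hstar (hxp ▸ h.mem_star)
      · exact subset_closure (h2 ⟨hx, hxp⟩)
    rcases h.theta.sides_right.closure_subset_or hX.conn_right
      (hX.subset_closure_iff.1 h3).symm with h4 | h4
    · exact ha (D.vert_inj (h.closure_right_inter hb ha hba
        ⟨h4 (hX.subset_right (Or.inl (Or.inl (D.isArc ha).right_mem))),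
          (D.isArc ha).right_mem⟩)).symm
    · exact disjoint_left.1 h.theta.sides_right.symm.closure_disj
        (h4 (hX.subset_right (Or.inr (D.isArc hb).right_mem))) hbE
  obtain ⟨X, X', hX⟩ := D.exists_sides ha hb hba.symm
  rcases germ_or ha hb hba.symm hc hac.symm hbc.symm hX with h1 | h1
  exacts [key hX h1, key hX.symm h1]

end SimpleDrawing

namespace SimpleDrawing

variable {n : ℕ} {D : SimpleDrawing n} {vs a b c : Fin n}

lemma disjoint_of_not_crosses (ha : vs ≠ a) (hb : vs ≠ b) (hac : a ≠ c) (hbc : b ≠ c)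
    (h : ¬ D.Crosses s(a, b) s(c, vs)) : Disjoint (D.arc vs c) (D.arc a b) := by
  rw [disjoint_left]
  intro p hp hp'
  refine h ⟨by simp [hac, ha.symm], p, ⟨hp', by rw [D.arc_symm] at hp; exact hp⟩, ?_⟩
  rintro ⟨q, hq, hq', -⟩
  rw [Sym2.mem_iff] at hq hq'
  rcases hq with rfl | rfl <;> rcases hq' with rfl | rfl <;> contradiction

lemma Crosses.ne_and_exists (h : D.Crosses s(a, b) s(c, vs)) (ha : vs ≠ a) (hb : vs ≠ b)
    (hab : a ≠ b) : c ≠ a ∧ c ≠ b ∧ ∃ p, p ∈ D.arc vs c ∧ p ∈ D.arc a b := by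
  obtain ⟨-, p, ⟨hp, hp'⟩, hn⟩ := h
  have h1 : p ∈ D.arc a b := hp
  have h2 : p ∈ D.arc c vs := hp'
  refine ⟨?_, ?_, p, by rw [D.arc_symm]; exact h2, h1⟩
  · rintro rfl
    exact hn ⟨c, by simp, by simp, D.arc_inter_arc hab ha.symm hb.symm ⟨h1, h2⟩⟩
  · rintro rfl
    rw [D.arc_symm] at h1
    exact hn ⟨c, by simp, by simp, D.arc_inter_arc hab.symm hb.symm ha.symm ⟨h1, h2⟩⟩

lemma IsRotationLabeling.ne {lab : Fin (n - 1) → Fin n} (h : D.IsRotationLabeling vs lab)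
    (i : Fin (n - 1)) : vs ≠ lab i := by
  have : lab i ∈ {x | x ≠ vs} := h.2.1 ▸ mem_range_self i
  exact this.symm

lemma val_finCycSucc {m : ℕ} (i : Fin m) : ((i : ℕ) + 1 < m ∧ (finCycSucc i : ℕ) = i + 1) ∨
    ((i : ℕ) + 1 = m ∧ (finCycSucc i : ℕ) = 0) := by
  have := i.isLt
  rcases (show (i : ℕ) + 1 < m ∨ (i : ℕ) + 1 = m by omega) with h | h
  · exact Or.inl ⟨h, Nat.mod_eq_of_lt h⟩
  · exact Or.inr ⟨h, by simp [finCycSucc, h]⟩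

lemma exists_finCycSucc_eq {m : ℕ} (i : Fin m) : ∃ j, finCycSucc j = i := by
  have := i.isLt
  by_cases h : (i : ℕ) = 0
  · refine ⟨⟨m - 1, by omega⟩, Fin.ext ?_⟩
    rcases val_finCycSucc (⟨m - 1, by omega⟩ : Fin m) with h1 | h1 <;> simp only at h1 <;> omega
  · refine ⟨⟨i - 1, by omega⟩, Fin.ext ?_⟩
    rcases val_finCycSucc (⟨i - 1, by omega⟩ : Fin m) with h1 | h1 <;> simp only at h1 <;> omega

/-- The edge from `b` to `q` separates the star edge at `a` from the angle between `b` and `c`,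
`q` being a vertex in that angle, or `c` itself. -/
def Shielded (D : SimpleDrawing n) (vs a c b q : Fin n) : Prop :=
  Disjoint (D.arc b q) (D.arc vs a) ∧ (q = c ∨
    vs ≠ q ∧ q ≠ a ∧ q ≠ c ∧ q ≠ b ∧ D.Sep vs b c q a ∧ ¬ D.Pierces vs a c q ∧
      Disjoint (D.arc b q) (D.arc vs c))

lemma Cut.notMem_left {b q : Fin n} {p : ℝ × ℝ} {E O σ τ α γ Ea Oa Ec Oc : Set (ℝ × ℝ)}
    (h : D.Cut vs a c b E O p σ τ α γ Ea Oa Ec Oc) (ha : vs ≠ a) (hc : vs ≠ c) (hac : a ≠ c)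
    (hb : vs ≠ b) (hba : b ≠ a) (hbc : b ≠ c) (hq : D.Shielded vs a c b q) :
    D.vert b ∉ Ea := by
  intro hbE
  obtain ⟨hd, rfl | ⟨hq, hqa, hqc, hqb, hsep, hnp, hd'⟩⟩ := hq
  · exact h.not_disjoint_star hc hac hb hba hbc hbE hd
  · exact h.not_disjoint_stars hac hb hba hbc hq hqa hqc hqb hbE
      (h.vert_mem_right ha hc hac hb hba hbc hq hqa hqc hqb hsep hnp) hd hd'

lemma false_of_shielded {q : Fin n} {p : ℝ × ℝ} (ha : vs ≠ a) (hc : vs ≠ c)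
    (hac : a ≠ c) (hb : vs ≠ b) (hba : b ≠ a) (hbc : b ≠ c) (hp : p ∈ D.arc vs b)
    (hp' : p ∈ D.arc a c) (hnp : ¬ D.Pierces vs a c b) (hq : D.Shielded vs a c b q)
    (hr : ¬ D.Pierces vs a b c ∨ ∃ r, D.Shielded vs c a b r) : False := by
  have key : ∀ {E O}, Sides (D.triangle vs a c) E O → D.EmanatesInto vs b E → False := by
    intro E O hs he
    obtain ⟨σ, τ, α, γ, Ea, Oa, Ec, Oc, hcut⟩ := exists_cut ha hc hac hb hba hbc hs he hp hp'
    have hbE := mem_of_not_pierces hs ha hc hac hb hba hbc he hnp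
    rcases hcut.theta.cover hbE with (h | h) | h
    · exact hcut.notMem_left ha hc hac hb hba hbc hq h
    · rcases hr with hr | ⟨r, hr⟩
      · exact hr (hcut.pierces_of_mem_right ha hc hac hb hba hbc h)
      · exact hcut.symm.notMem_left hc ha hac.symm hb hbc hba hr h
    · exact hcut.notMem_sigma h
  obtain ⟨U, V, hs⟩ := D.exists_sides ha hc hac
  rcases germ_or ha hc hac hb hba hbc hs with h | h
  exacts [key hs h, key hs.symm h]

lemma IsRotationLabeling.shielded {lab : Fin (n - 1) → Fin n}
    (hlab : D.IsRotationLabeling vs lab) {i j k q : Fin (n - 1)} (hki : k ≠ i)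
    (hkj : k ≠ j) (hkq : k ≠ q) (hqi : q ≠ i)
    (hd : ∀ l, ¬ D.Crosses s(lab k, lab q) s(lab l, vs))
    (hq : q ≠ j → ¬ D.Pierces vs (lab i) (lab j) (lab q) ∧
      (CyclicOrdered k q j i ∨ CyclicOrdered i j q k)) :
    D.Shielded vs (lab i) (lab j) (lab k) (lab q) := by
  have hv := hlab.ne
  have hne : ∀ {i j}, i ≠ j → lab i ≠ lab j := fun h => hlab.1.ne h
  have hdis : ∀ l, l ≠ k → l ≠ q → Disjoint (D.arc (lab k) (lab q)) (D.arc vs (lab l)) :=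
    fun l h1 h2 => (disjoint_of_not_crosses (hv _) (hv _) (hne h1.symm) (hne h2.symm)
      (hd l)).symm
  refine ⟨hdis i hki.symm hqi.symm, ?_⟩
  by_cases h : q = j
  · exact Or.inl (h ▸ rfl)
  · obtain ⟨h1, h2⟩ := hq h
    exact Or.inr ⟨hv _, hne hqi, hne h, hne hkq.symm, hlab.sep h2, h1, hdis j hkj.symm (Ne.symm h)⟩

/-- Every bad edge has a witness whose star edge pierces the triangle of the bad edge. -/
lemma IsRotationLabeling.exists_pierces {lab : Fin (n - 1) → Fin n}
    (hlab : D.IsRotationLabeling vs lab) (hside : ∀ x w, D.BadWitness vs lab x w → w < x)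
    (hnest : ∀ x x' w w', D.BadWitness vs lab x w → D.BadWitness vs lab x' w' → x < x' → w' < w)
    {v w : Fin (n - 1)} (hb : D.BadWitness vs lab v w) :
    ∃ w', D.Pierces vs (lab v) (lab (finCycSucc v)) (lab w') ∧ D.BadWitness vs lab v w' := by
  have hv := hlab.ne
  have hne : ∀ {i j}, i ≠ j → lab i ≠ lab j := fun h => hlab.1.ne h
  have hwv := hside v w hb
  have hxv := val_finCycSucc v
  have hvx : v ≠ finCycSucc v := by omega
  obtain ⟨-, hwx', p, hp, hp'⟩ := hb.ne_and_exists (hv _) (hv _) (hne hvx)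
  by_contra! hcon
  have hnp : ∀ k, k ≠ v → k ≠ finCycSucc v → ¬ D.Pierces vs (lab v) (lab (finCycSucc v)) (lab k) :=
    fun k h1 h2 hk => not_pierces_of_disjoint (hv _) (hv _) (hv _) (hne h1) (hne h2)
      (disjoint_of_not_crosses (hv _) (hv _) (hne h1.symm) (hne h2.symm) (hcon k hk)) hk
  have hr : ∀ k, ¬ D.BadWitness vs lab w k := fun k hk => by
    have h1 := hnest _ _ _ _ hk hb hwv
    have h2 := hside _ _ hk
    omega
  obtain ⟨l, hlw⟩ := exists_finCycSucc_eq w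
  have hl : ∀ k, ¬ D.BadWitness vs lab l k := fun k hk => by
    have h2 := hside _ _ hk
    have h3 := val_finCycSucc l
    rw [hlw] at h3
    rcases lt_trichotomy l v with h | rfl | h
    · have h1 := hnest _ _ _ _ hk hb h
      omega
    · exact hwx' (hlw ▸ rfl)
    · have h1 := hnest _ _ _ _ hb hk h
      omega
  have hl' : ∀ k, ¬ D.Crosses s(lab w, lab l) s(lab k, vs) := fun k hk => by
    refine hl k ?_
    rwa [BadWitness, hlw, Sym2.eq_swap]
  unfold BadWitness at hr
  have hrw := val_finCycSucc w
  have hlw' := val_finCycSucc l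
  rw [hlw] at hlw'
  have hwx : w ≠ finCycSucc v := fun h => hwx' (h ▸ rfl)
  generalize finCycSucc v = x at *
  generalize finCycSucc w = r at *
  clear hb hside hnest hcon
  refine false_of_shielded (hv v) (hv x) (hne hvx) (hv w) (hne hwv.ne) (hne hwx) hp hp'
    (hnp w hwv.ne hwx) (q := lab l) (hlab.shielded hwv.ne hwx ?_ ?_ hl' fun h =>
      ⟨hnp l ?_ h, Or.inr ?_⟩)
    (Or.inr ⟨lab r, hlab.shielded hwx hwv.ne ?_ ?_ hr fun h =>
      ⟨fun hh => hnp r h ?_ hh.symm, Or.inl ?_⟩⟩)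
  all_goals clear hp hp' hnp hr hl hl' hv hne hlab
  all_goals first | (simp only [CyclicOrdered, Fin.lt_def]; omega) | omega

lemma IsRotationLabeling.not_pierces_across (hD : D.Convex) {lab : Fin (n - 1) → Fin n}
    (hlab : D.IsRotationLabeling vs lab) {u w s x z y : Fin (n - 1)}
    (hp : D.Pierces vs (lab s) (lab x) (lab w))
    (hn : ∀ k, k = u ∨ k = y ∨ k = z → ¬ D.Crosses s(lab s, lab x) s(lab k, vs))
    (uw : u ≠ w) (us : u ≠ s) (ux : u ≠ x) (uz : u ≠ z) (uy : u ≠ y) (ws : w ≠ s) (wx : w ≠ x)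
    (wz : w ≠ z) (wy : w ≠ y) (sx : s ≠ x) (sz : s ≠ z) (sy : s ≠ y) (xy : x ≠ y) (zy : z ≠ y)
    (su : CyclicOrdered w u x s ∨ CyclicOrdered s x u w)
    (sy' : CyclicOrdered w y x s ∨ CyclicOrdered s x y w)
    (sz' : z ≠ x → CyclicOrdered w z x s ∨ CyclicOrdered s x z w)
    (su' : z ≠ x → CyclicOrdered z s w u ∨ CyclicOrdered u w s z)
    (sw : z ≠ x → CyclicOrdered u y z w ∨ CyclicOrdered w z y u) :
    ¬ D.Pierces vs (lab u) (lab y) (lab z) := by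
  have hv := hlab.ne
  have hne : ∀ {i j}, i ≠ j → lab i ≠ lab j := fun h => hlab.1.ne h
  have hx : ∀ {k}, lab k ≠ lab x → k ≠ x := fun h h' => h (h' ▸ rfl)
  have hd : ∀ k, k = u ∨ k = y ∨ k = z → k ≠ s → k ≠ x →
      Disjoint (D.arc vs (lab k)) (D.arc (lab s) (lab x)) := fun k h h1 h2 =>
    disjoint_of_not_crosses (hv _) (hv _) (hne h1.symm) (hne h2.symm) (hn k h)
  exact fun hz => Pierces.not_pierces_across hD hp hz (hv _) (hv _) (hv _) (hv _) (hv _) (hv _)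
    (hne uw) (hne us) (hne ux) (hne uz) (hne uy) (hne ws) (hne wx) (hne wz) (hne wy) (hne sx)
    (hne sz) (hne sy) (hne xy) (hne zy) (hd u (by simp) us ux) (hd y (by simp) sy.symm xy.symm)
    (fun h => hd z (by simp) sz.symm (hx h)) (hlab.sep su) (hlab.sep sy')
    (fun h => hlab.sep (sz' (hx h))) (fun h => hlab.sep (su' (hx h)))
    (fun h => hlab.sep (sw (hx h)))

end SimpleDrawing

/-- With `m ≥ 2` bad edges as in the standard labeling (sidedness and nestedness), and the
blocks `L i = {x | wR (i+1) < x < wL i}` and `R i = {x | v i + 1 ≤ x ≤ v (i+1)}`: no edge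
`{lab u, lab y}` with `u ∈ L i` and `y ∈ R i` crosses a star edge `{lab z, vs}` with
`z ∈ R i`. -/
theorem no_crossing_in_right_block (n : ℕ) (D : SimpleDrawing n) (hD : D.Convex)
    (vs : Fin n) (lab : Fin (n - 1) → Fin n) (hlab : D.IsRotationLabeling vs lab)
    (m : ℕ) (hm : 2 ≤ m) (v wL wR : ℕ → Fin (n - 1))
    (hmono : ∀ i j, i < j → j < m → v i < v j)
    (hbadall : ∀ x w, D.BadWitness vs lab x w → ∃ i, i < m ∧ x = v i)
    (hwitL : ∀ i, i < m → D.BadWitness vs lab (v i) (wL i))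
    (hwitR : ∀ i, i < m → D.BadWitness vs lab (v i) (wR i))
    (hwitLR : ∀ i, i < m → ∀ w, D.BadWitness vs lab (v i) w → wL i ≤ w ∧ w ≤ wR i)
    (hside : ∀ x w, D.BadWitness vs lab x w → w < x)
    (hnest : ∀ x x' w w', D.BadWitness vs lab x w → D.BadWitness vs lab x' w' → x < x' → w' < w)
    :
    ∀ i, i + 1 < m → ∀ u y z : Fin (n - 1),
      (wR (i+1) < u ∧ u < wL i) →
      (finCycSucc (v i) ≤ y ∧ y ≤ v (i+1)) →
      (finCycSucc (v i) ≤ z ∧ z ≤ v (i+1)) →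
      ¬D.Crosses s(lab u, lab y) s(lab z, vs) := by
  have hvs := hlab.ne
  intro i hi u y z ⟨hu1, hu2⟩ ⟨hy1, hy2⟩ ⟨hz1, hz2⟩ hcr
  obtain ⟨w₁, hp₁, hw₁⟩ := hlab.exists_pierces hside hnest (hwitL i (by omega))
  obtain ⟨w₂, hp₂, hw₂⟩ := hlab.exists_pierces hside hnest (hwitL (i + 1) hi)
  have hst := hmono i (i + 1) (by omega) hi
  have l₁ := (hwitLR i (by omega) w₁ hw₁).1
  have l₂ := (hwitLR (i + 1) hi w₂ hw₂).2
  have d₁ := hside _ _ hw₁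
  have d₂ := hside _ _ hw₂
  have e₁ := SimpleDrawing.val_finCycSucc (v i)
  have e₂ := SimpleDrawing.val_finCycSucc (v (i + 1))
  have hns₁ : ∀ k, k = u ∨ finCycSucc (v i) ≤ k → ¬ D.BadWitness vs lab (v i) k := by
    intro k hk hb
    have h1 := (hwitLR i (by omega) k hb).1
    have h2 := hside _ _ hb
    rcases hk with rfl | hk <;> omega
  have hns₂ : ∀ k, u ≤ k → ¬ D.BadWitness vs lab (v (i + 1)) k := by
    intro k hk hb
    have := (hwitLR (i + 1) hi k hb).2
    omega
  have hgood : ∀ k, finCycSucc (v i) ≤ k → k < v (i + 1) → ∀ w, ¬ D.BadWitness vs lab k w := by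
    intro k hk1 hk2 w hb
    obtain ⟨j, hj, rfl⟩ := hbadall k w hb
    rcases lt_trichotomy j i with h | rfl | h
    · have := hmono j i h (by omega)
      omega
    · omega
    · rcases (show j = i + 1 ∨ i + 1 < j by omega) with rfl | h
      · omega
      · have := hmono (i + 1) j h hj
        omega
  have hx₂ : w₂ ≠ finCycSucc (v (i + 1)) := by
    have := hvs w₂
    have := hw₂.ne_and_exists (hvs _) (hvs _) (hlab.1.ne (show v (i + 1) ≠ _ by omega))
    exact fun h => this.2.1 (h ▸ rfl)
  generalize wR (i + 1) = r at *
  generalize wL i = l at *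
  unfold SimpleDrawing.BadWitness at hns₁ hns₂ hgood
  generalize hx : finCycSucc (v i) = x at *
  generalize v i = s at *
  generalize hx' : finCycSucc (v (i + 1)) = x₂ at *
  generalize v (i + 1) = s₂ at *
  clear hbadall hwitL hwitR hwitLR hside hnest hmono hw₁ hw₂
  have hnp : ∀ y z, x ≤ y ∧ y ≤ s₂ → x ≤ z ∧ z ≤ s₂ → y ≠ z →
      ¬ D.Pierces vs (lab u) (lab y) (lab z) := by
    intro y z hy hz hyz
    rcases lt_or_gt_of_ne hyz with h | h
    · refine hlab.not_pierces_across hD (w := w₂) (s := x₂) (x := s₂) hp₂.symm ?_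
        ?_ ?_ ?_ ?_ ?_ ?_ ?_ ?_ ?_ ?_ ?_ ?_ ?_ ?_ (Or.inl ?_) (Or.inl ?_) (fun _ => Or.inl ?_)
        (fun _ => Or.inl ?_) (fun _ => Or.inl ?_)
      · intro k hk
        rw [Sym2.eq_swap]
        exact hns₂ k (by rcases hk with rfl | rfl | rfl <;> omega)
      all_goals clear hp₁ hp₂ hns₁ hns₂ hgood hcr
      all_goals first | (simp only [CyclicOrdered, Fin.lt_def]; omega) | omega
    · refine hlab.not_pierces_across hD (w := w₁) (s := s) (x := x) hp₁ ?_
        ?_ ?_ ?_ ?_ ?_ ?_ ?_ ?_ ?_ ?_ ?_ ?_ ?_ ?_ (Or.inr ?_) (Or.inr ?_) (fun _ => Or.inr ?_)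
        (fun _ => Or.inr ?_) (fun _ => Or.inr ?_)
      · exact fun k hk => hns₁ k (by rcases hk with rfl | rfl | rfl <;> omega)
      all_goals clear hp₁ hp₂ hns₁ hns₂ hgood hcr
      all_goals first | (simp only [CyclicOrdered, Fin.lt_def]; omega) | omega
  have huy : u ≠ y := by omega
  have huz : z ≠ u := by omega
  obtain ⟨-, hzy, p, hp, hp'⟩ := hcr.ne_and_exists (hvs _) (hvs _) (hlab.1.ne huy)
  replace hzy : z ≠ y := fun h => hzy (h ▸ rfl)
  obtain ⟨q, hq, hqz, hqd, hqo⟩ : ∃ q, (x ≤ q ∧ q ≤ s₂) ∧ z ≠ q ∧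
      (∀ k, ¬ D.Crosses s(lab z, lab q) s(lab k, vs)) ∧
      (q ≠ y → CyclicOrdered z q y u ∨ CyclicOrdered u y q z) := by
    clear hp₁ hp₂ hns₁ hns₂ hcr hp hp' hnp
    rcases lt_or_gt_of_ne hzy with h | h
    · have e := SimpleDrawing.val_finCycSucc z
      refine ⟨finCycSucc z, by omega, by omega, hgood z hz1 (by omega), fun _ => Or.inl ?_⟩
      simp only [CyclicOrdered, Fin.lt_def]
      omega
    · obtain ⟨q, rfl⟩ := SimpleDrawing.exists_finCycSucc_eq z
      have e := SimpleDrawing.val_finCycSucc q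
      refine ⟨q, by omega, by omega, fun k => ?_, fun _ => Or.inr ?_⟩
      · rw [Sym2.eq_swap]
        exact hgood q (by omega) (by omega) k
      · simp only [CyclicOrdered, Fin.lt_def]
        omega
  have hnp' : ¬ D.Pierces vs (lab u) (lab z) (lab y) := hnp z y ⟨hz1, hz2⟩ ⟨hy1, hy2⟩ hzy
  exact SimpleDrawing.false_of_shielded (hvs u) (hvs y) (hlab.1.ne huy) (hvs z) (hlab.1.ne huz)
    (hlab.1.ne hzy) hp hp' (hnp y z ⟨hy1, hy2⟩ ⟨hz1, hz2⟩ hzy.symm)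
    (hlab.shielded huz hzy hqz (by omega) hqd fun h =>
      ⟨hnp y q ⟨hy1, hy2⟩ hq h.symm, hqo h⟩) (Or.inl hnp')
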